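/- Let K be an n-polytope in ℝ^n and let K_t be the polytope obtained from K by moving one fixed facet by t, with δ > 0 as in the support lemma. Suppose K satisfies V(L,K_t,K[n−2])·V_n(K) ≤ V(L,K[n−1])·V(K_t,K[n−1]) for all convex bodies L and all t ∈ (−δ,δ). Then for all 0 ≤ r ≤ n−1 and all t ∈ (−δ,δ): S(K_t[r],K[n−1−r],·) = (V(K_t,K[n−1])/V_n(K))^r · S(K,·). -/

import Mathlib

open Pointwise MeasureTheory RealInnerProductSpace

/-- The mixed volume of an `n`-tuple of sets in `ℝⁿ`, via the polarization formula. -/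
noncomputable def mixedVol (n : ℕ) (K : Fin n → Set (EuclideanSpace ℝ (Fin n))) : ℝ :=
  ((n.factorial : ℝ))⁻¹ *
    ∑ S : Finset (Fin n), (-1 : ℝ) ^ (n - S.card) * (volume (∑ i ∈ S, K i)).toReal

/-- A convex body: a nonempty compact convex set. -/
def IsConvexBody {n : ℕ} (K : Set (EuclideanSpace ℝ (Fin n))) : Prop :=
  Convex ℝ K ∧ IsCompact K ∧ K.Nonempty

/-- The support function `h_K(u) = sup {⟨x,u⟩ : x ∈ K}`. -/
noncomputable def suppFn {n : ℕ} (K : Set (EuclideanSpace ℝ (Fin n)))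
    (u : EuclideanSpace ℝ (Fin n)) : ℝ :=
  sSup ((fun x => ⟪x, u⟫) '' K)

/-- The polytope obtained from `K` (with facet normals `u j`) by moving the `i`-th facet by `t`. -/
noncomputable def movedPoly {n N : ℕ} (K : Set (EuclideanSpace ℝ (Fin n)))
    (u : Fin N → EuclideanSpace ℝ (Fin n)) (i : Fin N) (t : ℝ) :
    Set (EuclideanSpace ℝ (Fin n)) :=
  {x | ∀ j : Fin N, ⟪x, u j⟫ ≤ suppFn K (u j) + if j = i then t else 0}

/-- The support of a measure: points all of whose open neighborhoods have nonzero measure. -/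
def msupport {α : Type*} [TopologicalSpace α] [MeasurableSpace α] (μ : Measure α) : Set α :=
  {x | ∀ U : Set α, IsOpen U → x ∈ U → μ U ≠ 0}

/-- A measure `μ` on the unit sphere is the mixed area measure `S(Kt[r],K[n-1-r],·)` if
`V(L,Kt[r],K[n-1-r]) = (1/n) ∫ h_L dμ` for every convex body `L`. -/
def IsMixedAreaMeasure (n : ℕ) (r : ℕ) (Kt K : Set (EuclideanSpace ℝ (Fin n)))
    (μ : Measure (Metric.sphere (0 : EuclideanSpace ℝ (Fin n)) 1)) : Prop :=
  ∀ L : Set (EuclideanSpace ℝ (Fin n)), IsConvexBody L →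
    mixedVol n (fun j : Fin n => if (j : ℕ) = 0 then L else if (j : ℕ) ≤ r then Kt else K)
      = (1 / n) * ∫ w : Metric.sphere (0 : EuclideanSpace ℝ (Fin n)) 1,
          suppFn L (w : EuclideanSpace ℝ (Fin n)) ∂μ

section LinearProgramming

variable {ι F : Type*} [Fintype ι] [AddCommGroup F] [Module ℝ F]

/-- The points that are positive combinations of the vectors `w b`, `b ∈ B`. -/
def openCone (w : ι → F) (B : Finset ι) : Set F :=
  {z | ∃ y : ι → ℝ, (∀ v ∈ B, 0 < y v) ∧ (∀ v ∉ B, y v = 0) ∧ ∑ v, y v • w v = z}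

/-- Strict dual feasibility of the set `B` of columns `w` for the cost `f`: every column outside
`B` is strictly more expensive than its expression through the columns in `B`. -/
def DualFeasible [DecidableEq ι] (w : ι → F) (f : Module.Dual ℝ (ι → ℝ)) (B : Finset ι) : Prop :=
  ∀ v ∉ B, ∀ c : ι → ℝ, (∀ b ∉ B, c b = 0) → ∑ b, c b • w b = w v → 0 < f (Pi.single v 1 - c)

lemma eq_zero_of_linearIndepOn {w : ι → F} {B : Finset ι} (hB : LinearIndepOn ℝ w (B : Set ι))
    {c : ι → ℝ} (hc : ∀ b ∉ B, c b = 0) (h : ∑ b, c b • w b = 0) : c = 0 := by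
  classical
  have h1 : ∑ b ∈ B, c b • w b = 0 := by
    rw [← h]
    refine Finset.sum_subset (Finset.subset_univ _) fun x _ hx => ?_
    rw [hc x hx, zero_smul]
  ext b
  by_cases hb : b ∈ B
  · exact linearIndepOn_finset_iff.1 hB c h1 b hb
  · exact hc b hb

lemma exists_coeff_of_mem_span {w : ι → F} {B : Finset ι} {x : F}
    (hx : x ∈ Submodule.span ℝ (w '' (B : Set ι))) :
    ∃ c : ι → ℝ, (∀ b ∉ B, c b = 0) ∧ ∑ b, c b • w b = x := by
  classical
  obtain ⟨c, hc, hcs⟩ := (Finsupp.mem_span_image_iff_linearCombination ℝ).1 hx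
  refine ⟨c, fun b hb => ?_, ?_⟩
  · by_contra h
    exact hb (by simpa using hc (Finsupp.mem_support_iff.2 h))
  · rw [← hcs, Finsupp.linearCombination_apply, Finsupp.sum_fintype]
    simp

lemma exists_generic_cost [DecidableEq ι] (w : ι → F) :
    ∃ f : Module.Dual ℝ (ι → ℝ), ∀ (B : Finset ι) (v : ι) (c : ι → ℝ),
      LinearIndepOn ℝ w (B : Set ι) → v ∉ B → (∀ b ∉ B, c b = 0) → ∑ b, c b • w b = w v →
      f (Pi.single v 1 - c) ≠ 0 := by
  classical
  let P : Finset ι × ι → (ι → ℝ) → Prop := fun p c =>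
    p.2 ∉ p.1 ∧ (∀ b ∉ p.1, c b = 0) ∧ ∑ b, c b • w b = w p.2
  let rel : Finset ι × ι → (ι → ℝ) := fun p =>
    if h : ∃ c, P p c then Pi.single p.2 1 - h.choose else Pi.single p.2 1
  have hrel : ∀ p, rel p ≠ 0 := by
    intro p hp
    have := congrFun hp p.2
    by_cases h : ∃ c, P p c
    · simp only [rel, h, dite_true, Pi.sub_apply, Pi.single_eq_same, Pi.zero_apply] at this
      rw [h.choose_spec.2.1 _ h.choose_spec.1] at this
      norm_num at this
    · simp only [rel, h, dite_false, Pi.single_eq_same, Pi.zero_apply] at this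
      norm_num at this
  obtain ⟨f, hf⟩ := Module.exists_dual_forall_apply_ne_zero (K := ℝ) rel hrel
  refine ⟨f, fun B v c hB hv hc hs => ?_⟩
  have h : ∃ c, P (B, v) c := ⟨c, hv, hc, hs⟩
  have hcc : h.choose = c := by
    have := eq_zero_of_linearIndepOn hB (c := h.choose - c) (fun b hb => by
      simp [h.choose_spec.2.1 b hb, hc b hb]) (by
      simp only [Pi.sub_apply, sub_smul, Finset.sum_sub_distrib, h.choose_spec.2.2, hs, sub_self])
    exact sub_eq_zero.1 this
  have := hf (B, v)
  simpa only [rel, h, dite_true, hcc] using this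

lemma cost_nonneg_of_optimal {w : ι → F} {f : Module.Dual ℝ (ι → ℝ)} {y c : ι → ℝ}
    (hy : ∀ v, 0 ≤ y v)
    (hopt : ∀ y' : ι → ℝ, (∀ v, 0 ≤ y' v) → ∑ v, y' v • w v = ∑ v, y v • w v → f y ≤ f y')
    (hc : ∑ v, c v • w v = 0) (hpos : ∀ v, y v = 0 → 0 ≤ c v) : 0 ≤ f c := by
  have h : ∀ v, ∀ᶠ e in nhdsWithin (0 : ℝ) (Set.Ioi 0), 0 ≤ y v + e * c v := by
    intro v
    rcases (hy v).eq_or_lt with h0 | h0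
    · filter_upwards [self_mem_nhdsWithin] with e he
      rw [← h0, zero_add]
      exact mul_nonneg (le_of_lt he) (hpos v h0.symm)
    · have : Filter.Tendsto (fun e : ℝ => y v + e * c v) (nhdsWithin 0 (Set.Ioi 0))
          (nhds (y v + 0 * c v)) :=
        (Continuous.tendsto (by fun_prop) 0).mono_left nhdsWithin_le_nhds
      rw [zero_mul, add_zero] at this
      filter_upwards [this.eventually (lt_mem_nhds h0)] with e he using he.le
  obtain ⟨e, he, he0⟩ := ((Filter.eventually_all.2 h).and self_mem_nhdsWithin).exists
  have h1 := hopt (y + e • c) (fun v => by simpa using he v) (by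
    simp [add_smul, Finset.sum_add_distrib, mul_smul, ← Finset.smul_sum, hc])
  rw [map_add, map_smul, smul_eq_mul] at h1
  have he0' : 0 < e := he0
  by_contra hneg
  push Not at hneg
  nlinarith [mul_neg_of_pos_of_neg he0' hneg]

lemma eq_of_mem_openCone [DecidableEq ι] {w : ι → F} {f : Module.Dual ℝ (ι → ℝ)} {B B' : Finset ι}
    (hB : LinearIndepOn ℝ w (B : Set ι)) (hBs : Submodule.span ℝ (w '' (B : Set ι)) = ⊤)
    (hBf : DualFeasible w f B) {y y' : ι → ℝ}
    (hy0 : ∀ v ∉ B, y v = 0) 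
    (hy' : ∀ v ∈ B', 0 < y' v) (hy0' : ∀ v ∉ B', y' v = 0)
    (h : ∑ v, y v • w v = ∑ v, y' v • w v) : f y ≤ f y' ∧ (¬ B' ⊆ B → f y < f y') := by
  have hex : ∀ v, ∃ c : ι → ℝ, (∀ b ∉ B, c b = 0) ∧ ∑ b, c b • w b = w v := fun v =>
    exists_coeff_of_mem_span (by rw [hBs]; trivial)
  choose c hc0 hcs using hex
  have hyn : ∀ v, 0 ≤ y' v := fun v => by
    by_cases hv : v ∈ B'
    · exact (hy' v hv).le
    · exact (hy0' v hv).ge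
  have hd : y' - y - ∑ v ∈ Bᶜ, y' v • (Pi.single v 1 - c v) = 0 := by
    apply eq_zero_of_linearIndepOn hB
    · intro b hb
      simp only [Pi.sub_apply, Finset.sum_apply, Pi.smul_apply, smul_eq_mul, hy0 b hb, hc0 _ b hb,
        sub_zero, Pi.single_apply, mul_ite, mul_one, mul_zero]
      rw [Finset.sum_ite_eq, if_pos (by simpa using hb), sub_self]
    · have hz : ∀ v, ∑ b, (Pi.single v (1 : ℝ) - c v : ι → ℝ) b • w b = 0 := fun v => by
        simp only [Pi.sub_apply, sub_smul, Finset.sum_sub_distrib, hcs, Pi.single_apply, ite_smul,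
          one_smul, zero_smul, Finset.sum_ite_eq', Finset.mem_univ, if_true, sub_self]
      let T : (ι → ℝ) →ₗ[ℝ] F := Fintype.linearCombination ℝ w
      have hT : ∀ a, ∑ b, a b • w b = T a := fun a => (Fintype.linearCombination_apply ℝ w a).symm
      simp only [hT] at hz h ⊢
      rw [map_sub, map_sub, map_sum, h]
      simp [hz, map_smul]
  have hf : f y' = f y + ∑ v ∈ Bᶜ, y' v * f (Pi.single v 1 - c v) := by
    have := congrArg f hd
    rw [map_sub, map_sub, map_sum, map_zero] at this
    simp only [map_smul, smul_eq_mul] at this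
    linarith
  have hpos : ∀ v ∈ Bᶜ, 0 ≤ y' v * f (Pi.single v 1 - c v) := fun v hv =>
    mul_nonneg (hyn v) (hBf v (by simpa using hv) (c v) (hc0 v) (hcs v)).le
  refine ⟨by rw [hf]; linarith [Finset.sum_nonneg hpos], fun hn => ?_⟩
  obtain ⟨v, hv', hv⟩ := Finset.not_subset.1 hn
  have : 0 < ∑ v ∈ Bᶜ, y' v * f (Pi.single v 1 - c v) :=
    Finset.sum_pos' hpos ⟨v, by simpa using hv,
      mul_pos (hy' v hv') (hBf v hv (c v) (hc0 v) (hcs v))⟩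
  linarith

lemma openCone_disjoint [DecidableEq ι] {w : ι → F} {f : Module.Dual ℝ (ι → ℝ)} {B B' : Finset ι}
    (hB : LinearIndepOn ℝ w (B : Set ι)) (hBs : Submodule.span ℝ (w '' (B : Set ι)) = ⊤)
    (hBf : DualFeasible w f B)
    (hB' : LinearIndepOn ℝ w (B' : Set ι)) (hBs' : Submodule.span ℝ (w '' (B' : Set ι)) = ⊤)
    (hBf' : DualFeasible w f B') (hne : B ≠ B') : Disjoint (openCone w B) (openCone w B') := by
  rw [Set.disjoint_left]
  rintro z ⟨y, hy, hy0, rfl⟩ ⟨y', hy', hy0', h⟩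
  have h1 := eq_of_mem_openCone hB hBs hBf hy0 hy' hy0' h.symm
  have h2 := eq_of_mem_openCone hB' hBs' hBf' hy0' hy hy0 h
  apply hne
  apply Finset.Subset.antisymm
  · by_contra hn; linarith [h2.2 hn, h1.1]
  · by_contra hn; linarith [h1.2 hn, h2.1]

lemma exists_mem_openCone [DecidableEq ι] {w : ι → F} {f : Module.Dual ℝ (ι → ℝ)}
    (hf : ∀ (B : Finset ι) (v : ι) (c : ι → ℝ),
      LinearIndepOn ℝ w (B : Set ι) → v ∉ B → (∀ b ∉ B, c b = 0) → ∑ b, c b • w b = w v →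
      f (Pi.single v 1 - c) ≠ 0) {z : F}
    (hne : {y : ι → ℝ | (∀ v, 0 ≤ y v) ∧ ∑ v, y v • w v = z}.Nonempty)
    (hcomp : IsCompact {y : ι → ℝ | (∀ v, 0 ≤ y v) ∧ ∑ v, y v • w v = z})
    (hz : ∀ (y : ι → ℝ) (T : Finset ι), (∀ v ∈ T, 0 < y v) → (∀ v ∉ T, y v = 0) →
      ∑ v, y v • w v = z → Submodule.span ℝ (w '' (T : Set ι)) = ⊤) :
    ∃ B : Finset ι, LinearIndepOn ℝ w (B : Set ι) ∧ Submodule.span ℝ (w '' (B : Set ι)) = ⊤ ∧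
      DualFeasible w f B ∧ z ∈ openCone w B := by
  obtain ⟨y, ⟨hy0, hyz⟩, hmin⟩ := hcomp.exists_isMinOn hne
    (LinearMap.continuous_of_finiteDimensional f).continuousOn
  have hopt : ∀ y' : ι → ℝ, (∀ v, 0 ≤ y' v) → ∑ v, y' v • w v = ∑ v, y v • w v → f y ≤ f y' :=
    fun y' h0 h => hmin ⟨h0, h.trans hyz⟩
  let T : Finset ι := Finset.univ.filter fun v => 0 < y v
  have hT : ∀ v ∈ T, 0 < y v := fun v hv => (Finset.mem_filter.1 hv).2
  have hT0 : ∀ v ∉ T, y v = 0 := fun v hv => by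
    by_contra h
    exact hv (Finset.mem_filter.2 ⟨Finset.mem_univ _, lt_of_le_of_ne (hy0 v) (Ne.symm h)⟩)
  have hsum : ∀ (v : ι) (c : ι → ℝ), ∑ b, c b • w b = w v →
      ∑ b, (Pi.single v (1 : ℝ) - c : ι → ℝ) b • w b = 0 := fun v c hc => by
    simp only [Pi.sub_apply, sub_smul, Finset.sum_sub_distrib, hc, Pi.single_apply, ite_smul,
      one_smul, zero_smul, Finset.sum_ite_eq', Finset.mem_univ, if_true, sub_self]
  have hspan := hz y T hT hT0 hyz
  have hind : LinearIndepOn ℝ w (T : Set ι) := by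
    obtain ⟨C, hCT, hCmax⟩ : ∃ C : Set ι, C ⊆ T ∧ Maximal (fun s => s ⊆ (T : Set ι) ∧ LinearIndepOn ℝ w s) C := by
      obtain ⟨C, -, hC⟩ := Set.Finite.exists_le_maximal
        (s := {s : Set ι | s ⊆ (T : Set ι) ∧ LinearIndepOn ℝ w s}) (Set.toFinite _) (a := ∅)
        ⟨Set.empty_subset _, linearIndepOn_empty ℝ w⟩
      exact ⟨C, hC.prop.1, hC⟩
    have hC := hCmax.prop.2
    by_cases hTC : (T : Set ι) ⊆ C
    · exact hC.mono hTC
    exfalso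
    obtain ⟨v, hvT, hvC⟩ := Set.not_subset.1 hTC
    have hmem : w v ∈ Submodule.span ℝ (w '' C) := by
      by_contra hmem
      have : LinearIndepOn ℝ w (insert v C) := hC.insert hmem
      exact hvC (hCmax.2 ⟨Set.insert_subset hvT hCT, this⟩ (Set.subset_insert v C) (Set.mem_insert v C))
    lift C to Finset ι using Set.toFinite C
    obtain ⟨c, hc0, hc⟩ := exists_coeff_of_mem_span hmem
    have hzero : ∀ b, y b = 0 → (Pi.single v (1 : ℝ) - c : ι → ℝ) b = 0 := fun b hb => by
      have hbT : b ∉ T := fun h => (hT b h).ne' hb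
      have hbv : b ≠ v := fun h => hbT (h ▸ hvT)
      have hbC : b ∉ C := fun h => hbT (hCT h)
      simp [hbv, hc0 b hbC]
    have h1 := cost_nonneg_of_optimal hy0 hopt (hsum v c hc) (fun b hb => (hzero b hb).ge)
    have h2 := cost_nonneg_of_optimal (c := -(Pi.single v (1 : ℝ) - c)) hy0 hopt
      (by
        have := hsum v c hc
        simp only [Pi.neg_apply, neg_smul, Finset.sum_neg_distrib, this, neg_zero])
      (fun b hb => by rw [Pi.neg_apply, hzero b hb, neg_zero])
    rw [map_neg] at h2
    exact hf C v c hC (by simpa using hvC) hc0 hc (by linarith)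
  refine ⟨T, hind, hspan, fun v hv c hc0 hc => ?_, ⟨y, hT, hT0, hyz⟩⟩
  refine lt_of_le_of_ne ?_ (hf T v c hind hv hc0 hc).symm
  refine cost_nonneg_of_optimal hy0 hopt (hsum v c hc) fun b hb => ?_
  have hbT : b ∉ T := fun h => (hT b h).ne' hb
  simp only [Pi.sub_apply, hc0 b hbT, sub_zero, Pi.single_apply]
  split_ifs <;> norm_num

end LinearProgramming

section Cells

lemma LinearMap.det_eq_det_mul_det_of_prod {E F : Type*} [AddCommGroup E] [Module ℝ E]
    [FiniteDimensional ℝ E] [AddCommGroup F] [Module ℝ F] [FiniteDimensional ℝ F]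
    (D : E × F →ₗ[ℝ] E × F) (T : E →ₗ[ℝ] E) (R : F →ₗ[ℝ] F)
    (h1 : ∀ x, D (x, 0) = (T x, 0)) (h2 : ∀ z, (D z).2 = R z.2) :
    LinearMap.det D = LinearMap.det T * LinearMap.det R := by
  classical
  let b := Module.finBasis ℝ E
  let c := Module.finBasis ℝ F
  have : LinearMap.toMatrix (b.prod c) (b.prod c) D =
      Matrix.fromBlocks (LinearMap.toMatrix b b T)
        (LinearMap.toMatrix c b (LinearMap.fst ℝ E F ∘ₗ D ∘ₗ LinearMap.inr ℝ E F)) 0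
        (LinearMap.toMatrix c c R) := by
    ext i j
    rcases i with i | i <;> rcases j with j | j <;>
      simp [LinearMap.toMatrix_apply, h1, h2, Module.Basis.prod_apply]
  rw [← LinearMap.det_toMatrix (b.prod c), this, Matrix.det_fromBlocks_zero₂₁,
    LinearMap.det_toMatrix, LinearMap.det_toMatrix]

variable {ι C E : Type*} [Fintype ι] [DecidableEq ι] [Fintype C] [DecidableEq C]
  [NormedAddCommGroup E] [NormedSpace ℝ E]

/-- The Cayley lift of the coloured points `q v`. -/
def cayley (q : ι → E) (col : ι → C) (v : ι) : E × (C → ℝ) := (q v, Pi.single (col v) 1)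

variable [FiniteDimensional ℝ E] [MeasurableSpace E] [BorelSpace E]

lemma exists_monomial_measure_cell (μ : Measure E) [μ.IsAddHaarMeasure]
    (q : ι → E) (col : ι → C) (B : Finset ι)
    (hB : LinearIndepOn ℝ (cayley q col) (B : Set ι))
    (hBs : Submodule.span ℝ (cayley q col '' (B : Set ι)) = ⊤) :
    ∃ d : C → ℕ, ∑ c, d c = Module.finrank ℝ E ∧ ∀ t : C → ℝ, (∀ c, 0 < t c) →
      μ {x | (x, t) ∈ openCone (cayley q col) B} =
        ENNReal.ofReal (∏ c, t c ^ d c) * μ {x | (x, fun _ => 1) ∈ openCone (cayley q col) B} := by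
  classical
  set w := cayley q col with hw
  have hsp : ⊤ ≤ Submodule.span ℝ (Set.range fun b : B => w b) := by
    rw [← hBs]
    apply Submodule.span_mono
    rintro _ ⟨b, hb, rfl⟩
    exact ⟨⟨b, hb⟩, rfl⟩
  let bas : Module.Basis B ℝ (E × (C → ℝ)) := Module.Basis.mk hB hsp
  have hbas : ∀ b : B, bas b = w b := fun b => Module.Basis.mk_apply hB hsp b
  have hcard : B.card = Module.finrank ℝ E + Fintype.card C := by
    rw [← Module.finrank_fintype_fun_eq_card ℝ (η := C), ← Module.finrank_prod,
      Module.finrank_eq_card_basis bas, Fintype.card_coe]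
  let k : C → ℕ := fun c => (B.filter fun b => col b = c).card
  have hk : ∀ c, 1 ≤ k c := by
    intro c
    by_contra h
    have h0 : ∀ b ∈ B, col b ≠ c := by
      intro b hb hc
      exact h (Finset.card_pos.2 ⟨b, Finset.mem_filter.2 ⟨hb, hc⟩⟩)
    have hz : bas.constr ℝ (fun b => (w b).2 c) = (0 : E × (C → ℝ) →ₗ[ℝ] ℝ) := by
      apply bas.ext
      intro b
      rw [Module.Basis.constr_basis]
      simp [hw, cayley, h0 b b.2]
    have hz' : bas.constr ℝ (fun b => (w b).2 c) =
        (LinearMap.proj c ∘ₗ LinearMap.snd ℝ E (C → ℝ) : E × (C → ℝ) →ₗ[ℝ] ℝ) := by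
      apply bas.ext
      intro b
      rw [Module.Basis.constr_basis, hbas]
      simp
    have := congrArg (fun f : E × (C → ℝ) →ₗ[ℝ] ℝ => f (0, Pi.single c 1)) (hz'.symm.trans hz)
    simp at this
  have hksum : ∑ c, k c = B.card :=
    (Finset.card_eq_sum_card_fiberwise (s := B) (t := Finset.univ) (f := col)
      (fun _ _ => Finset.mem_univ _)).symm
  refine ⟨fun c => k c - 1, ?_, fun t ht => ?_⟩
  · rw [Finset.sum_tsub_distrib _ fun c _ => hk c, hksum, hcard]
    simp
  let D : E × (C → ℝ) →ₗ[ℝ] E × (C → ℝ) := bas.constr ℝ fun b => t (col b) • w b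
  have hDw : ∀ b ∈ B, D (w b) = t (col b) • w b := fun b hb => by
    have := bas.constr_basis ℝ (fun b => t (col b) • w b) ⟨b, hb⟩
    rwa [hbas] at this
  let R : (C → ℝ) →ₗ[ℝ] (C → ℝ) := Matrix.toLin' (Matrix.diagonal t)
  have hR : ∀ τ c, R τ c = t c * τ c := fun τ c => by
    simp [R, Matrix.mulVec_diagonal]
  have hD2 : ∀ z, (D z).2 = R z.2 := by
    intro z
    have : LinearMap.snd ℝ E (C → ℝ) ∘ₗ D = R ∘ₗ LinearMap.snd ℝ E (C → ℝ) := by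
      apply bas.ext
      intro b
      rw [LinearMap.comp_apply, LinearMap.comp_apply, hbas, hDw _ b.2]
      ext c
      rw [LinearMap.snd_apply, LinearMap.snd_apply, hR]
      by_cases hc : c = col b
      · subst hc; simp [hw, cayley]
      · simp [hw, cayley, hc]
    exact congrArg (fun f => f z) this
  let T : E →ₗ[ℝ] E := LinearMap.fst ℝ E (C → ℝ) ∘ₗ D ∘ₗ LinearMap.inl ℝ E (C → ℝ)
  have hD1 : ∀ x, D (x, 0) = (T x, 0) := fun x => by
    refine Prod.ext rfl ?_
    rw [hD2]; simp
  have hdetD : LinearMap.det D = ∏ c, t c ^ k c := by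
    have : LinearMap.toMatrix bas bas D = Matrix.diagonal fun b : B => t (col b) := by
      ext i j
      rw [LinearMap.toMatrix_apply, hbas, hDw _ j.2, ← hbas, map_smul, bas.repr_self]
      by_cases h : i = j
      · subst h; simp
      · simp [Matrix.diagonal_apply_ne _ h, Finsupp.single_eq_of_ne h]
    rw [← LinearMap.det_toMatrix bas, this, Matrix.det_diagonal,
      Finset.prod_coe_sort B (fun b => t (col b)),
      ← Finset.prod_fiberwise_of_maps_to (s := B) (t := Finset.univ) (g := col)
      (fun _ _ => Finset.mem_univ _)]
    refine Finset.prod_congr rfl fun c _ => ?_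
    rw [Finset.prod_congr rfl (g := fun _ => t c) (fun b hb => by rw [(Finset.mem_filter.1 hb).2]),
      Finset.prod_const]
  have hdetT : LinearMap.det T = ∏ c, t c ^ (k c - 1) := by
    have h := LinearMap.det_eq_det_mul_det_of_prod D T R hD1 hD2
    have hdR : LinearMap.det R = ∏ c, t c := by
      rw [LinearMap.det_toLin', Matrix.det_diagonal]
    have hp : (0 : ℝ) < ∏ c, t c := Finset.prod_pos fun c _ => ht c
    rw [hdetD, hdR] at h
    apply mul_right_cancel₀ hp.ne'
    rw [← h, ← Finset.prod_mul_distrib]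
    exact Finset.prod_congr rfl fun c _ => by
      rw [← pow_succ, Nat.sub_add_cancel (hk c)]
  have hcone : ∀ z, D z ∈ openCone w B ↔ z ∈ openCone w B := by
    intro z
    have hDsum : ∀ y : ι → ℝ, (∀ v ∉ B, y v = 0) →
        D (∑ v, y v • w v) = ∑ v, (y v * t (col v)) • w v := fun y hy => by
      rw [map_sum]
      refine Finset.sum_congr rfl fun v _ => ?_
      by_cases hv : v ∈ B
      · rw [map_smul, hDw v hv, smul_smul]
      · rw [hy v hv]; simp
    have hinj : Function.Injective D := by
      have : LinearMap.det D ≠ 0 := by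
        rw [hdetD]
        exact (Finset.prod_pos fun c _ => pow_pos (ht c) _).ne'
      exact (LinearMap.equivOfDetNeZero D this).injective
    constructor
    · rintro ⟨y, hy, hy0, h⟩
      refine ⟨fun v => y v / t (col v), fun v hv => div_pos (hy v hv) (ht _), fun v hv => by
        simp [hy0 v hv], hinj ?_⟩
      rw [hDsum _ fun v hv => by simp [hy0 v hv], ← h]
      exact Finset.sum_congr rfl fun v _ => by rw [div_mul_cancel₀ _ (ht _).ne']
    · rintro ⟨y, hy, hy0, rfl⟩
      exact ⟨fun v => y v * t (col v), fun v hv => mul_pos (hy v hv) (ht _), fun v hv => by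
        simp [hy0 v hv], (hDsum y hy0).symm⟩
  have hDs : ∀ x, D (x, fun _ => 1) = (T x + (D (0, fun _ => 1)).1, t) := fun x => by
    refine Prod.ext ?_ ?_
    · have : ((x, fun _ => 1) : E × (C → ℝ)) = (x, 0) + (0, fun _ => 1) := by simp
      rw [this, map_add, hD1]; rfl
    · rw [hD2]; ext c; simp [hR]
  have hTs : Function.Surjective T := by
    have : LinearMap.det T ≠ 0 := by
      rw [hdetT]
      exact (Finset.prod_pos fun c _ => pow_pos (ht c) _).ne'
    exact (LinearMap.equivOfDetNeZero T this).surjective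
  have himg : {x | (x, t) ∈ openCone w B} = (fun x => x + (D (0, fun _ => 1)).1) ''
      (T '' {x | (x, fun _ => 1) ∈ openCone w B}) := by
    ext x
    constructor
    · intro hx
      obtain ⟨x', hx'⟩ := hTs (x - (D (0, fun _ => 1)).1)
      refine ⟨T x', ⟨x', ?_, rfl⟩, by rw [hx']; simp⟩
      change (x', fun _ => 1) ∈ openCone w B
      rw [← hcone, hDs, hx', sub_add_cancel]
      exact hx
    · rintro ⟨_, ⟨x', hx', rfl⟩, rfl⟩
      change (_, t) ∈ openCone w B
      rw [← hDs, hcone]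
      exact hx'
  rw [himg, Set.image_add_right, measure_preimage_add_right, Measure.addHaar_image_linearMap, hdetT,
    abs_of_pos (Finset.prod_pos fun c _ => pow_pos (ht c) _)]

lemma isOpen_openCone (w : ι → E) (B : Finset ι)
    (hB : LinearIndepOn ℝ w (B : Set ι))
    (hBs : Submodule.span ℝ (w '' (B : Set ι)) = ⊤) : IsOpen (openCone w B) := by
  classical
  have hsp : ⊤ ≤ Submodule.span ℝ (Set.range fun b : B => w b) := by
    rw [← hBs]
    apply Submodule.span_mono
    rintro _ ⟨b, hb, rfl⟩
    exact ⟨⟨b, hb⟩, rfl⟩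
  let bas : Module.Basis B ℝ E := Module.Basis.mk hB hsp
  have hbas : ∀ b : B, bas b = w b := fun b => Module.Basis.mk_apply hB hsp b
  have : openCone w B = ⋂ b : B, {z | 0 < bas.coord b z} := by
    ext z
    simp only [Set.mem_iInter, Set.mem_setOf_eq]
    constructor
    · rintro ⟨y, hy, hy0, rfl⟩ b
      have h1 : ∑ v, y v • w v = ∑ v : B, y v • bas v := by
        rw [← Finset.sum_subset (Finset.subset_univ B) fun x _ hx => by rw [hy0 x hx, zero_smul],
          ← Finset.sum_coe_sort]
        exact Finset.sum_congr rfl fun v _ => by rw [hbas]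
      rw [h1, Module.Basis.coord_apply, bas.repr_sum_self]
      exact hy b b.2
    · intro h
      refine ⟨fun v => if hv : v ∈ B then bas.coord ⟨v, hv⟩ z else 0, fun v hv => by
        simpa only [hv, dite_true] using h ⟨v, hv⟩, fun v hv => by simp [hv], ?_⟩
      rw [← Finset.sum_subset (Finset.subset_univ B) fun x _ hx => by simp [hx],
          ← Finset.sum_coe_sort]
      conv_rhs => rw [← bas.sum_repr z]
      exact Finset.sum_congr rfl fun v _ => by simp [hbas]
  rw [this]
  exact isOpen_iInter_of_finite fun b => isOpen_lt continuous_const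
    (LinearMap.continuous_of_finiteDimensional _)

end Cells

section Cayley

variable {ι C E : Type*} [Fintype ι] [Fintype C] [DecidableEq C]
  [NormedAddCommGroup E] [NormedSpace ℝ E]

/-- The Minkowski combination, with coefficients `t`, of the convex hulls of the colour classes. -/
def cayleySum (q : ι → E) (col : ι → C) (t : C → ℝ) : Set E :=
  {x | ∃ y : ι → ℝ, (∀ v, 0 ≤ y v) ∧ ∑ v, y v • cayley q col v = (x, t)}

lemma sum_cayley_eq_iff {q : ι → E} {col : ι → C} {y : ι → ℝ} {x : E} {t : C → ℝ} :
    ∑ v, y v • cayley q col v = (x, t) ↔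
      ∑ v, y v • q v = x ∧ ∀ c, ∑ v with col v = c, y v = t c := by
  rw [Prod.ext_iff, Prod.fst_sum, Prod.snd_sum, funext_iff]
  refine and_congr Iff.rfl (forall_congr' fun c => ?_)
  rw [Finset.sum_apply, Finset.sum_filter]
  simp only [cayley, Prod.smul_snd, Pi.smul_apply, smul_eq_mul, Pi.single_apply, mul_ite, mul_one,
    mul_zero]
  simp only [eq_comm]

lemma le_of_sum_cayley_eq {q : ι → E} {col : ι → C} {y : ι → ℝ} (hy : ∀ v, 0 ≤ y v) {x : E}
    {t : C → ℝ} (h : ∑ v, y v • cayley q col v = (x, t)) (v : ι) : y v ≤ t (col v) := by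
  rw [← (sum_cayley_eq_iff.1 h).2 (col v)]
  exact Finset.single_le_sum (f := y) (fun i _ => hy i) (by simp)

variable [FiniteDimensional ℝ E]

lemma isCompact_cayley_fiber (q : ι → E) (col : ι → C) (z : E × (C → ℝ)) :
    IsCompact {y : ι → ℝ | (∀ v, 0 ≤ y v) ∧ ∑ v, y v • cayley q col v = z} := by
  refine IsCompact.of_isClosed_subset (isCompact_Icc (a := (0 : ι → ℝ)) (b := fun v => z.2 (col v)))
    ?_ fun y hy => ⟨hy.1, le_of_sum_cayley_eq (x := z.1) hy.1 hy.2⟩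
  refine IsClosed.inter ?_ (isClosed_eq (by fun_prop) continuous_const)
  change IsClosed {y : ι → ℝ | ∀ v, 0 ≤ y v}
  rw [Set.ofPred_forall]
  exact isClosed_iInter fun v => isClosed_le continuous_const (continuous_apply v)

lemma isCompact_cayleySum (q : ι → E) (col : ι → C) (t : C → ℝ) :
    IsCompact (cayleySum q col t) := by
  have h : IsCompact {y : ι → ℝ | (∀ v, 0 ≤ y v) ∧ ∀ c, ∑ v with col v = c, y v = t c} := by
    refine IsCompact.of_isClosed_subset (isCompact_Icc (a := (0 : ι → ℝ)) (b := fun v => t (col v)))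
      ?_ fun y hy => ⟨hy.1, le_of_sum_cayley_eq (q := q) hy.1 (sum_cayley_eq_iff.2 ⟨rfl, hy.2⟩)⟩
    simp only [Set.ofPred_and, Set.ofPred_forall]
    exact IsClosed.inter (isClosed_iInter fun v => isClosed_le continuous_const (continuous_apply v))
      (isClosed_iInter fun v => isClosed_eq (by fun_prop) continuous_const)
  have : cayleySum q col t = (fun y : ι → ℝ => ∑ v, y v • q v) ''
      {y : ι → ℝ | (∀ v, 0 ≤ y v) ∧ ∀ c, ∑ v with col v = c, y v = t c} := by
    ext x
    constructor
    · rintro ⟨y, hy, h⟩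
      rw [sum_cayley_eq_iff] at h
      exact ⟨y, ⟨hy, h.2⟩, h.1⟩
    · rintro ⟨y, ⟨hy, h⟩, rfl⟩
      exact ⟨y, hy, sum_cayley_eq_iff.2 ⟨rfl, h⟩⟩
  rw [this]
  exact h.image (by fun_prop)

variable [MeasurableSpace E] [BorelSpace E]

lemma measure_section_eq_zero (μ : Measure E) [μ.IsAddHaarMeasure] (q : ι → E) (col : ι → C)
    (T : Set ι) (hT : ∀ c, ∃ v ∈ T, col v = c)
    (hTs : Submodule.span ℝ (cayley q col '' T) ≠ ⊤) (t : C → ℝ) :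
    μ {x | (x, t) ∈ Submodule.span ℝ (cayley q col '' T)} = 0 := by
  classical
  set U := Submodule.span ℝ (cayley q col '' T) with hU
  let g : E →ᵃ[ℝ] E × (C → ℝ) :=
    (LinearMap.inl ℝ E (C → ℝ)).toAffineMap + AffineMap.const ℝ E ((0, t) : E × (C → ℝ))
  have hg : ∀ x, g x = (x, t) := fun x => by simp [g]
  have hset : {x | (x, t) ∈ U} = (U.toAffineSubspace.comap g : Set E) := by
    ext x
    simp [hg]
  rw [hset]
  apply Measure.addHaar_affineSubspace
  intro htop
  have hall : ∀ x, (x, t) ∈ U := fun x => by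
    have : x ∈ (U.toAffineSubspace.comap g : Set E) := by rw [htop]; trivial
    rwa [← hset] at this
  have h0 : ∀ x, ((x, 0) : E × (C → ℝ)) ∈ U := fun x => by
    have := U.sub_mem (hall x) (hall 0)
    simpa using this
  have he : ∀ c, ((0, Pi.single c 1) : E × (C → ℝ)) ∈ U := fun c => by
    obtain ⟨v, hv, rfl⟩ := hT c
    have := U.sub_mem (Submodule.subset_span (Set.mem_image_of_mem (cayley q col) hv)) (h0 (q v))
    simpa [cayley] using this
  apply hTs
  rw [eq_top_iff]
  rintro ⟨x, τ⟩ -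
  have h1 : ((0, τ) : E × (C → ℝ)) ∈ U := by
    have : ((0, τ) : E × (C → ℝ)) = ∑ c, τ c • ((0, Pi.single c 1) : E × (C → ℝ)) := by
      refine Prod.ext (by simp [Prod.fst_sum]) ?_
      rw [Prod.snd_sum]
      simp only [Prod.smul_snd]
      exact pi_eq_sum_univ' τ 
    rw [this]
    exact U.sum_mem fun c _ => U.smul_mem _ (he c)
  have := U.add_mem (h0 x) h1
  simpa using this

theorem exists_polynomial_measure_cayleySum (μ : Measure E) [μ.IsAddHaarMeasure] (q : ι → E)
    (col : ι → C) :
    ∃ (k : ℕ) (κ : Fin k → ℝ) (d : Fin k → C → ℕ),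
      (∀ j, ∑ c, d j c = Module.finrank ℝ E) ∧
      ∀ t : C → ℝ, (∀ c, 0 < t c) →
        (μ (cayleySum q col t)).toReal = ∑ j, κ j * ∏ c, t c ^ d j c := by
  classical
  set w := cayley q col with hw
  obtain ⟨f, hf⟩ := exists_generic_cost w
  let J := {B : Finset ι // LinearIndepOn ℝ w (B : Set ι) ∧
    Submodule.span ℝ (w '' (B : Set ι)) = ⊤ ∧ DualFeasible w f B}
  have hmon := fun B : J => exists_monomial_measure_cell μ q col B.1 B.2.1 B.2.2.1
  choose d hd hmon using hmon
  let e := Fintype.equivFin J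
  refine ⟨Fintype.card J, fun j => (μ {x | (x, fun _ => 1) ∈ openCone w (e.symm j).1}).toReal,
    fun j => d (e.symm j), fun j => hd _, fun t ht => ?_⟩
  rw [e.symm.sum_comp (fun B : J => (μ {x | (x, fun _ => 1) ∈ openCone w B.1}).toReal *
    ∏ c, t c ^ d B c)]
  have hsub : ∀ B : J, {x | (x, t) ∈ openCone w B.1} ⊆ cayleySum q col t := by
    rintro B x ⟨y, hy, hy0, h⟩
    refine ⟨y, fun v => ?_, h⟩
    by_cases hv : v ∈ B.1
    · exact (hy v hv).le
    · exact (hy0 v hv).ge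
  have hmeas : ∀ B : J, MeasurableSet {x | (x, t) ∈ openCone w B.1} := fun B =>
    ((isOpen_openCone w B.1 B.2.1 B.2.2.1).preimage (f := fun x : E => (x, t))
      (by fun_prop)).measurableSet
  have hdisj : Pairwise (Function.onFun Disjoint fun B : J => {x | (x, t) ∈ openCone w B.1}) := by
    intro B B' hne
    have := openCone_disjoint B.2.1 B.2.2.1 B.2.2.2 B'.2.1 B'.2.2.1 B'.2.2.2
      (fun h => hne (Subtype.ext h))
    rw [Function.onFun, Set.disjoint_left]
    exact fun x hx hx' => Set.disjoint_left.1 this hx hx'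
  let P : Finset ι → Prop := fun T => (∀ c, ∃ v ∈ (T : Set ι), col v = c) ∧
    Submodule.span ℝ (w '' (T : Set ι)) ≠ ⊤
  have hcover : cayleySum q col t ⊆ (⋃ B : J, {x | (x, t) ∈ openCone w B.1}) ∪
      ⋃ T : {T // P T}, {x | (x, t) ∈ Submodule.span ℝ (w '' (T.1 : Set ι))} := by
    rintro x ⟨y₀, hy₀, h₀⟩
    by_cases hx : ∃ T : {T // P T}, (x, t) ∈ Submodule.span ℝ (w '' (T.1 : Set ι))
    · exact Or.inr (Set.mem_iUnion.2 hx)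
    left
    obtain ⟨B, h1, h2, h3, h4⟩ := exists_mem_openCone hf (z := (x, t)) ⟨y₀, hy₀, h₀⟩
      (isCompact_cayley_fiber q col (x, t)) (by
        intro y T hyT hy0 hsum
        by_contra hspan
        refine hx ⟨⟨T, fun c => ?_, hspan⟩, ?_⟩
        · by_contra hc
          push Not at hc
          have := (sum_cayley_eq_iff.1 hsum).2 c
          rw [Finset.sum_eq_zero fun v hv => hy0 v fun hvT =>
            hc v hvT (Finset.mem_filter.1 hv).2] at this
          exact (ht c).ne this
        · change (x, t) ∈ Submodule.span ℝ (w '' (T : Set ι))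
          rw [← hsum]
          refine Submodule.sum_mem _ fun v _ => ?_
          by_cases hv : v ∈ T
          · exact Submodule.smul_mem _ _ (Submodule.subset_span ⟨v, hv, rfl⟩)
          · rw [hy0 v hv, zero_smul]; exact Submodule.zero_mem _)
    exact Set.mem_iUnion.2 ⟨⟨B, h1, h2, h3⟩, h4⟩
  have hnull : μ (⋃ T : {T // P T}, {x | (x, t) ∈ Submodule.span ℝ (w '' (T.1 : Set ι))}) = 0 :=
    measure_iUnion_null fun T => measure_section_eq_zero μ q col _ T.2.1 T.2.2 t
  have hfin : μ (cayleySum q col t) ≠ ⊤ := (isCompact_cayleySum q col t).measure_ne_top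
  have hvol : μ (cayleySum q col t) = ∑ B : J, μ {x | (x, t) ∈ openCone w B.1} := by
    rw [← tsum_fintype (L := .unconditional _), ← measure_iUnion hdisj hmeas]
    apply le_antisymm
    · refine (measure_mono hcover).trans ((measure_union_le _ _).trans ?_)
      rw [hnull, add_zero]
    · exact measure_mono (Set.iUnion_subset hsub)
  rw [hvol, ENNReal.toReal_sum fun B _ => ne_top_of_le_ne_top hfin (measure_mono (hsub B))]
  refine Finset.sum_congr rfl fun B _ => ?_
  rw [hmon B t ht, ENNReal.toReal_mul, ENNReal.toReal_ofReal
    (Finset.prod_nonneg fun c _ => pow_nonneg (ht c).le _), mul_comm]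

end Cayley

section MinkowskiPolynomial

variable {C E : Type*} [Fintype C] [NormedAddCommGroup E] [NormedSpace ℝ E]

lemma sum_smul_convexHull_eq_cayleySum [DecidableEq C] (s : C → Finset E) {t : C → ℝ}
    (ht : ∀ c, 0 < t c) :
    ∑ c, t c • convexHull ℝ (s c : Set E) =
      cayleySum (fun v : Σ c, s c => (v.2 : E)) Sigma.fst t := by
  ext x
  have hfib : ∀ (y : (Σ c, s c) → ℝ) (c : C), ∑ v with Sigma.fst v = c, y v = ∑ v : s c, y ⟨c, v⟩ := by
    intro y c
    rw [Finset.sum_filter, Fintype.sum_sigma, Finset.sum_eq_single c]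
    · simp
    · intro b _ hb
      simp [hb]
    · simp
  rw [Set.mem_fintype_sum]
  constructor
  · rintro ⟨g, hg, rfl⟩
    have : ∀ c, ∃ a : E → ℝ, (∀ y ∈ s c, 0 ≤ a y) ∧ ∑ y ∈ s c, a y = 1 ∧
        t c • ∑ y ∈ s c, a y • y = g c := fun c => by
      obtain ⟨z, hz, hzg⟩ := hg c
      obtain ⟨a, h1, h2, rfl⟩ := Finset.mem_convexHull'.1 hz
      exact ⟨a, h1, h2, hzg⟩
    choose a h1 h2 h3 using this
    refine ⟨fun v => t v.1 * a v.1 v.2, fun v => mul_nonneg (ht _).le (h1 _ _ v.2.2),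
      sum_cayley_eq_iff.2 ⟨?_, fun c => ?_⟩⟩
    · rw [Fintype.sum_sigma]
      refine Finset.sum_congr rfl fun c _ => ?_
      rw [← h3 c, Finset.smul_sum, ← Finset.sum_coe_sort (s c) (fun y => t c • a c y • y)]
      exact Finset.sum_congr rfl fun v _ => mul_smul (t c) (a c v) (v : E)
    · rw [hfib]
      change ∑ v : s c, t c * a c v = t c
      rw [ ← Finset.mul_sum, Finset.sum_coe_sort (s c) (a c), h2, mul_one]
  · rintro ⟨y, hy, h⟩
    rw [sum_cayley_eq_iff] at h
    obtain ⟨rfl, h⟩ := h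
    refine ⟨fun c => ∑ v : s c, y ⟨c, v⟩ • (v : E), fun c => ?_,
      (Fintype.sum_sigma (fun v : Σ c, s c => y v • (v.2 : E))).symm⟩
    refine ⟨∑ v : s c, (y ⟨c, v⟩ / t c) • (v : E), ?_, ?_⟩
    · refine (convex_convexHull ℝ _).sum_mem (fun v _ => div_nonneg (hy _) (ht c).le) ?_
        fun v _ => subset_convexHull ℝ _ v.2
      rw [← Finset.sum_div, ← hfib, h, div_self (ht c).ne']
    · simp only [Finset.smul_sum, smul_smul]
      exact Finset.sum_congr rfl fun v _ => by rw [mul_div_cancel₀ _ (ht c).ne']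

lemma IsCompact.finset_sum {C : Type*} (s : Finset C) {K : C → Set E}
    (hK : ∀ c ∈ s, IsCompact (K c)) : IsCompact (∑ c ∈ s, K c) := by
  classical
  induction s using Finset.induction_on with
  | empty => simp
  | insert a s ha ih =>
    rw [Finset.sum_insert ha]
    exact (hK a (by simp)).add (ih fun c hc => hK c (by simp [hc]))

lemma tendsto_measure_sum_smul [FiniteDimensional ℝ E] [MeasurableSpace E] [BorelSpace E]
    (μ : Measure E) [μ.IsAddHaarMeasure] {K : C → Set E} (hK : ∀ c, IsCompact (K c))
    (hKc : ∀ c, Convex ℝ (K c)) (hne : ∀ c, (K c).Nonempty) {t : C → ℝ} (ht : ∀ c, 0 ≤ t c) :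
    Filter.Tendsto (fun e : ℝ => (μ (∑ c, (t c + e) • K c)).toReal) (nhdsWithin 0 (Set.Ioi 0))
      (nhds (μ (∑ c, t c • K c)).toReal) := by
  have hS : ∀ t : C → ℝ, IsCompact (∑ c, t c • K c) := fun t =>
    IsCompact.finset_sum _ fun c _ => (hK c).smul _
  have hsplit : ∀ e : ℝ, 0 < e → ∑ c, (t c + e) • K c = ∑ c, t c • K c + e • ∑ c, K c := by
    intro e he
    rw [Finset.smul_sum, ← Finset.sum_add_distrib]
    exact Finset.sum_congr rfl fun c _ => (hKc c).add_smul (ht c) he.le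
  have hC : IsCompact (∑ c, K c) := IsCompact.finset_sum _ fun c _ => hK c
  obtain ⟨v, hv⟩ : (∑ c, K c).Nonempty := by
    choose v hv using hne
    exact ⟨∑ c, v c, Set.finsetSum_mem_finsetSum _ _ _ fun c _ => hv c⟩
  obtain ⟨R, hR⟩ := hC.isBounded.subset_closedBall 0
  have hlow : ∀ e : ℝ, 0 < e → μ (∑ c, t c • K c) ≤ μ (∑ c, (t c + e) • K c) := by
    intro e he
    rw [hsplit e he, ← measure_preimage_add_right μ (-(e • v)), ← Set.image_add_right']
    · refine measure_mono ?_
      rintro _ ⟨x, hx, rfl⟩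
      exact Set.add_mem_add hx ⟨v, hv, (neg_neg _).symm⟩
  have hup : ∀ e : ℝ, 0 < e → μ (∑ c, (t c + e) • K c) ≤
      μ (Metric.cthickening (e * R) (∑ c, t c • K c)) := by
    intro e he
    rw [hsplit e he]
    refine measure_mono ?_
    rintro _ ⟨x, hx, _, ⟨z, hz, rfl⟩, rfl⟩
    refine Metric.mem_cthickening_of_dist_le _ x _ _ hx ?_
    have := hR hz
    rw [mem_closedBall_zero_iff] at this
    simp only [dist_self_add_left, norm_smul, Real.norm_eq_abs, abs_of_pos he]
    gcongr
  have hlim : Filter.Tendsto (fun e : ℝ => μ (Metric.cthickening (e * R) (∑ c, t c • K c)))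
      (nhdsWithin 0 (Set.Ioi 0)) (nhds (μ (∑ c, t c • K c))) := by
    have h0 : Filter.Tendsto (fun e : ℝ => e * R) (nhdsWithin 0 (Set.Ioi 0)) (nhds 0) := by
      have : Filter.Tendsto (fun e : ℝ => e * R) (nhds 0) (nhds (0 * R)) :=
        Continuous.tendsto (by fun_prop) 0
      rw [zero_mul] at this
      exact this.mono_left nhdsWithin_le_nhds
    exact (tendsto_measure_cthickening_of_isCompact (hS t)).comp h0
  refine (ENNReal.tendsto_toReal (hS t).measure_ne_top).comp
    (tendsto_of_tendsto_of_tendsto_of_le_of_le' tendsto_const_nhds hlim ?_ ?_)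
  · filter_upwards [self_mem_nhdsWithin] with e he using hlow e he
  · filter_upwards [self_mem_nhdsWithin] with e he using hup e he

/-- The volume of a Minkowski combination of polytopes is a homogeneous polynomial in the
coefficients. -/
theorem exists_polynomial_measure_sum_convexHull [FiniteDimensional ℝ E] [MeasurableSpace E]
    [BorelSpace E] (μ : Measure E) [μ.IsAddHaarMeasure] (s : C → Finset E)
    (hs : ∀ c, (s c).Nonempty) :
    ∃ (k : ℕ) (κ : Fin k → ℝ) (d : Fin k → C → ℕ),
      (∀ j, ∑ c, d j c = Module.finrank ℝ E) ∧
      ∀ t : C → ℝ, (∀ c, 0 ≤ t c) →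
        (μ (∑ c, t c • convexHull ℝ (s c : Set E))).toReal = ∑ j, κ j * ∏ c, t c ^ d j c := by
  classical
  obtain ⟨k, κ, d, hd, h⟩ := exists_polynomial_measure_cayleySum μ
    (fun v : Σ c, s c => (v.2 : E)) Sigma.fst
  refine ⟨k, κ, d, hd, fun t ht => ?_⟩
  have h1 := tendsto_measure_sum_smul μ (K := fun c => convexHull ℝ (s c : Set E))
    (fun c => (s c).finite_toSet.isCompact_convexHull ℝ) (fun c => convex_convexHull ℝ _)
    (fun c => (convexHull_nonempty_iff (𝕜 := ℝ)).2 (hs c)) ht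
  have h2 : Filter.Tendsto (fun e : ℝ => ∑ j, κ j * ∏ c, (t c + e) ^ d j c)
      (nhdsWithin 0 (Set.Ioi 0)) (nhds (∑ j, κ j * ∏ c, (t c + 0) ^ d j c)) :=
    (Continuous.tendsto (by fun_prop) 0).mono_left nhdsWithin_le_nhds
  simp only [add_zero] at h2
  refine tendsto_nhds_unique h1 (h2.congr' ?_)
  filter_upwards [self_mem_nhdsWithin] with e he
  have hpos : ∀ c, 0 < t c + e := fun c => add_pos_of_nonneg_of_pos (ht c) he
  rw [← h _ hpos, sum_smul_convexHull_eq_cayleySum s hpos]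

end MinkowskiPolynomial

section BrunnMinkowski

lemma mul_measure_add_le_of_forall_isCompact {A : Set ℝ} (hA : MeasurableSet A) {a : ℝ} (ha : 0 < a)
    {c d : ENNReal} (h : ∀ K ⊆ A, IsCompact K → ENNReal.ofReal a * volume K + c ≤ d) :
    ENNReal.ofReal a * volume A + c ≤ d := by
  have ha0 : ENNReal.ofReal a ≠ 0 := by simpa using ha
  by_cases hd : d = ⊤
  · simp [hd]
  have hcd : c ≤ d := by
    have := h ∅ (Set.empty_subset _) isCompact_empty
    simpa using this
  have hc : c ≠ ⊤ := ne_top_of_le_ne_top hd hcd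
  have : volume A ≤ (d - c) / ENNReal.ofReal a := by
    rw [hA.measure_eq_iSup_isCompact]
    refine iSup_le fun K => iSup_le fun hK => iSup_le fun hKc => ?_
    rw [ENNReal.le_div_iff_mul_le (Or.inl ha0) (Or.inl ENNReal.ofReal_ne_top), mul_comm]
    exact ENNReal.le_sub_of_add_le_right hc (h K hK hKc)
  rw [ENNReal.le_div_iff_mul_le (Or.inl ha0) (Or.inl ENNReal.ofReal_ne_top), mul_comm] at this
  calc _ ≤ (d - c) + c := by gcongr
    _ = d := tsub_add_cancel_of_le hcd

lemma brunn_minkowski_real_of_isCompact {A B C : Set ℝ} {l : ℝ} (hl0 : 0 < l) (hl1 : l < 1)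
    (hA : IsCompact A) (hB : IsCompact B) (hAn : A.Nonempty) (hBn : B.Nonempty)
    (h : ∀ a ∈ A, ∀ b ∈ B, (1 - l) * a + l * b ∈ C) :
    ENNReal.ofReal (1 - l) * volume A + ENNReal.ofReal l * volume B ≤ volume C := by
  obtain ⟨a, ha, hamax⟩ := hA.exists_isMaxOn hAn continuousOn_id
  obtain ⟨b, hb, hbmin⟩ := hB.exists_isMinOn hBn continuousOn_id
  have hvol : ∀ (r p : ℝ) (S : Set ℝ), 0 < r →
      volume ((fun x => r * x + p) '' S) = ENNReal.ofReal r * volume S := by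
    intro r p S hr
    have : (fun x => r * x + p) '' S = (fun x => x + p) '' (r • S) := by
      rw [← Set.image_smul, Set.image_image]; rfl
    rw [this, Set.image_add_right, measure_preimage_add_right, Measure.addHaar_smul]
    simp [abs_of_pos hr]
  have h1 := hvol (1 - l) (l * b) A (by linarith)
  have h2 := hvol l ((1 - l) * a) B hl0
  have hae := measure_union₀ (μ := (volume : Measure ℝ))
      (s := (fun x => (1 - l) * x + l * b) '' A) (t := (fun x => l * x + (1 - l) * a) '' B)
    (hB.image (by fun_prop)).measurableSet.nullMeasurableSet (by
      refine measure_mono_null (t := {(1 - l) * a + l * b}) ?_ (measure_singleton _)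
      rintro x ⟨⟨y, hy, rfl⟩, ⟨z, hz, hzx⟩⟩
      have hy' : y ≤ a := hamax hy
      have hz' : b ≤ z := hbmin hz
      simp only at hzx ⊢
      have : y = a := by nlinarith
      rw [this]; rfl)
  rw [← h1, ← h2, ← hae]
  refine measure_mono (Set.union_subset ?_ ?_)
  · rintro _ ⟨y, hy, rfl⟩
    exact h y hy b hb
  · rintro _ ⟨y, hy, rfl⟩
    simpa only [add_comm] using h a ha y hy

lemma brunn_minkowski_real {A B C : Set ℝ} {l : ℝ} (hl0 : 0 < l) (hl1 : l < 1)
    (hA : MeasurableSet A) (hB : MeasurableSet B) (hAn : A.Nonempty) (hBn : B.Nonempty)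
    (h : ∀ a ∈ A, ∀ b ∈ B, (1 - l) * a + l * b ∈ C) :
    ENNReal.ofReal (1 - l) * volume A + ENNReal.ofReal l * volume B ≤ volume C := by
  obtain ⟨a, ha⟩ := hAn
  obtain ⟨b, hb⟩ := hBn
  refine mul_measure_add_le_of_forall_isCompact hA (by linarith) fun K hK hKc => ?_
  rw [add_comm]
  refine mul_measure_add_le_of_forall_isCompact hB hl0 fun L hL hLc => ?_
  rw [add_comm]
  refine le_trans ?_ (brunn_minkowski_real_of_isCompact hl0 hl1 (hKc.insert a) (hLc.insert b)
    (Set.insert_nonempty _ _) (Set.insert_nonempty _ _) fun x hx y hy =>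
      h x (Set.insert_subset ha hK hx) y (Set.insert_subset hb hL hy))
  gcongr <;> exact Set.subset_insert _ _

/-- The Prékopa–Leindler inequality for bounded functions on the line. -/
lemma prekopa_leindler_real {f g h : ℝ → ℝ} {l : ℝ} (hl0 : 0 < l) (hl1 : l < 1)
    (hf : Measurable f) (hg : Measurable g) (hh : Measurable h)
    (hf0 : 0 ≤ f) (hg0 : 0 ≤ g) (hh0 : 0 ≤ h)
    (hfb : BddAbove (Set.range f)) (hgb : BddAbove (Set.range g))
    (H : ∀ x y, f x ^ (1 - l) * g y ^ l ≤ h ((1 - l) * x + l * y)) :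
    (∫⁻ x, ENNReal.ofReal (f x)) ^ (1 - l) * (∫⁻ x, ENNReal.ofReal (g x)) ^ l ≤
      ∫⁻ x, ENNReal.ofReal (h x) := by
  have hl1' : 0 < 1 - l := by linarith
  set F := sSup (Set.range f) with hF
  set G := sSup (Set.range g) with hG
  have hfF : ∀ x, f x ≤ F := fun x => le_csSup hfb ⟨x, rfl⟩
  have hgG : ∀ x, g x ≤ G := fun x => le_csSup hgb ⟨x, rfl⟩
  have hF' : (0 : ℝ) ≤ F := le_trans (hf0 0) (hfF 0)
  have hG' : (0 : ℝ) ≤ G := le_trans (hg0 0) (hgG 0)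
  rcases hF'.eq_or_lt with hF0 | hF0
  · have : ∀ x, f x = 0 := fun x => le_antisymm (by simpa [← hF0] using hfF x) (hf0 x)
    simp [this, ENNReal.zero_rpow_of_pos hl1']
  rcases hG'.eq_or_lt with hG0 | hG0
  · have : ∀ x, g x = 0 := fun x => le_antisymm (by simpa [← hG0] using hgG x) (hg0 x)
    simp [this, ENNReal.zero_rpow_of_pos hl0]
  set P := F ^ (1 - l) * G ^ l with hP
  have hP0 : 0 < P := by positivity
  have layer : ∀ (f : ℝ → ℝ) (F : ℝ), Measurable f → 0 ≤ f → 0 < F →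
      ∫⁻ x, ENNReal.ofReal (f x) =
        ENNReal.ofReal F * ∫⁻ s in Set.Ioi (0 : ℝ), volume {x | s < f x / F} := by
    intro f F hf hf0 hF
    rw [← lintegral_eq_lintegral_meas_lt volume (f := fun x => f x / F)
      (Filter.Eventually.of_forall fun x => div_nonneg (hf0 x) hF.le)
      (hf.div_const F).aemeasurable, ← lintegral_const_mul _ (by fun_prop)]
    refine lintegral_congr fun x => ?_
    rw [← ENNReal.ofReal_mul hF.le, mul_div_cancel₀ _ hF.ne']
  have hmeasF : ∀ (f : ℝ → ℝ) (F : ℝ), Measurable fun s => volume {x | s < f x / F} := by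
    intro f F
    refine Antitone.measurable fun s t hst => measure_mono fun x hx => lt_of_le_of_lt hst hx
  have key : ENNReal.ofReal (1 - l) * (∫⁻ s in Set.Ioi (0 : ℝ), volume {x | s < f x / F}) +
      ENNReal.ofReal l * (∫⁻ s in Set.Ioi (0 : ℝ), volume {x | s < g x / G}) ≤
      ∫⁻ s in Set.Ioi (0 : ℝ), volume {x | s < h x / P} := by
    rw [← lintegral_const_mul _ (hmeasF f F), ← lintegral_const_mul _ (hmeasF g G),
      ← lintegral_add_left ((hmeasF f F).const_mul _)]
    refine setLIntegral_mono (hmeasF h P) fun s hs => ?_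
    have hs : 0 < s := hs
    by_cases hs1 : s < 1
    · refine brunn_minkowski_real hl0 hl1
        (measurableSet_lt measurable_const (hf.div_const F))
        (measurableSet_lt measurable_const (hg.div_const G)) ?_ ?_ ?_
      · obtain ⟨_, ⟨x, rfl⟩, hx⟩ := exists_lt_of_lt_csSup (Set.range_nonempty f)
          (show s * F < F by nlinarith)
        exact ⟨x, by rwa [Set.mem_ofPred_eq, lt_div_iff₀ hF0]⟩
      · obtain ⟨_, ⟨x, rfl⟩, hx⟩ := exists_lt_of_lt_csSup (Set.range_nonempty g)
          (show s * G < G by nlinarith)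
        exact ⟨x, by rwa [Set.mem_ofPred_eq, lt_div_iff₀ hG0]⟩
      · intro x hx y hy
        have hx : s < f x / F := hx
        have hy : s < g y / G := hy
        rw [lt_div_iff₀ hF0] at hx
        rw [lt_div_iff₀ hG0] at hy
        change s < _ / P
        rw [lt_div_iff₀ hP0]
        refine lt_of_lt_of_le ?_ (H x y)
        have e1 : s * P = (s * F) ^ (1 - l) * (s * G) ^ l := by
          rw [Real.mul_rpow hs.le hF0.le, Real.mul_rpow hs.le hG0.le, hP]
          have : s ^ (1 - l) * s ^ l = s := by
            rw [← Real.rpow_add hs]; simp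
          calc s * (F ^ (1 - l) * G ^ l) = (s ^ (1 - l) * s ^ l) * (F ^ (1 - l) * G ^ l) := by rw [this]
            _ = _ := by ring
        rw [e1]
        exact mul_lt_mul'' (Real.rpow_lt_rpow (by positivity) hx hl1')
          (Real.rpow_lt_rpow (by positivity) hy hl0) (by positivity) (by positivity)
    · push Not at hs1
      have h1 : {x | s < f x / F} = ∅ := by
        refine Set.eq_empty_of_forall_notMem fun x hx => ?_
        have hx : s < f x / F := hx
        rw [lt_div_iff₀ hF0] at hx
        nlinarith [hfF x]
      have h2 : {x | s < g x / G} = ∅ := by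
        refine Set.eq_empty_of_forall_notMem fun x hx => ?_
        have hx : s < g x / G := hx
        rw [lt_div_iff₀ hG0] at hx
        nlinarith [hgG x]
      simp [h1, h2]
  rw [layer f F hf hf0 hF0, layer g G hg hg0 hG0, layer h P hh hh0 hP0]
  set I := ∫⁻ s in Set.Ioi (0 : ℝ), volume {x | s < f x / F}
  set J := ∫⁻ s in Set.Ioi (0 : ℝ), volume {x | s < g x / G}
  have hgm : I ^ (1 - l) * J ^ l ≤ ENNReal.ofReal (1 - l) * I + ENNReal.ofReal l * J := by
    have := ENNReal.young_inequality (I ^ (1 - l)) (J ^ l)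
      (Real.holderConjugate_one_div hl1' hl0 (by ring))
    rw [← ENNReal.rpow_mul, ← ENNReal.rpow_mul, mul_one_div_cancel hl1'.ne',
      mul_one_div_cancel hl0.ne', ENNReal.rpow_one, ENNReal.rpow_one, one_div, one_div,
      ENNReal.ofReal_inv_of_pos hl1', ENNReal.ofReal_inv_of_pos hl0, div_eq_mul_inv,
      div_eq_mul_inv, inv_inv, inv_inv] at this
    rwa [mul_comm _ I, mul_comm _ J]
  rw [ENNReal.mul_rpow_of_nonneg _ _ hl1'.le, ENNReal.mul_rpow_of_nonneg _ _ hl0.le, hP,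
    ENNReal.ofReal_mul (by positivity), ENNReal.ofReal_rpow_of_pos hF0, ENNReal.ofReal_rpow_of_pos hG0]
  calc _ = ENNReal.ofReal (F ^ (1 - l)) * ENNReal.ofReal (G ^ l) * (I ^ (1 - l) * J ^ l) := by ring
    _ ≤ _ := by gcongr; exact hgm.trans key

end BrunnMinkowski

section BrunnMinkowskiPi

lemma isCompact_section {m : ℕ} {A : Set (Fin (m + 1) → ℝ)} (hA : IsCompact A) (x : ℝ) :
    IsCompact {y : Fin m → ℝ | (Fin.cons x y : Fin (m + 1) → ℝ) ∈ A} := by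
  refine IsCompact.of_isClosed_subset (hA.image (f := fun z => (Fin.tail z : Fin m → ℝ))
    (by unfold Fin.tail; fun_prop)) (hA.isClosed.preimage (by fun_prop)) fun y hy => ⟨_, hy, by simp⟩

lemma volume_eq_lintegral_section {m : ℕ} {A : Set (Fin (m + 1) → ℝ)} (hA : MeasurableSet A) :
    volume A = ∫⁻ x : ℝ, volume {y : Fin m → ℝ | (Fin.cons x y : Fin (m + 1) → ℝ) ∈ A} := by
  have hp := volume_preserving_piFinSuccAbove (fun _ : Fin (m + 1) => ℝ) 0
  rw [← (hp.symm _).measure_preimage hA.nullMeasurableSet, Measure.volume_eq_prod,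
    Measure.prod_apply (hA.preimage (MeasurableEquiv.measurable _))]
  refine lintegral_congr fun x => ?_
  congr 1
  ext y
  simp [Fin.insertNthEquiv]

lemma measurable_volume_section {m : ℕ} {A : Set (Fin (m + 1) → ℝ)} (hA : MeasurableSet A) :
    Measurable fun x : ℝ => volume {y : Fin m → ℝ | (Fin.cons x y : Fin (m + 1) → ℝ) ∈ A} := by
  have h : Measurable fun p : ℝ × (Fin m → ℝ) => (Fin.cons p.1 p.2 : Fin (m + 1) → ℝ) :=
    Continuous.measurable (by fun_prop)
  exact measurable_measure_prodMk_left (ν := (volume : Measure (Fin m → ℝ))) (h hA)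

theorem brunn_minkowski_mul {l : ℝ} (hl0 : 0 < l) (hl1 : l < 1) :
    ∀ {m : ℕ} {A B C : Set (Fin m → ℝ)}, IsCompact A → IsCompact B → IsCompact C →
      (∀ a ∈ A, ∀ b ∈ B, (1 - l) • a + l • b ∈ C) →
      volume A ^ (1 - l) * volume B ^ l ≤ volume C := by
  have hl1' : 0 < 1 - l := by linarith
  intro m
  induction m with
  | zero =>
    intro A B C _ _ _ h
    rcases A.eq_empty_or_nonempty with rfl | ⟨a, ha⟩
    · simp [ENNReal.zero_rpow_of_pos hl1']
    rcases B.eq_empty_or_nonempty with rfl | ⟨b, hb⟩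
    · simp [ENNReal.zero_rpow_of_pos hl0]
    have hC : C = Set.univ := Subsingleton.eq_univ_of_nonempty ⟨_, h a ha b hb⟩
    have h1 : volume (Set.univ : Set (Fin 0 → ℝ)) = 1 := by
      simp [volume_pi]
    rw [hC, h1]
    calc volume A ^ (1 - l) * volume B ^ l
        ≤ volume (Set.univ : Set (Fin 0 → ℝ)) ^ (1 - l) *
          volume (Set.univ : Set (Fin 0 → ℝ)) ^ l := by
          gcongr <;> exact Set.subset_univ _
      _ = 1 := by rw [h1]; simp
  | succ m ih =>
    intro A B C hA hB hC h
    have hfin : ∀ {A : Set (Fin (m + 1) → ℝ)}, IsCompact A → ∀ x : ℝ,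
        volume {y : Fin m → ℝ | (Fin.cons x y : Fin (m + 1) → ℝ) ∈ A} ≠ ⊤ := fun hA x =>
      (isCompact_section hA x).measure_ne_top
    have hbdd : ∀ {A : Set (Fin (m + 1) → ℝ)}, IsCompact A → BddAbove (Set.range fun x : ℝ =>
        (volume {y : Fin m → ℝ | (Fin.cons x y : Fin (m + 1) → ℝ) ∈ A}).toReal) := by
      intro A hA
      have hcomp : IsCompact ((fun z => (Fin.tail z : Fin m → ℝ)) '' A) :=
        hA.image (by unfold Fin.tail; fun_prop)
      refine ⟨(volume ((fun z => (Fin.tail z : Fin m → ℝ)) '' A)).toReal, ?_⟩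
      rintro _ ⟨x, rfl⟩
      refine ENNReal.toReal_mono hcomp.measure_ne_top (measure_mono fun y hy => ⟨_, hy, by simp⟩)
    have hPL := prekopa_leindler_real hl0 hl1
      (measurable_volume_section hA.measurableSet).ennreal_toReal
      (measurable_volume_section hB.measurableSet).ennreal_toReal
      (measurable_volume_section hC.measurableSet).ennreal_toReal
      (fun _ => ENNReal.toReal_nonneg) (fun _ => ENNReal.toReal_nonneg)
      (fun _ => ENNReal.toReal_nonneg) (hbdd hA) (hbdd hB) (by
        intro x y
        rw [ENNReal.toReal_rpow, ENNReal.toReal_rpow, ← ENNReal.toReal_mul]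
        refine ENNReal.toReal_mono (hfin hC _) (ih (isCompact_section hA x)
          (isCompact_section hB y) (isCompact_section hC _) fun a ha b hb => ?_)
        have := h _ ha _ hb
        change (Fin.cons _ _ : Fin (m + 1) → ℝ) ∈ C
        convert this using 1
        ext i
        refine Fin.cases ?_ (fun i => ?_) i <;> simp)
    simp only [ENNReal.ofReal_toReal (hfin hA _), ENNReal.ofReal_toReal (hfin hB _),
      ENNReal.ofReal_toReal (hfin hC _)] at hPL
    rwa [← volume_eq_lintegral_section hA.measurableSet,
      ← volume_eq_lintegral_section hB.measurableSet,
      ← volume_eq_lintegral_section hC.measurableSet] at hPL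

theorem brunn_minkowski {m : ℕ} {A B C : Set (Fin m → ℝ)} {l a b : ℝ} (hl0 : 0 < l) (hl1 : l < 1)
    (hA : IsCompact A) (hB : IsCompact B) (hC : IsCompact C) (hBn : B.Nonempty)
    (h : ∀ x ∈ A, ∀ y ∈ B, (1 - l) • x + l • y ∈ C)
    (ha : 0 < a) (hb : 0 ≤ b) (hAv : volume A = ENNReal.ofReal (a ^ m))
    (hBv : volume B = ENNReal.ofReal (b ^ m)) :
    ENNReal.ofReal (((1 - l) * a + l * b) ^ m) ≤ volume C := by
  have hl1' : 0 < 1 - l := by linarith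
  have hscale : ∀ (r : ℝ) (S : Set (Fin m → ℝ)), 0 ≤ r →
      volume (r • S) = ENNReal.ofReal (r ^ m) * volume S := by
    intro r S hr
    rw [Measure.addHaar_smul, abs_of_nonneg (pow_nonneg hr _)]
    simp
  rcases hb.eq_or_lt with rfl | hb
  · obtain ⟨y, hy⟩ := hBn
    rw [mul_zero, add_zero, mul_pow, ENNReal.ofReal_mul (by positivity), ← hAv,
      ← hscale _ _ hl1'.le, ← measure_preimage_add_right volume (-(l • y)), ← Set.image_add_right']
    refine measure_mono ?_
    rintro _ ⟨_, ⟨x, hx, rfl⟩, rfl⟩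
    simpa using h x hx y hy
  set s := (1 - l) * a + l * b with hs
  have hs0 : 0 < s := by positivity
  have hth0 : 0 < l * b / s := by positivity
  have hth1 : l * b / s < 1 := by
    rw [div_lt_one hs0, hs]
    have := mul_pos hl1' ha
    linarith
  have h1 := brunn_minkowski_mul hth0 hth1 (hA.smul a⁻¹) (hB.smul b⁻¹) (hC.smul s⁻¹) (by
    rintro _ ⟨x, hx, rfl⟩ _ ⟨y, hy, rfl⟩
    refine ⟨_, h x hx y hy, ?_⟩
    simp only [smul_smul, smul_add]
    congr 2
    · field_simp
      rw [hs]; ring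
    · field_simp)
  have hone : ∀ {r : ℝ} {S : Set (Fin m → ℝ)}, 0 < r → volume S = ENNReal.ofReal (r ^ m) →
      volume (r⁻¹ • S) = 1 := by
    intro r S hr hS
    rw [hscale _ _ (by positivity), hS, ← ENNReal.ofReal_mul (by positivity), ← mul_pow,
      inv_mul_cancel₀ hr.ne']
    simp
  rw [hone ha hAv, hone hb hBv, ENNReal.one_rpow, ENNReal.one_rpow, one_mul] at h1
  calc ENNReal.ofReal (s ^ m) = ENNReal.ofReal (s ^ m) * 1 := (mul_one _).symm
    _ ≤ ENNReal.ofReal (s ^ m) * volume (s⁻¹ • C) := by gcongr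
    _ = volume C := by
      rw [← hscale _ _ hs0.le, smul_smul, mul_inv_cancel₀ hs0.ne', one_smul]

end BrunnMinkowskiPi

section Comparison

lemma deriv_le_of_eventually_le {f g : ℝ → ℝ} {f' g' : ℝ} (hf : HasDerivAt f f' 0)
    (hg : HasDerivAt g g' 0) (h0 : f 0 = g 0) (h : ∀ᶠ x in nhdsWithin 0 (Set.Ioi 0), f x ≤ g x) :
    f' ≤ g' := by
  have hs : HasDerivAt (g - f) (g' - f') 0 := hg.sub hf
  have ht := hs.tendsto_slope_zero_right
  have : 0 ≤ g' - f' := by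
    refine ge_of_tendsto ht ?_
    filter_upwards [h, self_mem_nhdsWithin] with x hx hx0
    have hx0 : 0 < x := hx0
    simp only [zero_add, Pi.sub_apply, h0, sub_self, sub_zero, smul_eq_mul]
    exact mul_nonneg (inv_nonneg.2 hx0.le) (by linarith)
  linarith

lemma hasDerivAt_pow_zero (n : ℕ) : HasDerivAt (fun x : ℝ => x ^ n) (if n = 1 then 1 else 0) 0 := by
  have h : (if n = 1 then (1 : ℝ) else 0) = n * 0 ^ (n - 1) := by
    rcases n with _ | _ | n <;> simp
  rw [h]
  exact hasDerivAt_pow n (0 : ℝ)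

/-- The analytic part of the argument: the inequalities between the volume polynomial
`∑ κ a^p b^q c^r` and its geometric bounds, compared to first order at the origin. -/
lemma first_order_comparison {m k : ℕ} {κ : Fin k → ℝ} {p q r : Fin k → ℕ}
    (hsum : ∀ j, p j + q j + r j = m + 1) {P : ℝ → ℝ → ℝ → ℝ}
    (hP : ∀ a b c, P a b c = ∑ j, κ j * (a ^ p j * b ^ q j * c ^ r j))
    {V α σ ε d y : ℝ} {ψ : ℝ → ℝ} (hV : V = P 0 0 1) (hV0 : 0 < V) (hα : 0 < α) (hσ : 0 < σ)
    (hm : 1 ≤ m)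
    (hlow : ∀ a b, 0 ≤ a → 0 ≤ b → P 0 b (1 + a) + a * σ * ψ b ≤ P a b 1)
    (hup : ∀ a, 0 ≤ a → P a 0 1 ≤
      (1 + a) ^ (m + 1) * V + a * σ * ((1 + a) * (1 + a * σ / d)) ^ m * α ^ m)
    (hcut : ∀ᶠ b in nhdsWithin (0 : ℝ) (Set.Ioi 0), P 0 b 1 ≤
      (1 + b) ^ (m + 1) * V - b * ε * ((1 + b) - b * ε / d) ^ m * α ^ m)
    (hψ0 : ψ 0 = α ^ m)
    (hψ : ∀ᶠ b in nhdsWithin (0 : ℝ) (Set.Ioi 0), (α + b * y) ^ m ≤ ψ b)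
    (hBez : (m + 1) * (∑ j, κ j * ((if p j = 1 then 1 else 0) * (if q j = 1 then 1 else 0))) * V ≤
      m * (∑ j, κ j * ((if p j = 1 then 1 else 0) * (if q j = 0 then 1 else 0))) *
        (∑ j, κ j * ((if p j = 0 then 1 else 0) * (if q j = 1 then 1 else 0)))) :
    (m + 1) * V * y ≤ α * ((m + 1) * V - ε * α ^ m) := by
  have hz : ∀ n : ℕ, (0 : ℝ) ^ n = if n = 0 then 1 else 0 := fun n => zero_pow_eq n
  set p11 := ∑ j, κ j * ((if p j = 1 then 1 else 0) * (if q j = 1 then 1 else 0))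
  set p10 := ∑ j, κ j * ((if p j = 1 then 1 else 0) * (if q j = 0 then 1 else 0)) with hp10
  set p01 := ∑ j, κ j * ((if p j = 0 then 1 else 0) * (if q j = 1 then 1 else 0)) with hp01
  have hPhom : ∀ c, P 0 0 c = V * c ^ (m + 1) := by
    intro c
    rw [hV, hP, hP, Finset.sum_mul]
    refine Finset.sum_congr rfl fun j _ => ?_
    rw [hz, hz]
    by_cases h0 : p j = 0 <;> by_cases h1 : q j = 0 <;> simp [h0, h1]
    left
    rw [← hsum j, h0, h1]; simp
  have hda : ∀ b, HasDerivAt (fun a => P a b 1)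
      (∑ j, κ j * ((if p j = 1 then 1 else 0) * b ^ q j)) 0 := by
    intro b
    have hfun : (fun a => P a b 1) = fun a => ∑ j, κ j * (a ^ p j * b ^ q j) := by
      ext a; rw [hP]; simp
    rw [hfun]
    exact HasDerivAt.fun_sum fun j _ => ((hasDerivAt_pow_zero (p j)).mul_const _).const_mul _
  have hdc : ∀ b, HasDerivAt (fun a => P 0 b (1 + a))
      (∑ j, κ j * ((if p j = 0 then 1 else 0) * b ^ q j * r j)) 0 := by
    intro b
    have hfun : (fun a => P 0 b (1 + a)) =
        fun a => ∑ j, κ j * ((if p j = 0 then 1 else 0) * b ^ q j * (1 + a) ^ r j) := by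
      ext a; rw [hP]; simp only [hz]
    rw [hfun]
    refine HasDerivAt.fun_sum fun j _ => HasDerivAt.const_mul _ (HasDerivAt.const_mul _ ?_)
    have := ((hasDerivAt_id (0 : ℝ)).const_add 1).fun_pow (r j)
    simpa using this
  have hdb : HasDerivAt (fun b => P 0 b 1) p01 0 := by
    have hfun : (fun b => P 0 b 1) =
        fun b => ∑ j, κ j * ((if p j = 0 then 1 else 0) * b ^ q j) := by
      ext a; rw [hP]; simp [hz]
    rw [hfun]
    exact HasDerivAt.fun_sum fun j _ => ((hasDerivAt_pow_zero (q j)).const_mul _).const_mul _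
  have hdψ : ∀ b, 0 ≤ b → ∑ j, κ j * ((if p j = 0 then 1 else 0) * b ^ q j * r j) + σ * ψ b ≤
      ∑ j, κ j * ((if p j = 1 then 1 else 0) * b ^ q j) := by
    intro b hb
    have h1 : HasDerivAt (fun a : ℝ => a * σ * ψ b) (σ * ψ b) 0 := by
      have := ((hasDerivAt_id (0 : ℝ)).mul_const σ).mul_const (ψ b)
      simpa using this
    refine deriv_le_of_eventually_le ((hdc b).add h1) (hda b) (by simp) ?_
    filter_upwards [self_mem_nhdsWithin] with a ha
    exact hlow a b (le_of_lt ha) hb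
  have hp10' : (∑ j, κ j * ((if p j = 1 then 1 else 0) * (0 : ℝ) ^ q j)) = p10 := by
    simp only [hz, hp10]
  have hc0 : ∑ j, κ j * ((if p j = 0 then 1 else 0) * (0 : ℝ) ^ q j * r j) = (m + 1) * V := by
    have h1 : HasDerivAt (fun a => P 0 0 (1 + a)) ((m + 1) * V) 0 := by
      simp only [hPhom]
      have := (((hasDerivAt_id (0 : ℝ)).const_add 1).fun_pow (m + 1)).const_mul V
      simpa [mul_comm] using this
    exact (hdc 0).unique h1
  have hp10_eq : p10 = (m + 1) * V + σ * α ^ m := by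
    apply le_antisymm
    · have h1 : HasDerivAt (fun a : ℝ => (1 + a) ^ (m + 1) * V +
          a * σ * ((1 + a) * (1 + a * σ / d)) ^ m * α ^ m)
          ((m + 1) * V + σ * α ^ m) 0 := by
        have e1 : HasDerivAt (fun a : ℝ => (1 + a) ^ (m + 1) * V) ((m + 1) * V) 0 := by
          have := ((((hasDerivAt_id (0 : ℝ)).const_add 1).fun_pow (m + 1)).mul_const V)
          simpa using this
        have e2 : HasDerivAt (fun a : ℝ => a * (σ * ((1 + a) * (1 + a * σ / d)) ^ m * α ^ m))
            (σ * α ^ m) 0 := by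
          have hd : DifferentiableAt ℝ
              (fun a : ℝ => σ * ((1 + a) * (1 + a * σ / d)) ^ m * α ^ m) 0 := by
            fun_prop
          have := (hasDerivAt_id (0 : ℝ)).fun_mul hd.hasDerivAt
          simpa using this
        exact (e1.fun_add e2).congr_of_eventuallyEq (.of_forall fun a => by ring)
      have := deriv_le_of_eventually_le (hda 0) h1 (by simp [hV]) (by
        filter_upwards [self_mem_nhdsWithin] with a ha
        exact hup a (le_of_lt ha))
      rwa [hp10'] at this
    · have := hdψ 0 le_rfl
      rwa [hc0, hp10', hψ0] at this
  have hp01_le : p01 ≤ (m + 1) * V - ε * α ^ m := by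
    have h1 : HasDerivAt (fun b : ℝ => (1 + b) ^ (m + 1) * V -
        b * ε * ((1 + b) - b * ε / d) ^ m * α ^ m) ((m + 1) * V - ε * α ^ m) 0 := by
      have e1 : HasDerivAt (fun a : ℝ => (1 + a) ^ (m + 1) * V) ((m + 1) * V) 0 := by
        have := ((((hasDerivAt_id (0 : ℝ)).const_add 1).fun_pow (m + 1)).mul_const V)
        simpa using this
      have e2 : HasDerivAt (fun b : ℝ => b * (ε * ((1 + b) - b * ε / d) ^ m * α ^ m))
          (ε * α ^ m) 0 := by
        have hd : DifferentiableAt ℝ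
            (fun b : ℝ => ε * ((1 + b) - b * ε / d) ^ m * α ^ m) 0 := by
          fun_prop
        have := (hasDerivAt_id (0 : ℝ)).fun_mul hd.hasDerivAt
        simpa using this
      exact (e1.fun_sub e2).congr_of_eventuallyEq (.of_forall fun a => by ring)
    exact deriv_le_of_eventually_le hdb h1 (by simp [hV]) hcut
  have hmain : m * p01 + σ * (m * α ^ (m - 1) * y) ≤ p11 := by
    have h1 : HasDerivAt (fun b : ℝ => ∑ j, κ j * ((if p j = 0 then 1 else 0) * b ^ q j * r j))
        (m * p01) 0 := by
      have : m * p01 = ∑ j, κ j * ((if p j = 0 then 1 else 0) *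
          (if q j = 1 then 1 else 0) * (r j : ℝ)) := by
        rw [hp01, Finset.mul_sum]
        refine Finset.sum_congr rfl fun j _ => ?_
        by_cases h0 : p j = 0 <;> by_cases h1 : q j = 1 <;> simp [h0, h1]
        have : r j = m := by have := hsum j; omega
        rw [this]; ring
      rw [this]
      exact HasDerivAt.fun_sum fun j _ =>
        (((hasDerivAt_pow_zero (q j)).const_mul _).mul_const _).const_mul _
    have h2 : HasDerivAt (fun b : ℝ => σ * (α + b * y) ^ m) (σ * (m * α ^ (m - 1) * y)) 0 := by
      have := ((((hasDerivAt_id (0 : ℝ)).mul_const y).const_add α).fun_pow m).const_mul σ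
      simpa using this
    have h3 : HasDerivAt (fun b : ℝ => ∑ j, κ j * ((if p j = 1 then 1 else 0) * b ^ q j)) p11 0 :=
      HasDerivAt.fun_sum fun j _ => ((hasDerivAt_pow_zero (q j)).const_mul _).const_mul _
    refine deriv_le_of_eventually_le (h1.add h2) h3 ?_ ?_
    · simp only [Pi.add_apply]
      rw [hc0, hp10', hp10_eq]; simp
    · filter_upwards [hψ, self_mem_nhdsWithin] with b hb hb0
      have := hdψ b (le_of_lt hb0)
      simp only [Pi.add_apply]
      nlinarith [mul_le_mul_of_nonneg_left hb hσ.le]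
  have hαm : α ^ m = α * α ^ (m - 1) := by
    rw [← pow_succ', Nat.sub_add_cancel hm]
  rw [hp10_eq] at hBez
  have hm0 : (0 : ℝ) < m := by exact_mod_cast hm
  have hpos : (0 : ℝ) < σ * m * α ^ (m - 1) := by positivity
  have hVn : 0 < (m + 1) * V := by positivity
  have h1 : (m + 1) * V * (σ * (m * α ^ (m - 1) * y)) ≤ m * (σ * α ^ m) * p01 := by
    have := mul_le_mul_of_nonneg_left hmain hVn.le
    nlinarith
  have h2 : m * (σ * α ^ m) * p01 ≤ m * (σ * α ^ m) * ((m + 1) * V - ε * α ^ m) :=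
    mul_le_mul_of_nonneg_left hp01_le (by positivity)
  have h3 := h1.trans h2
  refine le_of_mul_le_mul_left ?_ hpos
  calc σ * m * α ^ (m - 1) * ((m + 1) * V * y) = (m + 1) * V * (σ * (m * α ^ (m - 1) * y)) := by ring
    _ ≤ m * (σ * α ^ m) * ((m + 1) * V - ε * α ^ m) := h3
    _ = m * (σ * (α * α ^ (m - 1))) * ((m + 1) * V - ε * α ^ m) := by rw [← hαm]
    _ = _ := by ring

end Comparison

section Slices

variable {m : ℕ}

lemma volume_inter_slab {B : Set (ℝ × (Fin m → ℝ))} (hB : MeasurableSet B) {I : Set ℝ}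
    (hI : MeasurableSet I) :
    volume (B ∩ Prod.fst ⁻¹' I) = ∫⁻ s in I, volume (Prod.mk s ⁻¹' B) := by
  have hBI := hB.inter (measurable_fst hI)
  rw [Measure.volume_eq_prod, Measure.prod_apply hBI, ← lintegral_indicator hI]
  refine lintegral_congr fun s => ?_
  by_cases hs : s ∈ I
  · rw [Set.indicator_of_mem hs]
    congr 1
    ext x; simp [hs]
  · rw [Set.indicator_of_notMem hs]
    convert measure_empty (μ := volume)
    ext x; simp [hs]

lemma volume_slab_le {B : Set (ℝ × (Fin m → ℝ))} (hB : MeasurableSet B) {a b : ℝ}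
    {c : ENNReal} (h : ∀ s ∈ Set.Ico a b, volume (Prod.mk s ⁻¹' B) ≤ c) :
    volume (B ∩ Prod.fst ⁻¹' Set.Ico a b) ≤ ENNReal.ofReal (b - a) * c := by
  rw [volume_inter_slab hB measurableSet_Ico]
  refine (setLIntegral_mono measurable_const h).trans ?_
  rw [setLIntegral_const, Real.volume_Ico, mul_comm]

lemma le_volume_slab {B : Set (ℝ × (Fin m → ℝ))} (hB : MeasurableSet B) {a b : ℝ}
    {c : ENNReal} (h : ∀ s ∈ Set.Ico a b, c ≤ volume (Prod.mk s ⁻¹' B)) :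
    ENNReal.ofReal (b - a) * c ≤ volume (B ∩ Prod.fst ⁻¹' Set.Ico a b) := by
  rw [volume_inter_slab hB measurableSet_Ico]
  refine le_trans ?_ (setLIntegral_mono' measurableSet_Ico h)
  rw [setLIntegral_const, Real.volume_Ico, mul_comm]

lemma volume_smul_pi {c : ℝ} (hc : 0 ≤ c) (S : Set (Fin m → ℝ)) :
    volume (c • S) = ENNReal.ofReal (c ^ m) * volume S := by
  rw [Measure.addHaar_smul, Module.finrank_fin_fun, abs_of_nonneg (pow_nonneg hc m)]

lemma volume_vadd_smul_pi {c : ℝ} (hc : 0 ≤ c) (v : Fin m → ℝ) (S : Set (Fin m → ℝ)) :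
    volume (v +ᵥ c • S) = ENNReal.ofReal (c ^ m) * volume S := by
  rw [measure_vadd, volume_smul_pi hc]

/-- If every point of `K` lies between the base `{z.1 = 0}` and the cap `{ε ≤ z.1}`, then
cutting `(1 + b) • K` at height `b * ε` gives `b • cap + K`. -/
lemma mem_smul_cap_add {K : Set (ℝ × (Fin m → ℝ))} (hK : Convex ℝ K) {ε : ℝ} (hε : 0 < ε)
    (hdec : ∀ x ∈ K, ∃ v ∈ K, ∃ w ∈ K, v.1 = 0 ∧ ε ≤ w.1 ∧ x ∈ segment ℝ v w)
    {b : ℝ} (hb : 0 ≤ b) {z : ℝ × (Fin m → ℝ)} (hz : z ∈ (1 + b) • K) (hzε : b * ε ≤ z.1) :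
    z ∈ b • (K ∩ {z | ε ≤ z.1}) + K := by
  obtain ⟨x, hx, rfl⟩ := hz
  by_cases hxε : ε ≤ x.1
  · refine ⟨b • x, Set.smul_mem_smul_set ⟨hx, hxε⟩, x, hx, ?_⟩
    simp only [add_smul, one_smul, add_comm]
  · push Not at hxε
    obtain ⟨v, hv, w, hw, hv0, hwε, α, β, hα, hβ, hαβ, rfl⟩ := hdec x hx
    have hD : 0 < w.1 := hε.trans_le hwε
    simp only [Prod.fst_add, Prod.smul_fst, hv0, smul_eq_mul, mul_zero, zero_add] at hzε hxε
    set t := ε / w.1 with ht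
    have htw : t * w.1 = ε := div_mul_cancel₀ _ hD.ne'
    have ht0 : 0 < t := by positivity
    have ht1 : t ≤ 1 := (div_le_one hD).2 hwε
    have hβt : β ≤ t := by
      by_contra hc; push Not at hc; nlinarith
    have hbt : b * t ≤ (1 + b) * β := by
      by_contra hc; push Not at hc; nlinarith
    refine ⟨b • ((1 - t) • v + t • w), Set.smul_mem_smul_set
      ⟨hK hv hw (by linarith) ht0.le (by ring), ?_⟩,
      ((1 + b) * α - b * (1 - t)) • v + ((1 + b) * β - b * t) • w,
      hK hv hw ?_ (by linarith) ?_, ?_⟩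
    · simp [hv0, htw]
    · have : α = 1 - β := by linarith
      rw [this]; nlinarith
    · linear_combination (1 + b) * hαβ
    · simp only
      module

lemma smul_cap_add_subset {K : Set (ℝ × (Fin m → ℝ))} (hK : Convex ℝ K)
    (hK0 : ∀ z ∈ K, 0 ≤ z.1) {ε b c : ℝ} (hb : 0 ≤ b) (hc : 0 ≤ c) :
    b • (K ∩ {z | ε ≤ z.1}) + c • K ⊆ (b + c) • K ∩ {z | b * ε ≤ z.1} := by
  rintro _ ⟨_, ⟨x, ⟨hx, hxε⟩, rfl⟩, _, ⟨y, hy, rfl⟩, rfl⟩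
  refine ⟨?_, ?_⟩
  · rw [hK.add_smul hb hc]
    exact Set.add_mem_add (Set.smul_mem_smul_set hx) (Set.smul_mem_smul_set hy)
  · have h1 : b * ε ≤ b * x.1 := mul_le_mul_of_nonneg_left hxε hb
    have h2 := mul_nonneg hc (hK0 y hy)
    simp only [Set.mem_ofPred_eq, Prod.fst_add, Prod.smul_fst, smul_eq_mul]
    linarith

/-- Adding `a • L`, with `L` containing `K` and `(-σ, 0)`, to the truncated body adds at least a
prism over the facet at height `b * ε`. -/
lemma volume_add_prism_le {K L : Set (ℝ × (Fin m → ℝ))} (hK : Convex ℝ K) (hKc : IsCompact K)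
    (hK0 : ∀ z ∈ K, 0 ≤ z.1) (h0K : 0 ∈ K) {ε σ : ℝ} (hε : 0 < ε) (hσ : 0 < σ)
    (hdec : ∀ x ∈ K, ∃ v ∈ K, ∃ w ∈ K, v.1 = 0 ∧ ε ≤ w.1 ∧ x ∈ segment ℝ v w)
    (hL : Convex ℝ L) (hKL : K ⊆ L) (hyL : (-σ, 0) ∈ L) {a b : ℝ} (ha : 0 ≤ a) (hb : 0 ≤ b) :
    volume (b • (K ∩ {z | ε ≤ z.1}) + (1 + a) • K) +
      ENNReal.ofReal (a * σ) * volume (Prod.mk (b * ε) ⁻¹' ((1 + b) • K)) ≤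
    volume (a • L + b • (K ∩ {z | ε ≤ z.1}) + K) := by
  set S := Prod.mk (b * ε) ⁻¹' ((1 + b) • K) with hS
  have hSm : MeasurableSet (Set.Ico (b * ε - a * σ) (b * ε) ×ˢ S) := by
    refine measurableSet_Ico.prod ?_
    exact (hKc.smul (1 + b)).isClosed.measurableSet.preimage measurable_prodMk_left
  have hvol : ENNReal.ofReal (a * σ) * volume S =
      volume (Set.Ico (b * ε - a * σ) (b * ε) ×ˢ S) := by
    rw [Measure.volume_eq_prod, Measure.prod_prod, Real.volume_Ico]
    congr 2; ring
  rw [hvol, ← measure_union _ hSm]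
  · refine measure_mono (Set.union_subset ?_ ?_)
    · rw [add_comm 1 a, hK.add_smul ha zero_le_one, one_smul, ← add_assoc,
        add_comm (b • _) (a • K)]
      exact Set.add_subset_add_right (Set.add_subset_add_right (Set.smul_set_mono hKL))
    · rintro ⟨s, w⟩ ⟨⟨hs1, hs2⟩, hw⟩
      have h1 := mem_smul_cap_add hK hε hdec hb (z := (b * ε, w)) hw le_rfl
      rw [add_assoc]
      refine ⟨(s - b * ε, 0), ?_, (b * ε, w), h1, by simp⟩
      have hs1 : b * ε - a * σ ≤ s := hs1
      have hs2 : s < b * ε := hs2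
      have ha' : 0 < a := by
        rcases ha.lt_or_eq with h | h
        · exact h
        · rw [← h] at hs1; linarith
      set θ := (b * ε - s) / (a * σ) with hθ
      have hθ0 : 0 ≤ θ := by apply div_nonneg <;> nlinarith
      have hθ1 : θ ≤ 1 := by rw [hθ, div_le_one (by positivity)]; linarith
      have := hL (hKL h0K) hyL (sub_nonneg.2 hθ1) hθ0 (by ring)
      refine ⟨_, this, ?_⟩
      ext
      · simp only [smul_zero, zero_add, Prod.smul_fst, smul_eq_mul]
        rw [hθ]; field_simp; ring
      · simp
  · rw [Set.disjoint_left]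
    rintro z hz ⟨⟨_, h2⟩, _⟩
    have := (smul_cap_add_subset hK hK0 hb (by linarith : 0 ≤ 1 + a) hz).2
    exact absurd this (not_le.2 h2)

end Slices

section SliceBounds

variable {m : ℕ}

/-- Adding `a • conv (K ∪ {(-σ, 0)})` to `K` adds little more than a prism over the facet. -/
lemma volume_add_le {J : Type*} {K L : Set (ℝ × (Fin m → ℝ))} (hKc : IsCompact K)
    {ℓ : J → (ℝ × (Fin m → ℝ)) →ₗ[ℝ] ℝ} {g : J → ℝ}
    (hKrep : K = {z | 0 ≤ z.1 ∧ ∀ j, ℓ j z ≤ g j}) (hLc : IsCompact L) {σ d : ℝ} (hσ : 0 < σ)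
    (hLσ : ∀ z ∈ L, -σ ≤ z.1) (hLg : ∀ z ∈ L, ∀ j, ℓ j z ≤ g j) (hd : 0 < d)
    {x : Fin m → ℝ} (hx : (d, x) ∈ K) {a : ℝ} (ha : 0 ≤ a) :
    volume (a • L + K) ≤ volume ((1 + a) • K) +
      ENNReal.ofReal (a * σ) *
        (ENNReal.ofReal (((1 + a) * (1 + a * σ / d)) ^ m) * volume (Prod.mk 0 ⁻¹' K)) := by
  have ha1 : 0 < 1 + a := by linarith
  have hmem : ∀ z : ℝ × (Fin m → ℝ), 0 ≤ z.1 → (∀ j, ℓ j z ≤ (1 + a) * g j) →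
      z ∈ (1 + a) • K := by
    intro z hz0 hz
    rw [Set.mem_smul_set_iff_inv_smul_mem₀ ha1.ne', hKrep]
    refine ⟨by simp only [Prod.smul_fst, smul_eq_mul]; positivity, fun j => ?_⟩
    rw [map_smul, smul_eq_mul, inv_mul_le_iff₀ ha1]
    exact hz j
  have hQ : ∀ z ∈ a • L + K, -(a * σ) ≤ z.1 ∧ ∀ j, ℓ j z ≤ (1 + a) * g j := by
    rintro _ ⟨_, ⟨y, hy, rfl⟩, k, hk, rfl⟩
    rw [hKrep] at hk
    refine ⟨?_, fun j => ?_⟩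
    · have := mul_le_mul_of_nonneg_left (hLσ y hy) ha
      have := hk.1
      simp only [Prod.fst_add, Prod.smul_fst, smul_eq_mul]; linarith
    · have := mul_le_mul_of_nonneg_left (hLg y hy j) ha
      have := hk.2 j
      simp only [map_add, map_smul, smul_eq_mul]; linarith
  have hBm : MeasurableSet (a • L + K) := ((hLc.smul a).add hKc).isClosed.measurableSet
  have hsub : a • L + K ⊆ (1 + a) • K ∪ ((a • L + K) ∩ Prod.fst ⁻¹' Set.Ico (-(a * σ)) 0) := by
    intro z hz
    by_cases h : 0 ≤ z.1
    · exact Or.inl (hmem z h (hQ z hz).2)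
    · exact Or.inr ⟨hz, (hQ z hz).1, not_le.1 h⟩
  refine (measure_mono hsub).trans ((measure_union_le _ _).trans ?_)
  gcongr
  have h := volume_slab_le hBm (a := -(a * σ)) (b := 0)
    (c := ENNReal.ofReal (((1 + a) * (1 + a * σ / d)) ^ m) * volume (Prod.mk 0 ⁻¹' K)) ?_
  · simpa using h
  intro s hs
  have hs1 := hs.1
  have hs2 := hs.2
  set D := (1 + a) * d with hD
  have hD0 : 0 < D := by positivity
  set ρ := 1 + -s / D with hρ
  have hρ1 : 1 ≤ ρ := by
    have : 0 ≤ -s / D := div_nonneg (by linarith) hD0.le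
    linarith
  have hsubset : Prod.mk s ⁻¹' (a • L + K) ⊆
      ((s / d) • x) +ᵥ (ρ * (1 + a)) • (Prod.mk (0 : ℝ) ⁻¹' K) := by
    intro w hw
    have hw' := (hQ _ hw).2
    have hx' : ∀ j, ℓ j (d, x) ≤ g j := by rw [hKrep] at hx; exact hx.2
    have hz : ((0 : ℝ), ρ⁻¹ • (w - (s / d) • x)) ∈ (1 + a) • K := by
      refine hmem _ le_rfl fun j => ?_
      have e : ((0 : ℝ), ρ⁻¹ • (w - (s / d) • x)) = ρ⁻¹ • ((s, w) + (-s / d) • (d, x)) := by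
        ext k
        · simp only [Prod.smul_fst, Prod.fst_add, smul_eq_mul]; field_simp; ring
        · simp only [Prod.smul_snd, Prod.snd_add, Pi.smul_apply, Pi.sub_apply, Pi.add_apply,
            smul_eq_mul]; ring
      rw [e, map_smul, map_add, map_smul, smul_eq_mul, smul_eq_mul,
        inv_mul_le_iff₀ (by linarith)]
      have h1 : -s / d * ℓ j (d, x) ≤ -s / d * g j :=
        mul_le_mul_of_nonneg_left (hx' j) (div_nonneg (by linarith) hd.le)
      have h2 : ρ * ((1 + a) * g j) = (1 + a) * g j + -s / d * g j := by
        rw [hρ, hD]; field_simp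
      rw [h2]; linarith [hw' j]
    obtain ⟨y, hy, hyz⟩ := hz
    refine ⟨(ρ * (1 + a)) • y.2, Set.smul_mem_smul_set ?_, ?_⟩
    · have : y.1 = 0 := by
        have := congrArg Prod.fst hyz
        simp only [Prod.smul_fst, smul_eq_mul] at this
        exact (mul_eq_zero.1 this).resolve_left ha1.ne'
      change ((0 : ℝ), y.2) ∈ K
      rw [← this]; exact hy
    · have h2 : (1 + a) • y.2 = ρ⁻¹ • (w - (s / d) • x) := congrArg Prod.snd hyz
      have hρ0 : ρ ≠ 0 := by linarith
      simp only [vadd_eq_add]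
      rw [mul_smul, h2, smul_inv_smul₀ hρ0]; abel
  refine (measure_mono hsubset).trans ?_
  rw [volume_vadd_smul_pi (by nlinarith), mul_comm ρ]
  have hρ2 : ρ ≤ 1 + a * σ / d := by
    have : -s / D ≤ a * σ / d := by
      rw [hD, div_le_div_iff₀ (by positivity) hd]
      nlinarith [mul_nonneg ha hd.le, mul_nonneg (mul_nonneg ha hσ.le) (mul_nonneg ha hd.le)]
    linarith
  gcongr

/-- The part of `(1 + b) • K` cut off below height `b * ε` is large. -/
lemma volume_cap_add_le {K : Set (ℝ × (Fin m → ℝ))} (hK : Convex ℝ K) (hKc : IsCompact K)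
    (hK0 : ∀ z ∈ K, 0 ≤ z.1) {ε d : ℝ} (hd : 0 < d)
    {x : Fin m → ℝ} (hx : (d, x) ∈ K) {b : ℝ} (hb : 0 ≤ b) (hbd : b * ε ≤ d) :
    volume (b • (K ∩ {z | ε ≤ z.1}) + K) +
      ENNReal.ofReal (b * ε) *
        (ENNReal.ofReal (((1 + b) - b * ε / d) ^ m) * volume (Prod.mk 0 ⁻¹' K)) ≤
    volume ((1 + b) • K) := by
  have hb1 : 0 < 1 + b := by linarith
  have hBm : MeasurableSet ((1 + b) • K) := (hKc.smul (1 + b)).isClosed.measurableSet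
  have h := le_volume_slab hBm (a := 0) (b := b * ε)
    (c := ENNReal.ofReal (((1 + b) - b * ε / d) ^ m) * volume (Prod.mk 0 ⁻¹' K)) ?_
  · rw [sub_zero] at h
    have hsub := smul_cap_add_subset hK hK0 hb zero_le_one (ε := ε)
    rw [one_smul, add_comm b 1] at hsub
    have hsm : MeasurableSet ((1 + b) • K ∩ Prod.fst ⁻¹' Set.Ico 0 (b * ε)) :=
      hBm.inter (measurable_fst measurableSet_Ico)
    refine (add_le_add (measure_mono hsub) h).trans ?_
    rw [← measure_union _ hsm]
    · exact measure_mono (Set.union_subset Set.inter_subset_left Set.inter_subset_left)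
    · rw [Set.disjoint_left]
      rintro z ⟨_, hz⟩ ⟨_, hz'⟩
      exact absurd hz (not_le.2 hz'.2)
  intro s hs
  have hs1 := hs.1
  have hs2 := hs.2
  have hsd : s / d ≤ 1 := (div_le_one hd).2 (by linarith)
  have hsd0 : 0 ≤ s / d := div_nonneg hs1 hd.le
  have hbε : b * ε / d ≤ 1 := (div_le_one hd).2 hbd
  have hsb : s / d ≤ b * ε / d := by gcongr
  have hsubset : ((s / d) • x) +ᵥ (1 + b - s / d) • (Prod.mk (0 : ℝ) ⁻¹' K) ⊆
      Prod.mk s ⁻¹' ((1 + b) • K) := by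
    rintro _ ⟨_, ⟨y, hy, rfl⟩, rfl⟩
    change (s, _) ∈ (1 + b) • K
    have h1 : (1 + b - s / d) • ((0 : ℝ), y) + (s / d) • (d, x) ∈
        ((1 + b - s / d) + s / d) • K := by
      rw [hK.add_smul (by linarith) hsd0]
      exact Set.add_mem_add (Set.smul_mem_smul_set hy) (Set.smul_mem_smul_set hx)
    rw [sub_add_cancel] at h1
    convert h1 using 1
    ext k
    · simp only [Prod.smul_fst, Prod.fst_add, smul_eq_mul]; field_simp; ring
    · simp; ring
  refine le_trans ?_ (measure_mono hsubset)
  rw [volume_vadd_smul_pi (by linarith)]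
  gcongr
  linarith

/-- Lower bound for the section of `(1 + b) • K` at height `b * ε`, by Brunn–Minkowski. -/
lemma eventually_pow_le_volume_slice {K : Set (ℝ × (Fin m → ℝ))} (hK : Convex ℝ K)
    (hKc : IsCompact K) {ε s α x : ℝ} (hε : 0 < ε) (hs : 0 < s) (hα : 0 < α) (hx : 0 ≤ x)
    (hA : volume (Prod.mk (0 : ℝ) ⁻¹' K) = ENNReal.ofReal (α ^ m))
    (hB : volume (Prod.mk s ⁻¹' K) = ENNReal.ofReal (x ^ m))
    (hBn : (Prod.mk s ⁻¹' K).Nonempty) :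
    ∀ᶠ b in nhdsWithin (0 : ℝ) (Set.Ioi 0), (α + b * (α + ε / s * (x - α))) ^ m ≤
      (volume (Prod.mk (b * ε) ⁻¹' ((1 + b) • K))).toReal := by
  have hev : ∀ᶠ b in nhdsWithin (0 : ℝ) (Set.Ioi 0), b * ε / ((1 + b) * s) < 1 := by
    refine Filter.Eventually.filter_mono nhdsWithin_le_nhds ?_
    have : ContinuousAt (fun b : ℝ => b * ε / ((1 + b) * s)) 0 := by
      refine ContinuousAt.div (by fun_prop) (by fun_prop) ?_
      simp [hs.ne']
    exact this.eventually_lt continuousAt_const (by simp)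
  have hsl : ∀ (B : Set (ℝ × (Fin m → ℝ))) (t : ℝ), IsCompact B → IsCompact (Prod.mk t ⁻¹' B) := by
    intro B t hB
    have : Prod.mk t ⁻¹' B = Prod.snd '' (B ∩ Prod.fst ⁻¹' {t}) := by
      ext w; simp
    rw [this]
    exact (hB.inter_right (isClosed_singleton.preimage continuous_fst)).image continuous_snd
  filter_upwards [hev, self_mem_nhdsWithin] with b hl1 hb
  have hb : 0 < b := hb
  set l := b * ε / ((1 + b) * s) with hl
  have hl0 : 0 < l := by positivity
  have hbm := brunn_minkowski hl0 hl1 (hsl _ 0 hKc) (hsl _ s hKc) (hsl _ (l * s) hKc) hBn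
    (fun u hu w hw => ?_) hα hx hA hB
  · have heq : Prod.mk (b * ε) ⁻¹' ((1 + b) • K) = (1 + b) • (Prod.mk (l * s) ⁻¹' K) := by
      ext w
      rw [Set.mem_smul_set_iff_inv_smul_mem₀ (by positivity : (1 + b) ≠ 0)]
      change (_ : ℝ × (Fin m → ℝ)) ∈ (1 + b) • K ↔ (_ : ℝ × (Fin m → ℝ)) ∈ K
      rw [Set.mem_smul_set_iff_inv_smul_mem₀ (by positivity : (1 + b) ≠ 0)]
      have : (1 + b)⁻¹ • (b * ε, w) = (l * s, (1 + b)⁻¹ • w) := by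
        ext
        · simp only [Prod.smul_fst, smul_eq_mul]; rw [hl]; field_simp
        · rfl
      rw [this]
    have hfin : volume (Prod.mk (b * ε) ⁻¹' ((1 + b) • K)) ≠ ⊤ :=
      (hsl _ _ (hKc.smul _)).measure_lt_top.ne
    rw [← ENNReal.ofReal_le_iff_le_toReal hfin, heq, volume_smul_pi (by positivity)]
    refine le_trans (le_of_eq ?_) (mul_le_mul_right hbm _)
    rw [← ENNReal.ofReal_mul (by positivity), ← mul_pow]
    congr 2
    rw [hl]; field_simp; ring
  · have := hK hu hw (sub_nonneg.2 hl1.le) hl0.le (by ring)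
    change (_ : ℝ × (Fin m → ℝ)) ∈ K
    convert this using 1
    ext <;> simp

end SliceBounds

section Apex

variable {m : ℕ}

/-- Under the Bezout inequality, the sections of `K` parallel to the base shrink at least as fast
as those of the cone with the same base and volume. -/
lemma section_le_of_bezout {J : Type*} {K : Set (ℝ × (Fin m → ℝ))} (hm : 1 ≤ m) (hK : Convex ℝ K)
    (hKc : IsCompact K) {ℓ : J → (ℝ × (Fin m → ℝ)) →ₗ[ℝ] ℝ} {g : J → ℝ}
    (hKrep : K = {z | 0 ≤ z.1 ∧ ∀ j, ℓ j z ≤ g j}) (hg : ∀ j, 0 ≤ g j)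
    {ε σ d α : ℝ} (hε : 0 < ε)
    (hdec : ∀ x ∈ K, ∃ v ∈ K, ∃ w ∈ K, v.1 = 0 ∧ ε ≤ w.1 ∧ x ∈ segment ℝ v w)
    (hσ : 0 < σ) (hLc : IsCompact (convexHull ℝ (insert (-σ, 0) K)))
    (hσg : ∀ j, ℓ j (-σ, 0) ≤ g j) (hd : 0 < d)
    {x₀ : Fin m → ℝ} (hx₀ : (d, x₀) ∈ K) (hα : 0 < α)
    (hA : volume (Prod.mk (0 : ℝ) ⁻¹' K) = ENNReal.ofReal (α ^ m)) (hV0 : 0 < (volume K).toReal)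
    {k : ℕ} {κ : Fin k → ℝ} {p q r : Fin k → ℕ} (hsum : ∀ j, p j + q j + r j = m + 1)
    (hvol : ∀ a b c : ℝ, 0 ≤ a → 0 ≤ b → 0 ≤ c →
      (volume (a • convexHull ℝ (insert (-σ, 0) K) + b • (K ∩ {z | ε ≤ z.1}) + c • K)).toReal =
        ∑ j, κ j * (a ^ p j * b ^ q j * c ^ r j))
    (hBez : (m + 1) * (∑ j, κ j * ((if p j = 1 then 1 else 0) * (if q j = 1 then 1 else 0))) *
        (volume K).toReal ≤
      m * (∑ j, κ j * ((if p j = 1 then 1 else 0) * (if q j = 0 then 1 else 0))) *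
        (∑ j, κ j * ((if p j = 0 then 1 else 0) * (if q j = 1 then 1 else 0))))
    {s x : ℝ} (hs : 0 < s) (hx : 0 ≤ x)
    (hB : volume (Prod.mk s ⁻¹' K) = ENNReal.ofReal (x ^ m))
    (hBn : (Prod.mk s ⁻¹' K).Nonempty) :
    (m + 1) * (volume K).toReal * x ≤ α * ((m + 1) * (volume K).toReal - s * α ^ m) := by
  set L := convexHull ℝ (insert (-σ, 0) K) with hLdef
  set M := K ∩ {z | ε ≤ z.1} with hMdef
  set V := (volume K).toReal with hVdef
  have hK0 : ∀ z ∈ K, 0 ≤ z.1 := fun z hz => by rw [hKrep] at hz; exact hz.1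
  have h0K : (0 : ℝ × (Fin m → ℝ)) ∈ K := by
    rw [hKrep]; exact ⟨le_rfl, fun j => by simpa using hg j⟩
  have hL : Convex ℝ L := convex_convexHull _ _
  have hKL : K ⊆ L := (Set.subset_insert _ _).trans (subset_convexHull _ _)
  have hyL : (-σ, 0) ∈ L := subset_convexHull _ _ (Set.mem_insert _ _)
  have hMc : IsCompact M := hKc.inter_right (isClosed_le continuous_const continuous_fst)
  have hLσ : ∀ z ∈ L, -σ ≤ z.1 := by
    have : L ⊆ {z | -σ ≤ z.1} := by
      refine convexHull_min ?_ (convex_halfSpace_ge ⟨fun _ _ => rfl, fun _ _ => rfl⟩ _)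
      refine Set.insert_subset (le_refl (-σ)) fun z hz => ?_
      have := hK0 z hz
      change -σ ≤ z.1; linarith
    exact this
  have hLg : ∀ z ∈ L, ∀ j, ℓ j z ≤ g j := by
    intro z hz j
    have : L ⊆ {z | ℓ j z ≤ g j} := by
      refine convexHull_min ?_ (convex_halfSpace_le (ℓ j).isLinear _)
      refine Set.insert_subset (hσg j) fun z hz => ?_
      rw [hKrep] at hz; exact hz.2 j
    exact this hz
  have hfin : ∀ a b c : ℝ, volume (a • L + b • M + c • K) ≠ ⊤ := fun a b c =>
    (((hLc.smul a).add (hMc.smul b)).add (hKc.smul c)).measure_lt_top.ne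
  have hfinK : ∀ c : ℝ, volume (c • K) ≠ ⊤ := fun c => (hKc.smul c).measure_lt_top.ne
  have hKn : K.Nonempty := ⟨0, h0K⟩
  have hLn : L.Nonempty := ⟨0, hKL h0K⟩
  obtain ⟨-, -, w, hwK, -, hwε, -⟩ := hdec 0 h0K
  have hMn : M.Nonempty := ⟨w, hwK, hwε⟩
  have hAr : (volume (Prod.mk (0 : ℝ) ⁻¹' K)).toReal = α ^ m := by
    rw [hA, ENNReal.toReal_ofReal (by positivity)]
  have hsmulK : ∀ c : ℝ, 0 ≤ c → (volume (c • K)).toReal = c ^ (m + 1) * V := by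
    intro c hc
    have : (volume : Measure (ℝ × (Fin m → ℝ))).IsAddHaarMeasure :=
      Measure.prod.instIsAddHaarMeasure volume volume
    rw [Measure.addHaar_smul, ENNReal.toReal_mul, ENNReal.toReal_ofReal (abs_nonneg _)]
    simp only [Module.finrank_prod, Module.finrank_self, Module.finrank_fin_fun]
    rw [abs_of_nonneg (pow_nonneg hc _), add_comm 1 m]
  set P : ℝ → ℝ → ℝ → ℝ := fun a b c => ∑ j, κ j * (a ^ p j * b ^ q j * c ^ r j) with hPdef
  have hPvol : ∀ a b c : ℝ, 0 ≤ a → 0 ≤ b → 0 ≤ c →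
      (volume (a • L + b • M + c • K)).toReal = P a b c := hvol
  have hPKM : ∀ b c : ℝ, 0 ≤ b → 0 ≤ c → (volume (b • M + c • K)).toReal = P 0 b c := by
    intro b c hb hc
    rw [← hPvol 0 b c le_rfl hb hc, Set.zero_smul_set hLn, zero_add]
  have hPKL : ∀ a : ℝ, 0 ≤ a → (volume (a • L + K)).toReal = P a 0 1 := by
    intro a ha
    rw [← hPvol a 0 1 ha le_rfl zero_le_one, Set.zero_smul_set hMn, add_zero, one_smul]
  have hVP : V = P 0 0 1 := by
    rw [← hPKM 0 1 le_rfl zero_le_one, Set.zero_smul_set hMn, zero_add, one_smul]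
  have key := first_order_comparison (P := P) (V := V) (α := α) (σ := σ) (ε := ε) (d := d)
    (y := α + ε / s * (x - α))
    (ψ := fun b => (volume (Prod.mk (b * ε) ⁻¹' ((1 + b) • K))).toReal)
    hsum (fun a b c => rfl) hVP hV0 hα hσ hm ?_ ?_ ?_ ?_ ?_ hBez
  · have e : (m + 1) * V * (α + ε / s * (x - α)) =
        (m + 1) * V * α + ε / s * ((m + 1) * V * x - (m + 1) * V * α) := by ring
    rw [e] at key
    have h1 : ε / s * ((m + 1) * V * x - (m + 1) * V * α) ≤ ε / s * (-(s * α * α ^ m)) := by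
      have : ε / s * (-(s * α * α ^ m)) = - (ε * α * α ^ m) := by field_simp
      rw [this]; linarith
    have := le_of_mul_le_mul_left h1 (by positivity)
    linarith
  · intro a b ha hb
    have h := volume_add_prism_le hK hKc hK0 h0K hε hσ hdec hL hKL hyL ha hb
    rw [← hPKM b (1 + a) hb (by linarith), ← hPvol a b 1 ha hb zero_le_one, one_smul]
    have hslf : volume (Prod.mk (b * ε) ⁻¹' ((1 + b) • K)) ≠ ⊤ := by
      have : IsCompact (Prod.snd '' ((1 + b) • K)) := (hKc.smul _).image continuous_snd
      refine ne_top_of_le_ne_top this.measure_lt_top.ne (measure_mono fun z hz => ⟨_, hz, rfl⟩)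
    have h2 := ENNReal.toReal_mono (by simpa using hfin a b 1) h
    rwa [ENNReal.toReal_add (((hMc.smul b).add (hKc.smul _)).measure_lt_top.ne)
      (ENNReal.mul_ne_top ENNReal.ofReal_ne_top hslf), ENNReal.toReal_mul,
      ENNReal.toReal_ofReal (by positivity)] at h2
  · intro a ha
    have h := volume_add_le hKc hKrep hLc hσ hLσ hLg hd hx₀ ha
    rw [hA] at h
    have h2 := ENNReal.toReal_mono (by finiteness [hfinK (1 + a)]) h
    rw [hPKL a ha, ENNReal.toReal_add (hfinK _) (by finiteness), hsmulK _ (by linarith),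
      ENNReal.toReal_mul, ENNReal.toReal_mul, ENNReal.toReal_ofReal (by positivity),
      ENNReal.toReal_ofReal (by positivity), ENNReal.toReal_ofReal (by positivity)] at h2
    linarith
  · have hev : ∀ᶠ b in nhdsWithin (0 : ℝ) (Set.Ioi 0), b * ε < d := by
      refine Filter.Eventually.filter_mono nhdsWithin_le_nhds ?_
      have : ContinuousAt (fun b : ℝ => b * ε) 0 := by fun_prop
      exact this.eventually_lt continuousAt_const (by simpa using hd)
    filter_upwards [hev, self_mem_nhdsWithin] with b hbd hb
    have hb : 0 < b := hb
    have h := volume_cap_add_le hK hKc hK0 hd hx₀ hb.le hbd.le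
    rw [hA] at h
    have h0 : 0 ≤ 1 + b - b * ε / d := by
      have : b * ε / d ≤ 1 := (div_le_one hd).2 hbd.le
      linarith
    have h2 := ENNReal.toReal_mono (hfinK (1 + b)) h
    have hf : volume (b • M + K) ≠ ⊤ := ((hMc.smul b).add hKc).measure_lt_top.ne
    rw [ENNReal.toReal_add hf (by finiteness), hsmulK _ (by linarith),
      ENNReal.toReal_mul, ENNReal.toReal_mul, ENNReal.toReal_ofReal (by positivity),
      ENNReal.toReal_ofReal (by positivity), ENNReal.toReal_ofReal (by positivity)] at h2
    have h3 := hPKM b 1 hb.le zero_le_one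
    rw [one_smul] at h3
    rw [← h3]
    linarith
  · simpa using hAr
  · exact eventually_pow_le_volume_slice hK hKc hε hs hα hx hA hB hBn

/-- Under the Bezout inequality, `K` reaches at least the height of the cone over its base with
the same volume. -/
lemma exists_apex_of_section_le {K : Set (ℝ × (Fin m → ℝ))} (hm : 1 ≤ m)
    (hKc : IsCompact K) (hK0 : ∀ z ∈ K, 0 ≤ z.1) (hKn : K.Nonempty) {α : ℝ} (hα : 0 < α)
    (hA : volume (Prod.mk (0 : ℝ) ⁻¹' K) = ENNReal.ofReal (α ^ m)) (hV0 : 0 < (volume K).toReal)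
    (h : ∀ s x : ℝ, 0 < s → 0 ≤ x → volume (Prod.mk s ⁻¹' K) = ENNReal.ofReal (x ^ m) →
      (Prod.mk s ⁻¹' K).Nonempty →
      (m + 1) * (volume K).toReal * x ≤ α * ((m + 1) * (volume K).toReal - s * α ^ m)) :
    ∃ z ∈ K, (m + 1) * (volume K).toReal ≤ α ^ m * z.1 := by
  set V := (volume K).toReal with hVdef
  obtain ⟨z, hzK, hz⟩ := hKc.exists_isMaxOn hKn continuous_fst.continuousOn
  refine ⟨z, hzK, ?_⟩
  set H := (m + 1) * V / α ^ m with hH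
  have hH0 : 0 < H := by positivity
  have hHV : H * α ^ m = (m + 1) * V := by rw [hH]; field_simp
  by_contra hcon
  push Not at hcon
  have hzH : z.1 < H := by rw [hH, lt_div_iff₀ (by positivity)]; linarith
  have hm0 : m ≠ 0 := by omega
  have hsec : ∀ s ∈ Set.Ico 0 H, volume (Prod.mk s ⁻¹' K) ≤
      ENNReal.ofReal (α ^ m * (1 - s / H) ^ m) := by
    intro s hs
    rcases hs.1.eq_or_lt with h0 | h0
    · rw [← h0, hA]; simp
    rcases (Prod.mk s ⁻¹' K).eq_empty_or_nonempty with he | hne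
    · rw [he]; simp
    have hfin : volume (Prod.mk s ⁻¹' K) ≠ ⊤ := by
      have : IsCompact (Prod.snd '' K) := hKc.image continuous_snd
      exact ne_top_of_le_ne_top this.measure_lt_top.ne (measure_mono fun z hz => ⟨_, hz, rfl⟩)
    set x := (volume (Prod.mk s ⁻¹' K)).toReal ^ ((m : ℝ)⁻¹) with hx
    have hx0 : 0 ≤ x := by positivity
    have hxm : x ^ m = (volume (Prod.mk s ⁻¹' K)).toReal :=
      Real.rpow_inv_natCast_pow ENNReal.toReal_nonneg hm0
    have hvx : volume (Prod.mk s ⁻¹' K) = ENNReal.ofReal (x ^ m) := by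
      rw [hxm, ENNReal.ofReal_toReal hfin]
    have := h s x h0 hx0 hvx hne
    rw [hvx, ← mul_pow]
    refine ENNReal.ofReal_le_ofReal (pow_le_pow_left₀ hx0 ?_ _)
    rw [← hHV] at this
    have hpos : 0 < H * α ^ m := by positivity
    refine le_of_mul_le_mul_left (this.trans (le_of_eq ?_)) hpos
    field_simp
  have hVle : volume K ≤ ∫⁻ s in Set.Icc 0 z.1, ENNReal.ofReal (α ^ m * (1 - s / H) ^ m) := by
    have hsub : K ⊆ K ∩ Prod.fst ⁻¹' Set.Icc 0 z.1 := fun w hw => ⟨hw, hK0 w hw, hz hw⟩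
    refine (measure_mono hsub).trans ?_
    rw [volume_inter_slab hKc.isClosed.measurableSet measurableSet_Icc]
    exact setLIntegral_mono' measurableSet_Icc
      fun s hs => hsec s ⟨hs.1, hs.2.trans_lt hzH⟩
  have hz0 : 0 ≤ z.1 := hK0 z hzK
  have hnn : ∀ s ∈ Set.Icc 0 z.1, 0 ≤ α ^ m * (1 - s / H) ^ m := by
    intro s hs
    have : s / H ≤ 1 := (div_le_one hH0).2 (hs.2.trans hzH.le)
    exact mul_nonneg (by positivity) (pow_nonneg (by linarith) _)
  have hcont : Continuous fun s : ℝ => α ^ m * (1 - s / H) ^ m := by fun_prop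
  have hderiv : ∀ s : ℝ, HasDerivAt (fun s => -V * (1 - s / H) ^ (m + 1))
      (α ^ m * (1 - s / H) ^ m) s := by
    intro s
    have h1 := ((((hasDerivAt_id s).div_const H).const_sub 1).fun_pow (m + 1)).const_mul (-V)
    refine h1.congr_deriv ?_
    simp only [id, Nat.add_sub_cancel, Nat.cast_add, Nat.cast_one]
    have : α ^ m = (m + 1) * V / H := by rw [← hHV]; field_simp
    rw [this]; ring
  have hint : ∫ s in (0 : ℝ)..z.1, α ^ m * (1 - s / H) ^ m = V - V * (1 - z.1 / H) ^ (m + 1) := by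
    rw [intervalIntegral.integral_eq_sub_of_hasDerivAt (fun s _ => hderiv s)
      (hcont.intervalIntegrable _ _)]
    simp; ring
  rw [← ofReal_integral_eq_lintegral_ofReal (hcont.integrableOn_Icc)
    ((ae_restrict_iff' measurableSet_Icc).2 (.of_forall hnn)),
    integral_Icc_eq_integral_Ioc, ← intervalIntegral.integral_of_le hz0, hint] at hVle
  have hlt : 0 < V * (1 - z.1 / H) ^ (m + 1) := by
    have : z.1 / H < 1 := (div_lt_one hH0).2 hzH
    have : 0 < 1 - z.1 / H := by linarith
    positivity
  have hV1 : volume K = ENNReal.ofReal V := (ENNReal.ofReal_toReal hKc.measure_lt_top.ne).symm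
  rw [hV1] at hVle
  have := (ENNReal.ofReal_le_ofReal_iff' (p := V)).1 hVle
  rcases this with h | h <;> linarith

end Apex

section Truncation

variable {F : Type*} [AddCommGroup F] [Module ℝ F]

lemma exists_segment_of_convexHull {V : Finset (ℝ × F)} {ε : ℝ}
    (hV : ∀ v ∈ V, v.1 = 0 ∨ ε ≤ v.1) (hε : 0 < ε)
    (h0 : ∃ z ∈ convexHull ℝ (V : Set (ℝ × F)), z.1 = 0)
    (h1 : ∃ z ∈ convexHull ℝ (V : Set (ℝ × F)), 0 < z.1) {x : ℝ × F}
    (hx : x ∈ convexHull ℝ (V : Set (ℝ × F))) :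
    ∃ v ∈ convexHull ℝ {v ∈ (V : Set (ℝ × F)) | v.1 = 0},
      ∃ w ∈ convexHull ℝ {w ∈ (V : Set (ℝ × F)) | ε ≤ w.1}, x ∈ segment ℝ v w := by
  have hfst : IsLinearMap ℝ (Prod.fst : ℝ × F → ℝ) := ⟨fun _ _ => rfl, fun _ _ => rfl⟩
  have hU : (V : Set (ℝ × F)) = {v ∈ (V : Set (ℝ × F)) | v.1 = 0} ∪ {w ∈ (V : Set (ℝ × F)) | ε ≤ w.1} := by
    ext v
    constructor
    · intro hv
      rcases hV v hv with h | h
      · exact Or.inl ⟨hv, h⟩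
      · exact Or.inr ⟨hv, h⟩
    · rintro (h | h) <;> exact h.1
  have hne0 : {v ∈ (V : Set (ℝ × F)) | v.1 = 0}.Nonempty := by
    by_contra hc
    rw [Set.not_nonempty_iff_eq_empty] at hc
    rw [hc, Set.empty_union] at hU
    obtain ⟨z, hz, hz0⟩ := h0
    rw [hU] at hz
    have : z ∈ {z : ℝ × F | ε ≤ z.1} :=
      convexHull_min (fun w hw => hw.2) (convex_halfSpace_ge hfst ε) hz
    have : ε ≤ z.1 := this
    linarith
  have hne1 : {w ∈ (V : Set (ℝ × F)) | ε ≤ w.1}.Nonempty := by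
    by_contra hc
    rw [Set.not_nonempty_iff_eq_empty] at hc
    rw [hc, Set.union_empty] at hU
    obtain ⟨z, hz, hz0⟩ := h1
    rw [hU] at hz
    have : z ∈ {z : ℝ × F | z.1 = 0} :=
      convexHull_min (fun w hw => hw.2) (convex_hyperplane hfst 0) hz
    have : z.1 = 0 := this
    linarith
  rw [hU, convexHull_union hne0 hne1, mem_convexJoin] at hx
  exact hx

lemma exists_convexHull_truncation [DecidableEq (ℝ × F)] {V : Finset (ℝ × F)} {ε : ℝ}
    (hV : ∀ v ∈ V, v.1 = 0 ∨ ε ≤ v.1) (hε : 0 < ε)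
    (h0 : ∃ z ∈ convexHull ℝ (V : Set (ℝ × F)), z.1 = 0)
    (h1 : ∃ z ∈ convexHull ℝ (V : Set (ℝ × F)), 0 < z.1) :
    ∃ T : Finset (ℝ × F),
      convexHull ℝ (V : Set (ℝ × F)) ∩ {z | ε ≤ z.1} = convexHull ℝ (T : Set (ℝ × F)) := by
  have hfst : IsLinearMap ℝ (Prod.fst : ℝ × F → ℝ) := ⟨fun _ _ => rfl, fun _ _ => rfl⟩
  set p : ℝ × F → ℝ × F → ℝ × F := fun v w => (1 - ε / w.1) • v + (ε / w.1) • w with hp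
  set V0 := V.filter fun v => v.1 = 0 with hV0
  set V1 := V.filter fun v => ε ≤ v.1 with hV1
  have hV0c : (V0 : Set (ℝ × F)) = {v ∈ (V : Set (ℝ × F)) | v.1 = 0} := by ext; simp [hV0]
  have hV1c : (V1 : Set (ℝ × F)) = {v ∈ (V : Set (ℝ × F)) | ε ≤ v.1} := by ext; simp [hV1]
  refine ⟨V1 ∪ Finset.image₂ p V0 V1, ?_⟩
  set Q := convexHull ℝ ((V1 ∪ Finset.image₂ p V0 V1 : Finset (ℝ × F)) : Set (ℝ × F)) with hQ
  have hQc : Convex ℝ Q := convex_convexHull _ _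
  have hTQ : ∀ x ∈ V1 ∪ Finset.image₂ p V0 V1, x ∈ Q := fun x hx => subset_convexHull _ _ hx
  have hp1 : ∀ v w : ℝ × F, v.1 = 0 → ε ≤ w.1 → (p v w).1 = ε := by
    intro v w hv hw
    have : w.1 ≠ 0 := by linarith
    simp [hp, hv, this]
  apply Set.Subset.antisymm
  · rintro x ⟨hx, hxε⟩
    obtain ⟨v, hv, w, hw, hxs⟩ := exists_segment_of_convexHull hV hε h0 h1 hx
    have hv0 : v.1 = 0 := convexHull_min (fun w hw => hw.2) (convex_hyperplane hfst 0) hv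
    have hwε : ε ≤ w.1 := convexHull_min (fun w hw => hw.2) (convex_halfSpace_ge hfst ε) hw
    have hpQ1 : ∀ w ∈ V1, p v w ∈ Q := by
      intro w hw
      have : v ∈ {v | p v w ∈ Q} := by
        refine convexHull_min ?_ ?_ hv
        · intro v' hv'
          rw [← hV0c] at hv'
          exact hTQ _ (Finset.mem_union_right _ (Finset.mem_image₂_of_mem hv' hw))
        · intro v1 h1 v2 h2 a b ha hb hab
          change p _ w ∈ Q
          have e : p (a • v1 + b • v2) w = a • p v1 w + b • p v2 w := by
            have hb' : b = 1 - a := by linarith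
            simp only [hp, hb']; module
          rw [e]; exact hQc h1 h2 ha hb hab
      exact this
    have hpQ : p v w ∈ Q := by
      have : w ∈ {w : ℝ × F | ε ≤ w.1 ∧ p v w ∈ Q} := by
        refine convexHull_min ?_ ?_ hw
        · intro w' hw'
          refine ⟨hw'.2, hpQ1 w' ?_⟩
          rw [← hV1c] at hw'; exact hw'
        · intro w1 h1 w2 h2 a b ha hb hab
          have hd1 : 0 < w1.1 := hε.trans_le h1.1
          have hd2 : 0 < w2.1 := hε.trans_le h2.1
          have hd : ε ≤ a * w1.1 + b * w2.1 := by
            have := mul_le_mul_of_nonneg_left h1.1 ha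
            have := mul_le_mul_of_nonneg_left h2.1 hb
            have : a * ε + b * ε = ε := by rw [← add_mul, hab, one_mul]
            linarith
          have hd0 : 0 < a * w1.1 + b * w2.1 := hε.trans_le hd
          refine ⟨by simpa using hd, ?_⟩
          set D := a * w1.1 + b * w2.1 with hD
          have e : p v (a • w1 + b • w2) =
              (a * w1.1 / D) • p v w1 + (b * w2.1 / D) • p v w2 := by
            have h3 : (a • w1 + b • w2).1 = D := by simp [hD]
            simp only [hp, h3]
            have i1 : a * w1.1 / D * (ε / w1.1) = ε / D * a := by field_simp
            have i2 : b * w2.1 / D * (ε / w2.1) = ε / D * b := by field_simp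
            have i3 : a * w1.1 / D * (1 - ε / w1.1) + b * w2.1 / D * (1 - ε / w2.1) =
                1 - ε / D := by
              have : a * w1.1 / D + b * w2.1 / D = 1 := by rw [← add_div, ← hD, div_self hd0.ne']
              have : ε / D * a + ε / D * b = ε / D := by rw [← mul_add, hab, mul_one]
              linarith
            rw [← i3]
            simp only [smul_add, add_smul, smul_smul, i1, i2]
            abel
          rw [e]
          refine hQc h1.2 h2.2 (by positivity) (by positivity) ?_
          rw [← add_div, ← hD, div_self hd0.ne']
      exact this.2
    have hwQ : w ∈ Q := by
      refine convexHull_mono ?_ hw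
      rw [← hV1c]; exact_mod_cast Finset.subset_union_left
    obtain ⟨a, b, ha, hb, hab, rfl⟩ := hxs
    have hw0 : 0 < w.1 := hε.trans_le hwε
    have hbw : ε ≤ b * w.1 := by
      have : ε ≤ (a • v + b • w).1 := hxε
      simpa [hv0] using this
    rcases hwε.eq_or_lt with he | hlt
    · have hb1 : b = 1 := by
        have : 1 ≤ b := by
          by_contra hc; push Not at hc; nlinarith
        linarith
      have ha0 : a = 0 := by linarith
      simpa [ha0, hb1] using hwQ
    · have hden : 0 < 1 - ε / w.1 := by rw [sub_pos, div_lt_one hw0]; exact hlt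
      have e : a • v + b • w = (a / (1 - ε / w.1)) • p v w + (1 - a / (1 - ε / w.1)) • w := by
        have i1 : a / (1 - ε / w.1) * (1 - ε / w.1) = a := div_mul_cancel₀ _ hden.ne'
        have i2 : a / (1 - ε / w.1) * (ε / w.1) + (1 - a / (1 - ε / w.1)) = b := by
          linear_combination -hab - i1
        simp only [hp, smul_add, smul_smul, i1]
        rw [add_assoc, ← add_smul, i2]
      rw [e]
      refine hQc hpQ hwQ (by positivity) ?_ (by ring)
      rw [sub_nonneg, div_le_one hden, le_sub_iff_add_le]
      have : ε / w.1 ≤ b := by rw [div_le_iff₀ hw0]; exact hbw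
      linarith
  · refine convexHull_min ?_ ((convex_convexHull _ _).inter (convex_halfSpace_ge hfst ε))
    intro x hx
    rcases Finset.mem_union.1 (Finset.mem_coe.1 hx) with hx | hx
    · have := (Finset.mem_filter.1 hx)
      exact ⟨subset_convexHull _ _ this.1, this.2⟩
    · obtain ⟨v, hv, w, hw, rfl⟩ := Finset.mem_image₂.1 hx
      have hv := Finset.mem_filter.1 hv
      have hw := Finset.mem_filter.1 hw
      have hw0 : 0 < w.1 := hε.trans_le hw.2
      refine ⟨convex_convexHull ℝ _ (subset_convexHull _ _ hv.1) (subset_convexHull _ _ hw.1) ?_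
        (by positivity) (by ring), (hp1 v w hv.2 hw.2).ge⟩
      rw [sub_nonneg, div_le_one hw0]; exact hw.2

end Truncation

section Cone

variable {m : ℕ}

/-- A convex body whose volume is at most that of the cone over its base with apex `p` is that
cone. -/
lemma mem_segment_apex {K : Set (ℝ × (Fin m → ℝ))} (hK : Convex ℝ K)
    (hKc : IsCompact K) (hKi : (interior K).Nonempty) {α : ℝ}
    (hα : 0 ≤ α) (hA : volume (Prod.mk (0 : ℝ) ⁻¹' K) = ENNReal.ofReal (α ^ m))
    {p : ℝ × (Fin m → ℝ)} (hp : p ∈ K) (hp0 : 0 < p.1)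
    (hV : (m + 1) * (volume K).toReal ≤ α ^ m * p.1) {z : ℝ × (Fin m → ℝ)} (hz : z ∈ K) :
    ∃ v ∈ K, v.1 = 0 ∧ z ∈ segment ℝ v p := by
  set B := K ∩ Prod.fst ⁻¹' {0} with hB
  have hBc : IsCompact B := hKc.inter_right (isClosed_singleton.preimage continuous_fst)
  set C := (fun q : ℝ × (ℝ × (Fin m → ℝ)) => (1 - q.1) • q.2 + q.1 • p) '' (Set.Icc 0 1 ×ˢ B)
    with hC
  have hCc : IsCompact C := (isCompact_Icc.prod hBc).image (by fun_prop)
  have hCK : C ⊆ K := by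
    rintro _ ⟨⟨θ, v⟩, ⟨hθ, hv⟩, rfl⟩
    exact hK hv.1 hp (sub_nonneg.2 hθ.2) hθ.1 (by ring)
  suffices hzC : z ∈ C by
    obtain ⟨⟨θ, v⟩, ⟨hθ, hv⟩, rfl⟩ := hzC
    exact ⟨v, hv.1, hv.2, 1 - θ, θ, sub_nonneg.2 hθ.2, hθ.1, by ring, rfl⟩
  have hvolC : volume K ≤ volume C := by
    set h := p.1 with hh
    have hsec : ∀ s ∈ Set.Icc 0 h, ENNReal.ofReal (α ^ m * (1 - s / h) ^ m) ≤
        volume (Prod.mk s ⁻¹' C) := by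
      intro s hs
      have hs1 : s / h ≤ 1 := (div_le_one hp0).2 hs.2
      have hs0 : 0 ≤ s / h := div_nonneg hs.1 hp0.le
      have hsub : ((s / h) • p.2) +ᵥ (1 - s / h) • (Prod.mk (0 : ℝ) ⁻¹' K) ⊆ Prod.mk s ⁻¹' C := by
        rintro _ ⟨_, ⟨y, hy, rfl⟩, rfl⟩
        refine ⟨(s / h, (0, y)), ⟨⟨hs0, hs1⟩, hy, rfl⟩, ?_⟩
        ext k
        · simp [← hh, hp0.ne']
        · simp; ring
      refine le_trans ?_ (measure_mono hsub)
      rw [volume_vadd_smul_pi (by linarith), hA, ← ENNReal.ofReal_mul (by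
        exact pow_nonneg (by linarith) _), mul_comm]
    have h1 : ∫⁻ s in Set.Icc 0 h, ENNReal.ofReal (α ^ m * (1 - s / h) ^ m) ≤ volume C := by
      refine le_trans ?_ (measure_mono (Set.inter_subset_left (s := C)
        (t := Prod.fst ⁻¹' Set.Icc 0 h)))
      rw [volume_inter_slab hCc.isClosed.measurableSet measurableSet_Icc]
      exact setLIntegral_mono' measurableSet_Icc hsec
    have hnn : ∀ s ∈ Set.Icc 0 h, 0 ≤ α ^ m * (1 - s / h) ^ m := by
      intro s hs
      have : s / h ≤ 1 := (div_le_one hp0).2 hs.2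
      exact mul_nonneg (by positivity) (pow_nonneg (by linarith) _)
    have hcont : Continuous fun s : ℝ => α ^ m * (1 - s / h) ^ m := by fun_prop
    have hderiv : ∀ s : ℝ, HasDerivAt (fun s => -(α ^ m * h / (m + 1)) * (1 - s / h) ^ (m + 1))
        (α ^ m * (1 - s / h) ^ m) s := by
      intro s
      have h1 := ((((hasDerivAt_id s).div_const h).const_sub 1).fun_pow (m + 1)).const_mul
        (-(α ^ m * h / (m + 1)))
      refine h1.congr_deriv ?_
      simp only [id, Nat.add_sub_cancel, Nat.cast_add, Nat.cast_one]
      field_simp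
    have hint : ∫ s in (0 : ℝ)..h, α ^ m * (1 - s / h) ^ m = α ^ m * h / (m + 1) := by
      rw [intervalIntegral.integral_eq_sub_of_hasDerivAt (fun s _ => hderiv s)
        (hcont.intervalIntegrable _ _)]
      simp [hp0.ne']
    rw [← ofReal_integral_eq_lintegral_ofReal (hcont.integrableOn_Icc)
      ((ae_restrict_iff' measurableSet_Icc).2 (.of_forall hnn)),
      integral_Icc_eq_integral_Ioc, ← intervalIntegral.integral_of_le hp0.le, hint] at h1
    refine le_trans ?_ h1
    rw [← ENNReal.ofReal_toReal hKc.measure_lt_top.ne]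
    refine ENNReal.ofReal_le_ofReal ?_
    rw [le_div_iff₀ (by positivity)]; linarith
  have hdiff : volume (K \ C) = 0 := by
    rw [measure_sdiff hCK hCc.isClosed.measurableSet.nullMeasurableSet hCc.measure_lt_top.ne]
    exact tsub_eq_zero_of_le hvolC
  by_contra hzC
  have hcl : z ∈ closure (interior K) := by
    rw [hK.closure_interior_eq_closure_of_nonempty_interior hKi]
    exact subset_closure hz
  obtain ⟨y, hyC, hyK⟩ := mem_closure_iff.1 hcl Cᶜ hCc.isClosed.isOpen_compl hzC
  have hopen : IsOpen (Cᶜ ∩ interior K) := hCc.isClosed.isOpen_compl.inter isOpen_interior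
  refine (hopen.measure_pos volume ⟨y, hyC, hyK⟩).ne' (measure_mono_null ?_ hdiff)
  exact fun w hw => ⟨interior_subset hw.2, hw.1⟩

end Cone

section Facets

variable {n : ℕ}

lemma dimH_submodule {E : Type*} [NormedAddCommGroup E] [NormedSpace ℝ E] [FiniteDimensional ℝ E]
    (S : Submodule ℝ E) : dimH (S : Set E) = Module.finrank ℝ S := by
  rw [← Real.dimH_univ_eq_finrank S, ← S.subtypeₗᵢ.isometry.dimH_image]
  congr 1
  ext x; simp

/-- The intersection of two non-parallel hyperplanes is null for the `(n-1)`-dimensional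
Hausdorff measure. -/
lemma hausdorffMeasure_inter_hyperplanes {a b : EuclideanSpace ℝ (Fin n)}
    (hab : LinearIndependent ℝ ![a, b]) (s t : ℝ) :
    μH[(n : ℝ) - 1] {x : EuclideanSpace ℝ (Fin n) | ⟪x, a⟫ = s ∧ ⟪x, b⟫ = t} = 0 := by
  set W := Submodule.span ℝ (Set.range ![a, b]) with hW
  have hfr : Module.finrank ℝ W = 2 := by
    rw [hW, finrank_span_eq_card hab]; simp
  have hsum := Submodule.finrank_add_finrank_orthogonal W
  rw [hfr, finrank_euclideanSpace_fin] at hsum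
  rcases Set.eq_empty_or_nonempty {x : EuclideanSpace ℝ (Fin n) | ⟪x, a⟫ = s ∧ ⟪x, b⟫ = t} with
    he | ⟨x₀, hx₀⟩
  · rw [he]; simp
  have hsub : {x : EuclideanSpace ℝ (Fin n) | ⟪x, a⟫ = s ∧ ⟪x, b⟫ = t} ⊆
      (fun y => x₀ + y) '' (Wᗮ : Set (EuclideanSpace ℝ (Fin n))) := by
    intro x hx
    refine ⟨x - x₀, ?_, by simp⟩
    rw [SetLike.mem_coe, hW, Submodule.mem_orthogonal]
    intro y hy
    refine Submodule.span_induction ?_ ?_ ?_ ?_ hy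
    · rintro _ ⟨k, rfl⟩
      fin_cases k
      · change ⟪a, x - x₀⟫ = 0
        rw [real_inner_comm, inner_sub_left, hx.1, hx₀.1, sub_self]
      · change ⟪b, x - x₀⟫ = 0
        rw [real_inner_comm, inner_sub_left, hx.2, hx₀.2, sub_self]
    · simp
    · intro u v _ _ hu hv; rw [inner_add_left, hu, hv, add_zero]
    · intro c u _ hu; rw [inner_smul_left, hu, mul_zero]
  refine measure_mono_null hsub ?_
  have hn : (n : ℝ) - 1 = ((n - 1 : ℕ) : NNReal) := by
    have : 1 ≤ n := by omega
    rw [NNReal.coe_natCast, Nat.cast_sub this, Nat.cast_one]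
  rw [hn]
  refine hausdorffMeasure_of_dimH_lt ?_
  have hiso : Isometry fun y : EuclideanSpace ℝ (Fin n) => x₀ + y := isometry_add_left x₀
  rw [hiso.dimH_image, dimH_submodule]
  have : Module.finrank ℝ Wᗮ < n - 1 := by omega
  exact_mod_cast this

lemma interior_inner_eq_empty {a : EuclideanSpace ℝ (Fin n)} (ha : a ≠ 0) (s : ℝ) :
    interior {x : EuclideanSpace ℝ (Fin n) | ⟪x, a⟫ = s} = ∅ := by
  by_contra hc
  obtain ⟨x, hx⟩ := Set.nonempty_iff_ne_empty.2 hc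
  have hx1 : ⟪x, a⟫ = s :=
    (interior_subset hx : x ∈ {x : EuclideanSpace ℝ (Fin n) | ⟪x, a⟫ = s})
  have hcont : ContinuousAt (fun t : ℝ => x + t • a) 0 := by fun_prop
  have hev : ∀ᶠ t in nhds (0 : ℝ), x + t • a ∈ {x : EuclideanSpace ℝ (Fin n) | ⟪x, a⟫ = s} := by
    apply hcont.eventually_mem
    simpa using mem_interior_iff_mem_nhds.1 hx
  obtain ⟨t, ht, ht0⟩ := ((hev.filter_mono nhdsWithin_le_nhds).and
    (self_mem_nhdsWithin (s := Set.Ioi (0 : ℝ)))).exists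
  have ht0 : 0 < t := ht0
  have ht : ⟪x + t • a, a⟫ = s := ht
  rw [inner_add_left, inner_smul_left, hx1] at ht
  have h1 : t * ⟪a, a⟫ = 0 := by simpa using ht
  rcases mul_eq_zero.1 h1 with h | h
  · exact ht0.ne' h
  · exact ha (inner_self_eq_zero.1 h)

/-- Two distinct facets of a convex body meet in a set of dimension less than `n - 1`. -/
lemma hausdorffMeasure_facet_inter {K : Set (EuclideanSpace ℝ (Fin n))}
    (hKi : (interior K).Nonempty) {a b : EuclideanSpace ℝ (Fin n)} (ha : ‖a‖ = 1) (hb : ‖b‖ = 1)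
    (hab : a ≠ b) {s t : ℝ} (hKa : ∀ x ∈ K, ⟪x, a⟫ ≤ s) (hKb : ∀ x ∈ K, ⟪x, b⟫ ≤ t) :
    μH[(n : ℝ) - 1] (K ∩ {x | ⟪x, a⟫ = s ∧ ⟪x, b⟫ = t}) = 0 := by
  have ha0 : a ≠ 0 := by rintro rfl; simp at ha
  by_cases hli : LinearIndependent ℝ ![a, b]
  · exact measure_mono_null Set.inter_subset_right (hausdorffMeasure_inter_hyperplanes hli s t)
  · rw [LinearIndependent.pair_iff' ha0] at hli
    push Not at hli
    obtain ⟨c, rfl⟩ := hli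
    rw [norm_smul, ha, mul_one, Real.norm_eq_abs] at hb
    have hc : c = -1 := by
      rcases abs_eq (zero_le_one) |>.1 hb with h | h
      · exact absurd (by rw [h, one_smul]) hab
      · exact h
    convert measure_empty (μ := μH[(n : ℝ) - 1])
    rw [Set.eq_empty_iff_forall_notMem]
    rintro x ⟨hxK, hxa, hxb⟩
    have hsub : K ⊆ {x | ⟪x, a⟫ = s} := by
      intro y hy
      refine le_antisymm (hKa y hy) ?_
      have h1 := hKb y hy
      simp only [hc, neg_smul, one_smul, inner_neg_right] at h1 hxb
      linarith
    obtain ⟨z, hz⟩ := hKi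
    have := interior_mono hsub hz
    rw [interior_inner_eq_empty ha0] at this
    exact this

end Facets

section Coordinates

variable {m : ℕ}

/-- Volume-preserving linear coordinates with prescribed first coordinate. -/
lemma exists_measurePreserving_coordinates {v : EuclideanSpace ℝ (Fin (m + 1))} (hv : ‖v‖ = 1) :
    ∃ Φ : EuclideanSpace ℝ (Fin (m + 1)) ≃L[ℝ] ℝ × (Fin m → ℝ),
      MeasurePreserving Φ volume volume ∧ ∀ x, (Φ x).1 = ⟪x, v⟫ := by
  obtain ⟨b, hb⟩ := Orthonormal.exists_orthonormalBasis_extension_of_card_eq (𝕜 := ℝ)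
    (E := EuclideanSpace ℝ (Fin (m + 1))) (ι := Fin (m + 1)) (by simp)
    (v := fun _ => v) (s := {0}) (by
      refine ⟨fun _ => hv, fun i j hij => ?_⟩
      exact absurd (Subsingleton.elim i j) hij)
  have hb0 : b 0 = v := hb 0 rfl
  let e3 : (Fin (m + 1) → ℝ) ≃ₗ[ℝ] ℝ × (Fin m → ℝ) :=
    { toFun := fun f => (f 0, fun k => f k.succ)
      invFun := fun q => Fin.cons q.1 q.2
      map_add' := fun _ _ => rfl
      map_smul' := fun _ _ => rfl
      left_inv := fun f => by
        ext k; refine Fin.cases ?_ (fun k => ?_) k <;> simp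
      right_inv := fun q => by ext <;> simp }
  let e : EuclideanSpace ℝ (Fin (m + 1)) ≃ₗ[ℝ] ℝ × (Fin m → ℝ) :=
    (b.repr.toLinearEquiv.trans (WithLp.linearEquiv 2 ℝ (Fin (m + 1) → ℝ))).trans e3
  refine ⟨e.toContinuousLinearEquiv, ?_, fun x => ?_⟩
  · have h1 := b.repr.measurePreserving
    have h2 := PiLp.volume_preserving_ofLp (Fin (m + 1))
    have h3 := volume_preserving_piFinSuccAbove (fun _ : Fin (m + 1) => ℝ) 0
    have h := (h3.comp h2).comp h1
    exact h
  · change b.repr x 0 = _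
    rw [b.repr_apply_apply, hb0, real_inner_comm]

/-- A subset of a hyperplane with nonzero `m`-dimensional Hausdorff measure has positive volume
in coordinates. -/
lemma volume_slice_ne_zero (Φ : EuclideanSpace ℝ (Fin (m + 1)) ≃L[ℝ] ℝ × (Fin m → ℝ))
    {F : Set (EuclideanSpace ℝ (Fin (m + 1)))} {x₀ : EuclideanSpace ℝ (Fin (m + 1))}
    (hF : μH[((m + 1 : ℕ) : ℝ) - 1] F ≠ 0) (hF0 : ∀ x ∈ F, (Φ (x - x₀)).1 = 0)
    {S : Set (Fin m → ℝ)} (hS : ∀ x ∈ F, (Φ (x - x₀)).2 ∈ S) : volume S ≠ 0 := by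
  intro h0
  apply hF
  let f : (Fin m → ℝ) →L[ℝ] EuclideanSpace ℝ (Fin (m + 1)) :=
    (Φ.symm : ℝ × (Fin m → ℝ) →L[ℝ] _).comp (ContinuousLinearMap.inr ℝ ℝ (Fin m → ℝ))
  have hlip := f.lipschitz
  have hsub : F ⊆ (fun y => x₀ + y) '' (f '' S) := by
    intro x hx
    refine ⟨x - x₀, ⟨_, hS x hx, ?_⟩, by simp⟩
    have : Φ (x - x₀) = (0, (Φ (x - x₀)).2) := by rw [← hF0 x hx]
    change Φ.symm (0, (Φ (x - x₀)).2) = _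
    rw [← this, Φ.symm_apply_apply]
  refine measure_mono_null hsub ?_
  rw [Isometry.hausdorffMeasure_image (isometry_add_left x₀) (Or.inl (by push_cast; simp))]
  have h1 := (hlip.lipschitzOnWith (s := S)).hausdorffMeasure_image_le
    (d := ((m + 1 : ℕ) : ℝ) - 1) (by push_cast; simp)
  have h2 : μH[((m + 1 : ℕ) : ℝ) - 1] S = 0 := by
    have : ((m + 1 : ℕ) : ℝ) - 1 = (Fintype.card (Fin m) : ℝ) := by simp
    rw [this, hausdorffMeasure_pi_real, h0]
  rw [h2, mul_zero] at h1
  exact le_antisymm h1 bot_le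

end Coordinates

section Core

variable {m N : ℕ}

/-- A polytope satisfying the Bezout inequality for small inward displacements of its `i`-th facet
is a pyramid over that facet: all the other facets have a common point. -/
lemma exists_apex_of_bezout (hm : 1 ≤ m) {K : Set (EuclideanSpace ℝ (Fin (m + 1)))}
    (hKi : (interior K).Nonempty) {s : Finset (EuclideanSpace ℝ (Fin (m + 1)))}
    (hKs : K = convexHull ℝ (s : Set (EuclideanSpace ℝ (Fin (m + 1)))))
    {u : Fin N → EuclideanSpace ℝ (Fin (m + 1))} (hu : ∀ j, ‖u j‖ = 1)
    (huinj : Function.Injective u) {h : Fin N → ℝ} (hKrep : ∀ x, x ∈ K ↔ ∀ j, ⟪x, u j⟫ ≤ h j)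
    (hfacet : ∀ j, μH[((m + 1 : ℕ) : ℝ) - 1] (K ∩ {x | ⟪x, u j⟫ = h j}) ≠ 0) (i : Fin N)
    {δ : ℝ} (hδ : 0 < δ)
    (hBez : ∀ ε : ℝ, 0 < ε → ε < δ → ∀ L M : Finset (EuclideanSpace ℝ (Fin (m + 1))),
      L.Nonempty → M.Nonempty →
      convexHull ℝ (M : Set (EuclideanSpace ℝ (Fin (m + 1)))) = K ∩ {x | ⟪x, u i⟫ ≤ h i - ε} →
      ∀ (k : ℕ) (κ : Fin k → ℝ) (p q r : Fin k → ℕ), (∀ j, p j + q j + r j = m + 1) →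
      (∀ a b c : ℝ, 0 ≤ a → 0 ≤ b → 0 ≤ c →
        (volume (a • convexHull ℝ (L : Set (EuclideanSpace ℝ (Fin (m + 1)))) +
          b • convexHull ℝ (M : Set (EuclideanSpace ℝ (Fin (m + 1)))) + c • K)).toReal =
        ∑ j, κ j * (a ^ p j * b ^ q j * c ^ r j)) →
      (m + 1) * (∑ j, κ j * ((if p j = 1 then 1 else 0) * (if q j = 1 then 1 else 0))) *
        (volume K).toReal ≤
      m * (∑ j, κ j * ((if p j = 1 then 1 else 0) * (if q j = 0 then 1 else 0))) *
        (∑ j, κ j * ((if p j = 0 then 1 else 0) * (if q j = 1 then 1 else 0)))) :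
    ∃ p ∈ K, ⟪p, u i⟫ < h i ∧ ∀ j, j ≠ i → ⟪p, u j⟫ = h j := by
  classical
  have hKle : ∀ j, ∀ x ∈ K, ⟪x, u j⟫ ≤ h j := fun j x hx => (hKrep x).1 hx j
  have hKc : IsCompact K := by rw [hKs]; exact s.finite_toSet.isCompact_convexHull ℝ
  have hKcv : Convex ℝ K := by rw [hKs]; exact convex_convexHull _ _
  have hnull : ∀ j, j ≠ i → μH[((m + 1 : ℕ) : ℝ) - 1]
      (K ∩ {x | ⟪x, u i⟫ = h i ∧ ⟪x, u j⟫ = h j}) = 0 := fun j hj =>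
    hausdorffMeasure_facet_inter hKi (hu i) (hu j) (fun e => hj (huinj e).symm) (hKle i) (hKle j)
  -- a point in the relative interior of the `i`-th facet
  obtain ⟨x₀, hx₀K, hx₀i, hx₀j⟩ : ∃ x₀ ∈ K, ⟪x₀, u i⟫ = h i ∧ ∀ j, j ≠ i → ⟪x₀, u j⟫ < h j := by
    by_contra hcon
    push Not at hcon
    apply hfacet i
    have hsub : K ∩ {x | ⟪x, u i⟫ = h i} ⊆
        ⋃ j ∈ {j | j ≠ i}, K ∩ {x | ⟪x, u i⟫ = h i ∧ ⟪x, u j⟫ = h j} := by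
      rintro x ⟨hxK, hxi⟩
      obtain ⟨j, hj, hxj⟩ := hcon x hxK hxi
      simp only [Set.mem_iUnion]
      exact ⟨j, hj, hxK, hxi, le_antisymm (hKle j x hxK) hxj⟩
    refine measure_mono_null hsub ((measure_biUnion_null_iff (Set.to_countable _)).2 ?_)
    exact fun j hj => hnull j hj
  obtain ⟨Φ, hΦ, hΦ1⟩ := exists_measurePreserving_coordinates (m := m) (v := -u i) (by simp [hu])
  set T : EuclideanSpace ℝ (Fin (m + 1)) →ᵃ[ℝ] ℝ × (Fin m → ℝ) :=
    (Φ : EuclideanSpace ℝ (Fin (m + 1)) →ₗ[ℝ] ℝ × (Fin m → ℝ)).toAffineMap -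
      AffineMap.const ℝ _ (Φ x₀) with hTdef
  set U : ℝ × (Fin m → ℝ) →ᵃ[ℝ] EuclideanSpace ℝ (Fin (m + 1)) :=
    (Φ.symm : ℝ × (Fin m → ℝ) →ₗ[ℝ] EuclideanSpace ℝ (Fin (m + 1))).toAffineMap +
      AffineMap.const ℝ _ x₀ with hUdef
  have hT : ∀ x, T x = Φ (x - x₀) := fun x => by rw [map_sub]; rfl
  have hU : ∀ z, U z = Φ.symm z + x₀ := fun z => rfl
  have hUT : ∀ x, U (T x) = x := fun x => by rw [hU, hT]; simp
  have hTU : ∀ z, T (U z) = z := fun z => by rw [hU, hT]; simp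
  have hT1 : ∀ x, (T x).1 = h i - ⟪x, u i⟫ := fun x => by
    rw [hT, hΦ1, inner_neg_right, inner_sub_left, hx₀i]; ring
  have hU1 : ∀ z : ℝ × (Fin m → ℝ), ⟪U z, u i⟫ = h i - z.1 := fun z => by
    have := hT1 (U z); rw [hTU] at this; linarith
  set KW : Set (ℝ × (Fin m → ℝ)) := {z | U z ∈ K} with hKW
  have hKWimg : KW = T '' K := by
    ext z
    constructor
    · intro hz; exact ⟨U z, hz, hTU z⟩
    · rintro ⟨x, hx, rfl⟩
      change U (T x) ∈ K
      rwa [hUT]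
  set VW := s.image T with hVW
  have hKWV : KW = convexHull ℝ (VW : Set (ℝ × (Fin m → ℝ))) := by
    rw [hKWimg, hKs, AffineMap.image_convexHull, hVW, Finset.coe_image]
  have hKWc : IsCompact KW := by rw [hKWV]; exact VW.finite_toSet.isCompact_convexHull ℝ
  have hKWcv : Convex ℝ KW := by rw [hKWV]; exact convex_convexHull _ _
  -- volumes agree in both coordinate systems
  have hUvol : ∀ (c : ℝ) (S : Set (ℝ × (Fin m → ℝ))), IsCompact S →
      volume ((c • x₀) +ᵥ (Φ.symm '' S)) = volume S := by
    intro c S hS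
    rw [measure_vadd, ← hΦ.measure_preimage hS.isClosed.measurableSet.nullMeasurableSet]
    congr 1
    exact Φ.symm.image_eq_preimage_symm S
  have hUimg : ∀ S : Set (ℝ × (Fin m → ℝ)), U '' S = x₀ +ᵥ (Φ.symm '' S) := by
    intro S
    ext x
    simp only [Set.mem_image, Set.mem_vadd_set, exists_exists_and_eq_and, hU, vadd_eq_add, add_comm]
  have hKU : K = U '' KW := by
    rw [hKWimg, ← Set.image_comp]
    have : (U ∘ T : _ → _) = id := funext hUT
    rw [this, Set.image_id]
  have hvolK : volume K = volume KW := by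
    have := hUvol 1 KW hKWc
    rw [one_smul, ← hUimg, ← hKU] at this
    exact this
  have hsumvol : ∀ {A B C : Set (ℝ × (Fin m → ℝ))}, IsCompact A → IsCompact B → IsCompact C →
      ∀ a b c : ℝ, volume (a • (U '' A) + b • (U '' B) + c • (U '' C)) =
        volume (a • A + b • B + c • C) := by
    intro A B C hA hB hC a b c
    rw [← hUvol (a + b + c) _ (((hA.smul a).add (hB.smul b)).add (hC.smul c))]
    congr 1
    rw [hUimg, hUimg, hUimg]
    have himg : Φ.symm '' (a • A + b • B + c • C) =
        a • (Φ.symm '' A) + b • (Φ.symm '' B) + c • (Φ.symm '' C) := by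
      rw [Set.image_add, Set.image_add, image_smul_set, image_smul_set, image_smul_set]
    rw [himg]
    simp only [← Set.singleton_vadd, vadd_eq_add, smul_add, Set.smul_set_singleton, add_smul,
      ← Set.singleton_add_singleton]
    abel
  -- half-space description in coordinates
  set ℓ : {j // j ≠ i} → (ℝ × (Fin m → ℝ)) →ₗ[ℝ] ℝ := fun j =>
    ((innerₗ (EuclideanSpace ℝ (Fin (m + 1)))) (u j)).comp
      (Φ.symm : ℝ × (Fin m → ℝ) →ₗ[ℝ] EuclideanSpace ℝ (Fin (m + 1))) with hℓdef
  have hℓ : ∀ j z, ℓ j z = ⟪Φ.symm z, u j⟫ := fun j z => by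
    change inner ℝ (u j) (Φ.symm z) = _
    rw [real_inner_comm]
  set g : {j // j ≠ i} → ℝ := fun j => h j - ⟪x₀, u j⟫ with hg
  have hg0 : ∀ j, 0 < g j := fun j => sub_pos.2 (hx₀j j j.2)
  have hKWrep : KW = {z | 0 ≤ z.1 ∧ ∀ j, ℓ j z ≤ g j} := by
    ext z
    change U z ∈ K ↔ _ ∧ _
    rw [hKrep]
    constructor
    · intro hz
      refine ⟨?_, fun j => ?_⟩
      · have := hz i; rw [hU1] at this; linarith
      · have := hz j; rw [hU, inner_add_left] at this
        rw [hℓ]; change _ ≤ h j - _; linarith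
    · rintro ⟨hz0, hz⟩ j
      by_cases hj : j = i
      · rw [hj, hU1]; linarith
      · have := hz ⟨j, hj⟩
        rw [hℓ] at this
        have : ⟪Φ.symm z, u j⟫ ≤ h j - ⟪x₀, u j⟫ := this
        rw [hU, inner_add_left]; linarith
  have hKW0 : ∀ z ∈ KW, 0 ≤ z.1 := fun z hz => by rw [hKWrep] at hz; exact hz.1
  have h0KW : (0 : ℝ × (Fin m → ℝ)) ∈ KW := by
    change U 0 ∈ K; rw [hU]; simpa using hx₀K
  obtain ⟨z₁, hz₁, hz₁0⟩ : ∃ z ∈ KW, 0 < z.1 := by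
    by_contra hcon
    push Not at hcon
    have hsub : K ⊆ {x | ⟪x, u i⟫ = h i} := by
      intro x hx
      have h1 := hcon (T x) (by rw [hKWimg]; exact ⟨x, hx, rfl⟩)
      rw [hT1] at h1
      exact le_antisymm (hKle i x hx) (by linarith)
    obtain ⟨z, hz⟩ := hKi
    have := interior_mono hsub hz
    rw [interior_inner_eq_empty (by intro e; have := hu i; simp [e] at this)] at this
    exact this
  -- the parameters
  have hev1 : ∀ᶠ ε in nhdsWithin (0 : ℝ) (Set.Ioi 0), ∀ v ∈ VW, v.1 = 0 ∨ ε ≤ v.1 := by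
    rw [Filter.eventually_all_finset]
    intro v hv
    have hv0 := hKW0 v (by rw [hKWV]; exact subset_convexHull _ _ hv)
    rcases hv0.eq_or_lt with e | e
    · exact .of_forall fun _ => Or.inl e.symm
    · filter_upwards [nhdsWithin_le_nhds (eventually_lt_nhds e)] with ε hε using Or.inr hε.le
  obtain ⟨ε, ⟨hεV, hεδ⟩, hε⟩ := ((hev1.and (nhdsWithin_le_nhds (eventually_lt_nhds hδ))).and
    (self_mem_nhdsWithin (s := Set.Ioi (0 : ℝ)))).exists
  have hε : 0 < ε := hε
  have hev2 : ∀ᶠ σ in nhdsWithin (0 : ℝ) (Set.Ioi 0), ∀ j, ℓ j (-σ, 0) ≤ g j := by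
    rw [Filter.eventually_all]
    intro j
    refine Filter.Eventually.filter_mono nhdsWithin_le_nhds ?_
    have hc : ContinuousAt (fun σ : ℝ => ℓ j (-σ, 0)) 0 := by
      have : Continuous (ℓ j) := LinearMap.continuous_of_finiteDimensional _
      exact (this.comp (by fun_prop)).continuousAt
    have := hc.eventually_lt (continuousAt_const (y := g j)) (by
      have h0 : ℓ j (-(0 : ℝ), 0) = 0 := by rw [neg_zero]; exact map_zero _
      rw [h0]; exact hg0 j)
    exact this.mono fun _ h => h.le
  obtain ⟨σ, hσg, hσ⟩ := (hev2.and (self_mem_nhdsWithin (s := Set.Ioi (0 : ℝ)))).exists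
  have hσ : 0 < σ := hσ
  have hex0 : ∃ z ∈ convexHull ℝ (VW : Set (ℝ × (Fin m → ℝ))), z.1 = 0 :=
    ⟨0, by rw [← hKWV]; exact h0KW, rfl⟩
  have hex1 : ∃ z ∈ convexHull ℝ (VW : Set (ℝ × (Fin m → ℝ))), 0 < z.1 :=
    ⟨z₁, by rw [← hKWV]; exact hz₁, hz₁0⟩
  have hdec : ∀ x ∈ KW, ∃ v ∈ KW, ∃ w ∈ KW, v.1 = 0 ∧ ε ≤ w.1 ∧ x ∈ segment ℝ v w := by
    intro x hx
    rw [hKWV] at hx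
    obtain ⟨v, hv, w, hw, hxs⟩ := exists_segment_of_convexHull hεV hε hex0 hex1 hx
    have hfst : IsLinearMap ℝ (Prod.fst : ℝ × (Fin m → ℝ) → ℝ) := ⟨fun _ _ => rfl, fun _ _ => rfl⟩
    refine ⟨v, ?_, w, ?_, ?_, ?_, hxs⟩
    · rw [hKWV]; exact convexHull_mono (fun _ h => h.1) hv
    · rw [hKWV]; exact convexHull_mono (fun _ h => h.1) hw
    · exact convexHull_min (fun w hw => hw.2) (convex_hyperplane hfst 0) hv
    · exact convexHull_min (fun w hw => hw.2) (convex_halfSpace_ge hfst ε) hw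
  obtain ⟨TW, hTW⟩ := exists_convexHull_truncation hεV hε hex0 hex1
  rw [← hKWV] at hTW
  have hLW : convexHull ℝ (insert (-σ, 0) KW) =
      convexHull ℝ ((insert (-σ, 0) VW : Finset (ℝ × (Fin m → ℝ))) : Set _) := by
    rw [hKWV, Set.insert_eq, convexHull_convexHull_union_right, Finset.coe_insert, Set.insert_eq]
  have hLWc : IsCompact (convexHull ℝ (insert (-σ, 0) KW)) := by
    rw [hLW]; exact Set.Finite.isCompact_convexHull ℝ (Finset.finite_toSet _)
  have hMWc : IsCompact (KW ∩ {z | ε ≤ z.1}) :=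
    hKWc.inter_right (isClosed_le continuous_const continuous_fst)
  set Ls := (insert (-σ, 0) VW).image U with hLs
  set Ms := TW.image U with hMs
  have hLU : convexHull ℝ (Ls : Set (EuclideanSpace ℝ (Fin (m + 1)))) =
      U '' convexHull ℝ (insert (-σ, 0) KW) := by
    rw [hLW, AffineMap.image_convexHull, hLs, Finset.coe_image]
  have hMU : convexHull ℝ (Ms : Set (EuclideanSpace ℝ (Fin (m + 1)))) =
      U '' (KW ∩ {z | ε ≤ z.1}) := by
    rw [hTW, AffineMap.image_convexHull, hMs, Finset.coe_image]
  have hMKi : convexHull ℝ (Ms : Set (EuclideanSpace ℝ (Fin (m + 1)))) =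
      K ∩ {x | ⟪x, u i⟫ ≤ h i - ε} := by
    rw [hMU]
    ext x
    constructor
    · rintro ⟨z, ⟨hz, hzε⟩, rfl⟩
      have hzε : ε ≤ z.1 := hzε
      refine ⟨hz, ?_⟩
      change ⟪U z, u i⟫ ≤ _
      rw [hU1]; linarith
    · rintro ⟨hx, hxi⟩
      have hxi : ⟪x, u i⟫ ≤ h i - ε := hxi
      refine ⟨T x, ⟨by rw [hKWimg]; exact ⟨x, hx, rfl⟩, ?_⟩, hUT x⟩
      change ε ≤ (T x).1
      rw [hT1]; linarith
  have hLsne : Ls.Nonempty := (Finset.insert_nonempty _ _).image _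
  have hMsne : Ms.Nonempty := by
    obtain ⟨-, -, w, hwK, -, hwε, -⟩ := hdec 0 h0KW
    have : (convexHull ℝ (TW : Set (ℝ × (Fin m → ℝ)))).Nonempty := by
      rw [← hTW]; exact ⟨w, hwK, hwε⟩
    exact (Finset.coe_nonempty.1 (convexHull_nonempty_iff.1 this)).image _
  have hsne : s.Nonempty := by
    have : K.Nonempty := ⟨x₀, hx₀K⟩
    rw [hKs] at this
    exact Finset.coe_nonempty.1 (convexHull_nonempty_iff.1 this)
  obtain ⟨k, κ, e, he, hpoly⟩ := exists_polynomial_measure_sum_convexHull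
    (volume : Measure (EuclideanSpace ℝ (Fin (m + 1)))) ![Ls, Ms, s] (by
      intro c; fin_cases c
      exacts [hLsne, hMsne, hsne])
  have hdeg : ∀ j, e j 0 + e j 1 + e j 2 = m + 1 := by
    intro j
    have := he j
    rw [Fin.sum_univ_three, finrank_euclideanSpace_fin] at this
    exact this
  have hvolE : ∀ a b c : ℝ, 0 ≤ a → 0 ≤ b → 0 ≤ c →
      (volume (a • convexHull ℝ (Ls : Set (EuclideanSpace ℝ (Fin (m + 1)))) +
        b • convexHull ℝ (Ms : Set (EuclideanSpace ℝ (Fin (m + 1)))) + c • K)).toReal =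
      ∑ j, κ j * (a ^ e j 0 * b ^ e j 1 * c ^ e j 2) := by
    intro a b c ha hb hc
    have := hpoly ![a, b, c] (by intro c; fin_cases c <;> assumption)
    simp only [Fin.sum_univ_three, Fin.prod_univ_three] at this
    rw [hKs]
    exact this
  have hbez := hBez ε hε hεδ Ls Ms hLsne hMsne hMKi k κ _ _ _ hdeg hvolE
  rw [hvolK] at hbez
  have hvolW : ∀ a b c : ℝ, 0 ≤ a → 0 ≤ b → 0 ≤ c →
      (volume (a • convexHull ℝ (insert (-σ, 0) KW) + b • (KW ∩ {z | ε ≤ z.1}) + c • KW)).toReal =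
        ∑ j, κ j * (a ^ e j 0 * b ^ e j 1 * c ^ e j 2) := by
    intro a b c ha hb hc
    rw [← hvolE a b c ha hb hc, hLU, hMU]
    conv_rhs => rw [hKU]
    rw [hsumvol hLWc hMWc hKWc]
  have hV0 : 0 < (volume KW).toReal := by
    rw [← hvolK]
    refine ENNReal.toReal_pos ?_ hKc.measure_lt_top.ne
    exact ((isOpen_interior.measure_pos volume hKi).trans_le (measure_mono interior_subset)).ne'
  have hKWi : (interior KW).Nonempty := by
    obtain ⟨x, hx⟩ := hKi
    have hcont : Continuous U := by
      have : Continuous fun z => Φ.symm z + x₀ := by fun_prop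
      exact this
    have hopen : IsOpen (U ⁻¹' interior K) := isOpen_interior.preimage hcont
    refine ⟨T x, interior_maximal (fun z hz => ?_) hopen (by
      rw [Set.mem_preimage, hUT]; exact hx)⟩
    exact interior_subset (s := K) hz
  -- the base
  have hm0 : m ≠ 0 := by omega
  set A := volume (Prod.mk (0 : ℝ) ⁻¹' KW) with hAdef
  have hAfin : A ≠ ⊤ := by
    have : IsCompact (Prod.snd '' KW) := hKWc.image continuous_snd
    exact ne_top_of_le_ne_top this.measure_lt_top.ne (measure_mono fun z hz => ⟨_, hz, rfl⟩)
  have hA0 : A ≠ 0 := by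
    refine volume_slice_ne_zero Φ (hfacet i) (x₀ := x₀) (fun x hx => ?_) (fun x hx => ?_)
    · have hxi : ⟪x, u i⟫ = h i := hx.2
      rw [← hT, hT1, hxi, sub_self]
    · have hxi : ⟪x, u i⟫ = h i := hx.2
      have h1 : ((0 : ℝ), (Φ (x - x₀)).2) = T x := by
        ext1
        · rw [hT1, hxi, sub_self]
        · rw [hT]
      change ((0 : ℝ), (Φ (x - x₀)).2) ∈ KW
      rw [h1, hKWimg]; exact ⟨x, hx.1, rfl⟩
  set α := A.toReal ^ ((m : ℝ)⁻¹) with hαdef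
  have hα : 0 < α := Real.rpow_pos_of_pos (ENNReal.toReal_pos hA0 hAfin) _
  have hαA : A = ENNReal.ofReal (α ^ m) := by
    rw [hαdef, Real.rpow_inv_natCast_pow ENNReal.toReal_nonneg hm0, ENNReal.ofReal_toReal hAfin]
  obtain ⟨z, hz, hzV⟩ := exists_apex_of_section_le hm hKWc hKW0 ⟨0, h0KW⟩ hα hαA hV0
    fun s x hs hx hB hBn => section_le_of_bezout hm hKWcv hKWc hKWrep (fun j => (hg0 j).le) hε hdec
      hσ hLWc hσg hz₁0 (x₀ := z₁.2) hz₁ hα hαA hV0 hdeg hvolW hbez hs hx hB hBn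
  have hz0 : 0 < z.1 := by
    have : 0 < α ^ m * z.1 := lt_of_lt_of_le (by positivity) hzV
    exact pos_of_mul_pos_right this (by positivity)
  refine ⟨U z, hz, by rw [hU1]; linarith, fun j hj => ?_⟩
  by_contra hne
  have hlt : ⟪U z, u j⟫ < h j := lt_of_le_of_ne (hKle j _ hz) hne
  refine hfacet j (measure_mono_null ?_ (hnull j hj))
  rintro x ⟨hxK, hxj⟩
  have hxj : ⟪x, u j⟫ = h j := hxj
  refine ⟨hxK, ?_, hxj⟩
  obtain ⟨v, hv, hv0, a, b, ha, hb, hab, hxs⟩ := mem_segment_apex hKWcv hKWc hKWi hα.le hαA hz hz0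
    hzV (z := T x) (by rw [hKWimg]; exact ⟨x, hxK, rfl⟩)
  have hx : x = a • U v + b • U z := by
    rw [← hUT x, ← hxs, hU, hU, hU, map_add, map_smul, map_smul]
    have : b = 1 - a := by linarith
    rw [this]; module
  have hvj := hKle j _ hv
  rw [hx, inner_add_left, inner_smul_left, inner_smul_left] at hxj
  simp only [conj_trivial] at hxj
  have hb0 : b = 0 := by
    by_contra hb0
    have hb' : 0 < b := lt_of_le_of_ne hb (Ne.symm hb0)
    have h1 := mul_lt_mul_of_pos_left hlt hb'
    have h2 := mul_le_mul_of_nonneg_left hvj ha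
    have h3 : a * h j + b * h j = h j := by rw [← add_mul, hab, one_mul]
    linarith
  have ha1 : a = 1 := by linarith
  rw [hx, hb0, ha1, one_smul, zero_smul, add_zero, hU1, hv0, sub_zero]

end Core

section MixedVol

lemma zero_smul_convexHull {E : Type*} [AddCommGroup E] [Module ℝ E] {s : Finset E}
    (hs : s.Nonempty) : (0 : ℝ) • convexHull ℝ (s : Set E) = 0 :=
  Set.zero_smul_set (convexHull_nonempty_iff.2 hs)

lemma Finset.sum_powerset_insert_alternating {ι : Type*} [DecidableEq ι] {a : ι} {U : Finset ι}
    (ha : a ∉ U) (F : Finset ι → ℝ) :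
    ∑ S ∈ (insert a U).powerset, (-1 : ℝ) ^ ((insert a U).card - S.card) * F S =
      ∑ S ∈ U.powerset, (-1 : ℝ) ^ (U.card - S.card) * (F (insert a S) - F S) := by
  rw [Finset.sum_powerset_insert ha, ← Finset.sum_add_distrib]
  refine Finset.sum_congr rfl fun S hS => ?_
  have hSU := Finset.mem_powerset.1 hS
  have hle := Finset.card_le_card hSU
  rw [Finset.card_insert_of_notMem ha, Finset.card_insert_of_notMem fun h => ha (hSU h),
    Nat.add_sub_add_right, Nat.succ_sub hle, pow_succ]
  ring

lemma Finset.sum_powerset_alternating_pow {ι : Type*} (U : Finset ι) {r : ℕ} (hr : r ≤ U.card) :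
    ∑ S ∈ U.powerset, (-1 : ℝ) ^ (U.card - S.card) * (S.card : ℝ) ^ r =
      if r = U.card then (U.card.factorial : ℝ) else 0 := by
  classical
  rw [Finset.sum_powerset_apply_card (fun k => (-1 : ℝ) ^ (U.card - k) * (k : ℝ) ^ r)]
  have h := fwdDiff_iter_eq_sum_shift (1 : ℝ) (fun x : ℝ => x ^ r) U.card 0
  have h2 : ∑ m ∈ Finset.range (U.card + 1), U.card.choose m • ((-1 : ℝ) ^ (U.card - m) * (m : ℝ) ^ r)
      = (fwdDiff (1 : ℝ))^[U.card] (fun x : ℝ => x ^ r) 0 := by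
    rw [h]
    refine Finset.sum_congr rfl fun k _ => ?_
    simp only [nsmul_eq_mul, zsmul_eq_mul, zero_add, mul_one]
    push_cast
    ring
  rw [h2]
  split_ifs with hrU
  · rw [hrU, fwdDiff_iter_eq_factorial]; rfl
  · rw [fwdDiff_iter_pow_eq_zero_of_lt (lt_of_le_of_ne hr hrU)]; rfl

lemma Convex.finset_sum_eq_smul {E ι : Type*} [AddCommGroup E] [Module ℝ E] {K : Set E}
    (hK : Convex ℝ K) (hne : K.Nonempty) (S : Finset ι) (X : ι → Set E) (hX : ∀ i ∈ S, X i = K) :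
    ∑ i ∈ S, X i = (S.card : ℝ) • K := by
  classical
  induction S using Finset.induction_on with
  | empty => simp [Set.zero_smul_set hne]
  | insert a S ha ih =>
    rw [Finset.sum_insert ha, hX a (Finset.mem_insert_self _ _),
      ih fun i hi => hX i (Finset.mem_insert_of_mem hi), Finset.card_insert_of_notMem ha]
    push_cast
    rw [add_comm _ (1 : ℝ), hK.add_smul zero_le_one (Nat.cast_nonneg _), one_smul]

lemma prod_pow_sub_zero_pow {n : ℕ} {d : Fin n → ℕ} (hd : ∑ i, d i = n) (c : Fin n → ℝ) :
    ∏ i, (c i ^ d i - 0 ^ d i) = if ∀ i, d i = 1 then ∏ i, c i else 0 := by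
  split_ifs with h
  · exact Finset.prod_congr rfl fun i _ => by simp [h i]
  · have h0 : ∃ i, d i = 0 := by
      by_contra! h0
      refine h fun i => ?_
      have h1 : ∀ i ∈ Finset.univ, 1 ≤ d i := fun i _ => Nat.one_le_iff_ne_zero.2 (h0 i)
      have h2 := (Finset.sum_eq_sum_iff_of_le h1).1 (by simp [hd])
      exact (h2 i (Finset.mem_univ i)).symm
    obtain ⟨i, hi⟩ := h0
    exact Finset.prod_eq_zero (Finset.mem_univ i) (by simp [hi])

lemma mixedVol_smul_convexHull {n : ℕ} (s : Fin n → Finset (EuclideanSpace ℝ (Fin n)))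
    (hs : ∀ i, (s i).Nonempty) {c : Fin n → ℝ} (hc : ∀ i, 0 ≤ c i) :
    mixedVol n (fun i => c i • convexHull ℝ (s i : Set (EuclideanSpace ℝ (Fin n)))) =
      (∏ i, c i) * mixedVol n (fun i => convexHull ℝ (s i : Set (EuclideanSpace ℝ (Fin n)))) := by
  classical
  obtain ⟨k, κ, d, hd, hpoly⟩ := exists_polynomial_measure_sum_convexHull
    (volume : Measure (EuclideanSpace ℝ (Fin n))) s hs
  simp only [finrank_euclideanSpace_fin] at hd
  have key : ∀ c : Fin n → ℝ, (∀ i, 0 ≤ c i) →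
      mixedVol n (fun i => c i • convexHull ℝ (s i : Set (EuclideanSpace ℝ (Fin n)))) =
      ((n.factorial : ℝ))⁻¹ * ((∏ i, c i) * ∑ j, κ j * if ∀ i, d j i = 1 then 1 else 0) := by
    intro c hc
    rw [mixedVol]
    congr 1
    have hS : ∀ S : Finset (Fin n), (volume (∑ i ∈ S, c i •
        convexHull ℝ (s i : Set (EuclideanSpace ℝ (Fin n))))).toReal =
        ∑ j, κ j * ∏ i, (if i ∈ S then c i else 0) ^ d j i := by
      intro S
      rw [← hpoly (fun i => if i ∈ S then c i else 0) (fun i => by split_ifs; exacts [hc i, le_rfl])]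
      congr 2
      rw [← Finset.sum_subset (Finset.subset_univ S)]
      · exact Finset.sum_congr rfl fun i hi => by rw [if_pos hi]
      · intro i _ hi
        rw [if_neg hi, zero_smul_convexHull (hs i)]
    simp only [hS]
    calc _ = ∑ S : Finset (Fin n), ∑ j, κ j * ((-1 : ℝ) ^ (n - S.card) *
          ∏ i, (if i ∈ S then c i else 0) ^ d j i) := by
            refine Finset.sum_congr rfl fun S _ => ?_
            rw [Finset.mul_sum]
            exact Finset.sum_congr rfl fun j _ => by ring
      _ = ∑ j, κ j * ∏ i, (c i ^ d j i - 0 ^ d j i) := by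
            rw [Finset.sum_comm]
            refine Finset.sum_congr rfl fun j _ => ?_
            rw [← Finset.mul_sum]
            congr 1
            simp only [sub_eq_add_neg]
            rw [Finset.prod_add, Finset.powerset_univ]
            refine Finset.sum_congr rfl fun S _ => ?_
            rw [Finset.prod_neg, ← Finset.compl_eq_univ_sdiff, Finset.card_compl, Fintype.card_fin,
              ← Finset.prod_mul_prod_compl S (fun i => (if i ∈ S then c i else 0) ^ d j i)]
            rw [Finset.prod_congr rfl (g := fun i => c i ^ d j i) fun i hi => by rw [if_pos hi],
              Finset.prod_congr rfl (s₁ := Sᶜ) (g := fun i => 0 ^ d j i)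
                fun i hi => by rw [if_neg (Finset.mem_compl.1 hi)]]
            ring
      _ = _ := by
            rw [Finset.mul_sum]
            refine Finset.sum_congr rfl fun j _ => ?_
            rw [prod_pow_sub_zero_pow (hd j)]
            split_ifs <;> ring
  rw [key c hc]
  have h1 := key (fun _ => 1) fun _ => zero_le_one
  simp only [one_smul, Finset.prod_const_one, one_mul] at h1
  rw [h1]
  ring

lemma mixedVol_const {n : ℕ} {K : Set (EuclideanSpace ℝ (Fin n))} (hK : Convex ℝ K)
    (hne : K.Nonempty) : mixedVol n (fun _ => K) = (volume K).toReal := by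
  have h : ∀ S : Finset (Fin n), (volume (∑ i ∈ S, K)).toReal =
      (S.card : ℝ) ^ n * (volume K).toReal := by
    intro S
    rw [hK.finset_sum_eq_smul hne S (fun _ => K) fun _ _ => rfl, Measure.addHaar_smul,
      finrank_euclideanSpace_fin, ENNReal.toReal_mul, abs_of_nonneg (by positivity),
      ENNReal.toReal_ofReal (by positivity)]
  rw [mixedVol]
  simp only [h, ← mul_assoc]
  rw [← Finset.sum_mul]
  have := Finset.sum_powerset_alternating_pow (Finset.univ : Finset (Fin n)) (r := n) (by simp)
  simp only [Finset.powerset_univ, Finset.card_univ, Fintype.card_fin, if_true] at this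
  rw [this, ← mul_assoc, inv_mul_cancel₀ (by positivity), one_mul]

lemma mixedVol_vadd {n : ℕ} (K : Fin n → Set (EuclideanSpace ℝ (Fin n)))
    (v : Fin n → EuclideanSpace ℝ (Fin n)) :
    mixedVol n (fun i => v i +ᵥ K i) = mixedVol n K := by
  rw [mixedVol, mixedVol]
  congr 1
  refine Finset.sum_congr rfl fun S _ => ?_
  have : ∑ i ∈ S, (v i +ᵥ K i) = (∑ i ∈ S, v i) +ᵥ ∑ i ∈ S, K i := by
    simp only [← Set.singleton_vadd, vadd_eq_add]
    rw [Finset.sum_add_distrib, Set.finsetSum_singleton]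
  rw [this, measure_vadd]

lemma mixedVol_eq_zero_of_singleton {n : ℕ} {K : Fin n → Set (EuclideanSpace ℝ (Fin n))} (i : Fin n)
    {p : EuclideanSpace ℝ (Fin n)} (hi : K i = {p}) : mixedVol n K = 0 := by
  classical
  rw [mixedVol]
  have h := Finset.sum_powerset_insert_alternating (Finset.notMem_erase i Finset.univ)
    fun S => (volume (∑ i ∈ S, K i)).toReal
  rw [Finset.insert_erase (Finset.mem_univ i)] at h
  simp only [Finset.powerset_univ, Finset.card_univ, Fintype.card_fin] at h
  rw [h, Finset.sum_eq_zero, mul_zero]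
  intro S hS
  have hiS : i ∉ S := fun h => Finset.notMem_erase i _ (Finset.mem_powerset.1 hS h)
  rw [Finset.sum_insert hiS, hi, ← vadd_eq_add, Set.singleton_vadd, measure_vadd, sub_self,
    mul_zero]

end MixedVol

section MixedCoefficients

lemma mixedVol_one_of_polynomial {m : ℕ} {L K : Set (EuclideanSpace ℝ (Fin (m + 1)))}
    (hL : L.Nonempty) (hK : Convex ℝ K) (hne : K.Nonempty) {k : ℕ} {κ : Fin k → ℝ}
    {p r : Fin k → ℕ} (hpr : ∀ j, p j + r j ≤ m + 1)
    (hpoly : ∀ a c : ℝ, 0 ≤ a → 0 ≤ c →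
      (volume (a • L + c • K)).toReal = ∑ j, κ j * (a ^ p j * c ^ r j)) :
    mixedVol (m + 1) (fun j => if (j : ℕ) = 0 then L else K) =
      ((m + 1).factorial : ℝ)⁻¹ *
        (m.factorial * ∑ j, κ j * if p j ≠ 0 ∧ r j = m then 1 else 0) := by
  classical
  set X : Fin (m + 1) → Set (EuclideanSpace ℝ (Fin (m + 1))) :=
    fun j => if (j : ℕ) = 0 then L else K with hX
  set U : Finset (Fin (m + 1)) := Finset.univ.erase 0 with hU
  have h0U : (0 : Fin (m + 1)) ∉ U := Finset.notMem_erase _ _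
  have hUc : U.card = m := by simp [hU]
  have hins : insert 0 U = Finset.univ := Finset.insert_erase (Finset.mem_univ _)
  have hsum : ∀ S ∈ U.powerset, ∑ i ∈ S, X i = (S.card : ℝ) • K := by
    intro S hS
    refine hK.finset_sum_eq_smul hne S X fun i hi => ?_
    have : i ≠ 0 := Finset.ne_of_mem_erase (Finset.mem_powerset.1 hS hi)
    exact if_neg fun h => this (Fin.ext h)
  rw [mixedVol]
  congr 1
  have h := Finset.sum_powerset_insert_alternating h0U fun S => (volume (∑ i ∈ S, X i)).toReal
  rw [hins, hUc] at h
  simp only [Finset.powerset_univ, Finset.card_univ, Fintype.card_fin] at h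
  rw [h]
  have hterm : ∀ S ∈ U.powerset, (volume (∑ i ∈ insert 0 S, X i)).toReal -
      (volume (∑ i ∈ S, X i)).toReal =
      ∑ j, κ j * ((1 - 0 ^ p j) * (S.card : ℝ) ^ r j) := by
    intro S hS
    rw [Finset.sum_insert fun h => h0U (Finset.mem_powerset.1 hS h), hsum S hS]
    have h1 := hpoly 1 S.card zero_le_one (Nat.cast_nonneg _)
    have h2 := hpoly 0 S.card le_rfl (Nat.cast_nonneg _)
    rw [Set.zero_smul_set hL, zero_add] at h2
    rw [one_smul] at h1
    rw [h2, show X 0 = L from rfl, h1, ← Finset.sum_sub_distrib]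
    exact Finset.sum_congr rfl fun j _ => by rw [one_pow]; ring
  rw [Finset.sum_congr rfl fun S hS => by rw [hterm S hS, Finset.mul_sum], Finset.sum_comm,
    Finset.mul_sum]
  refine Finset.sum_congr rfl fun j _ => ?_
  calc _ = κ j * (1 - 0 ^ p j) * ∑ S ∈ U.powerset, (-1 : ℝ) ^ (U.card - S.card) *
        (S.card : ℝ) ^ r j := by
        rw [hUc, Finset.mul_sum]
        exact Finset.sum_congr rfl fun S _ => by ring
    _ = _ := by
        by_cases hp : p j = 0
        · simp [hp]
        · have := hpr j
          rw [Finset.sum_powerset_alternating_pow U (by omega), hUc]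
          by_cases hr : r j = m <;> simp [hp, hr]
          ring

lemma mixedVol_two_of_polynomial {m : ℕ} {L M K : Set (EuclideanSpace ℝ (Fin (m + 2)))}
    (hL : L.Nonempty) (hM : M.Nonempty) (hK : Convex ℝ K) (hne : K.Nonempty) {k : ℕ}
    {κ : Fin k → ℝ} {p q r : Fin k → ℕ} (hpr : ∀ j, p j + q j + r j = m + 2)
    (hpoly : ∀ a b c : ℝ, 0 ≤ a → 0 ≤ b → 0 ≤ c →
      (volume (a • L + b • M + c • K)).toReal = ∑ j, κ j * (a ^ p j * b ^ q j * c ^ r j)) :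
    mixedVol (m + 2) (fun j => if (j : ℕ) = 0 then L else if (j : ℕ) = 1 then M else K) =
      ((m + 2).factorial : ℝ)⁻¹ *
        (m.factorial * ∑ j, κ j * ((if p j = 1 then 1 else 0) * (if q j = 1 then 1 else 0))) := by
  classical
  set X : Fin (m + 2) → Set (EuclideanSpace ℝ (Fin (m + 2))) :=
    fun j => if (j : ℕ) = 0 then L else if (j : ℕ) = 1 then M else K with hX
  set U : Finset (Fin (m + 2)) := (Finset.univ.erase 0).erase 1 with hU
  have h01 : (1 : Fin (m + 2)) ∈ Finset.univ.erase (0 : Fin (m + 2)) := by simp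
  have h1U : (1 : Fin (m + 2)) ∉ U := Finset.notMem_erase _ _
  have hUc : U.card = m := by rw [hU, Finset.card_erase_of_mem h01]; simp
  have hins1 : insert 1 U = Finset.univ.erase (0 : Fin (m + 2)) := Finset.insert_erase h01
  have h0U' : (0 : Fin (m + 2)) ∉ insert 1 U := by rw [hins1]; exact Finset.notMem_erase _ _
  have h0U : (0 : Fin (m + 2)) ∉ U := fun h => h0U' (Finset.mem_insert_of_mem h)
  have h1Uc : (insert 1 U).card = m + 1 := by rw [Finset.card_insert_of_notMem h1U, hUc]
  have hins : insert 0 (insert 1 U) = Finset.univ := by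
    rw [hins1]; exact Finset.insert_erase (Finset.mem_univ _)
  have hsum : ∀ S ∈ U.powerset, ∑ i ∈ S, X i = (S.card : ℝ) • K := by
    intro S hS
    refine hK.finset_sum_eq_smul hne S X fun i hi => ?_
    have hiU := Finset.mem_powerset.1 hS hi
    have h0 : (i : ℕ) ≠ 0 := fun h => h0U ((Fin.ext h : i = 0) ▸ hiU)
    have h1 : (i : ℕ) ≠ 1 := fun h => h1U ((Fin.ext (by simpa using h) : i = 1) ▸ hiU)
    simp only [hX, if_neg h0, if_neg h1]
  rw [mixedVol]
  congr 1
  have h := Finset.sum_powerset_insert_alternating h0U' fun S => (volume (∑ i ∈ S, X i)).toReal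
  rw [Finset.sum_powerset_insert_alternating h1U, hins, hUc] at h
  simp only [Finset.powerset_univ, Finset.card_univ, Fintype.card_fin] at h
  rw [h]
  have hterm : ∀ S ∈ U.powerset, (volume (∑ i ∈ insert 0 (insert 1 S), X i)).toReal -
      (volume (∑ i ∈ insert 1 S, X i)).toReal - ((volume (∑ i ∈ insert 0 S, X i)).toReal -
      (volume (∑ i ∈ S, X i)).toReal) =
      ∑ j, κ j * ((1 - 0 ^ p j) * (1 - 0 ^ q j) * (S.card : ℝ) ^ r j) := by
    intro S hS
    have hSU := Finset.mem_powerset.1 hS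
    have h1S : (1 : Fin (m + 2)) ∉ S := fun h => h1U (hSU h)
    have h0S : (0 : Fin (m + 2)) ∉ S := fun h => h0U (hSU h)
    have h0S' : (0 : Fin (m + 2)) ∉ insert 1 S := fun h => h0U' (Finset.insert_subset_insert _ hSU h)
    have hX1 : X 1 = M := by simp [hX]
    rw [Finset.sum_insert h0S', Finset.sum_insert h1S, Finset.sum_insert h0S, hsum S hS, hX1,
      show X 0 = L from rfl]
    have h11 := hpoly 1 1 S.card zero_le_one zero_le_one (Nat.cast_nonneg _)
    have h01 := hpoly 0 1 S.card le_rfl zero_le_one (Nat.cast_nonneg _)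
    have h10 := hpoly 1 0 S.card zero_le_one le_rfl (Nat.cast_nonneg _)
    have h00 := hpoly 0 0 S.card le_rfl le_rfl (Nat.cast_nonneg _)
    simp only [Set.zero_smul_set hL, Set.zero_smul_set hM, zero_add, add_zero, one_smul]
      at h11 h01 h10 h00
    rw [← add_assoc, h11, h01, h10, h00, ← Finset.sum_sub_distrib, ← Finset.sum_sub_distrib,
      ← Finset.sum_sub_distrib]
    exact Finset.sum_congr rfl fun j _ => by rw [one_pow, one_pow]; ring
  rw [Finset.sum_congr rfl fun S hS => by rw [hterm S hS, Finset.mul_sum], Finset.sum_comm,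
    Finset.mul_sum]
  refine Finset.sum_congr rfl fun j _ => ?_
  calc _ = κ j * (1 - 0 ^ p j) * (1 - 0 ^ q j) * ∑ S ∈ U.powerset, (-1 : ℝ) ^ (U.card - S.card) *
        (S.card : ℝ) ^ r j := by
        rw [hUc, Finset.mul_sum]
        exact Finset.sum_congr rfl fun S _ => by ring
    _ = _ := by
        by_cases hp : p j = 0
        · simp [hp]
        by_cases hq : q j = 0
        · simp [hq]
        have := hpr j
        rw [Finset.sum_powerset_alternating_pow U (by omega), hUc]
        by_cases hr : r j = m
        · have hp1 : p j = 1 := by omega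
          have hq1 : q j = 1 := by omega
          simp [hp1, hq1, hr]
          ring
        · have : ¬ (p j = 1 ∧ q j = 1) := by omega
          rw [if_neg hr]
          by_cases hp1 : p j = 1
          · have hq1 : q j ≠ 1 := fun h => this ⟨hp1, h⟩
            simp [hq1]
          · simp [hp1]

lemma bezout_coefficients {m : ℕ} (hm : 1 ≤ m) {L M K : Set (EuclideanSpace ℝ (Fin (m + 1)))}
    (hL : L.Nonempty) (hM : M.Nonempty) (hK : Convex ℝ K) (hne : K.Nonempty) {k : ℕ}
    {κ : Fin k → ℝ} {p q r : Fin k → ℕ} (hpr : ∀ j, p j + q j + r j = m + 1)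
    (hpoly : ∀ a b c : ℝ, 0 ≤ a → 0 ≤ b → 0 ≤ c →
      (volume (a • L + b • M + c • K)).toReal = ∑ j, κ j * (a ^ p j * b ^ q j * c ^ r j))
    (hBez : mixedVol (m + 1)
          (fun j => if (j : ℕ) = 0 then L else if (j : ℕ) = 1 then M else K) *
        mixedVol (m + 1) (fun _ => K) ≤
      mixedVol (m + 1) (fun j => if (j : ℕ) = 0 then L else K) *
        mixedVol (m + 1) (fun j => if (j : ℕ) = 0 then M else K)) :
    (m + 1) * (∑ j, κ j * ((if p j = 1 then 1 else 0) * (if q j = 1 then 1 else 0))) *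
        (volume K).toReal ≤
      m * (∑ j, κ j * ((if p j = 1 then 1 else 0) * (if q j = 0 then 1 else 0))) *
        (∑ j, κ j * ((if p j = 0 then 1 else 0) * (if q j = 1 then 1 else 0))) := by
  obtain ⟨m, rfl⟩ : ∃ m', m = m' + 1 := ⟨m - 1, by omega⟩
  have hpq : ∀ j, (if p j ≠ 0 ∧ r j = m + 1 then (1 : ℝ) else 0) * 0 ^ q j =
      (if p j = 1 then 1 else 0) * (if q j = 0 then 1 else 0) := by
    intro j
    have := hpr j
    by_cases hq : q j = 0
    · by_cases hp : p j = 1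
      · have : r j = m + 1 := by omega
        simp [hq, hp, this]
      · have : ¬ (p j ≠ 0 ∧ r j = m + 1) := by omega
        rw [if_neg this, if_neg hp]; simp
    · simp [hq]
  have hqp : ∀ j, (if q j ≠ 0 ∧ r j = m + 1 then (1 : ℝ) else 0) * 0 ^ p j =
      (if p j = 0 then 1 else 0) * (if q j = 1 then 1 else 0) := by
    intro j
    have := hpr j
    by_cases hq : p j = 0
    · by_cases hp : q j = 1
      · have : r j = m + 1 := by omega
        simp [hq, hp, this]
      · have : ¬ (q j ≠ 0 ∧ r j = m + 1) := by omega
        rw [if_neg this, if_neg hp]; simp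
    · simp [hq]
  rw [mixedVol_const hK hne, mixedVol_two_of_polynomial hL hM hK hne hpr hpoly,
    mixedVol_one_of_polynomial hL hK hne (κ := fun j => κ j * 0 ^ q j) (p := p) (r := r)
      (fun j => by have := hpr j; omega) (fun a c ha hc => by
        have := hpoly a 0 c ha le_rfl hc
        rw [Set.zero_smul_set hM, add_zero] at this
        rw [this]
        exact Finset.sum_congr rfl fun j _ => by ring),
    mixedVol_one_of_polynomial hM hK hne (κ := fun j => κ j * 0 ^ p j) (p := q) (r := r)
      (fun j => by have := hpr j; omega) (fun b c hb hc => by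
        have := hpoly 0 b c le_rfl hb hc
        rw [Set.zero_smul_set hL, zero_add] at this
        rw [this]
        exact Finset.sum_congr rfl fun j _ => by ring)] at hBez
  have e1 : ∀ j, κ j * 0 ^ q j * (if p j ≠ 0 ∧ r j = m + 1 then (1 : ℝ) else 0) =
      κ j * ((if p j = 1 then 1 else 0) * (if q j = 0 then 1 else 0)) := fun j => by
    rw [← hpq]; ring
  have e2 : ∀ j, κ j * 0 ^ p j * (if q j ≠ 0 ∧ r j = m + 1 then (1 : ℝ) else 0) =
      κ j * ((if p j = 0 then 1 else 0) * (if q j = 1 then 1 else 0)) := fun j => by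
    rw [← hqp]; ring
  simp only [e1, e2] at hBez
  set A := ∑ j, κ j * ((if p j = 1 then (1 : ℝ) else 0) * (if q j = 1 then 1 else 0))
  set B := ∑ j, κ j * ((if p j = 1 then (1 : ℝ) else 0) * (if q j = 0 then 1 else 0))
  set C := ∑ j, κ j * ((if p j = 0 then (1 : ℝ) else 0) * (if q j = 1 then 1 else 0))
  set V := (volume K).toReal
  have hf : (0 : ℝ) < m.factorial := by positivity
  have hm2 : (0 : ℝ) < m + 2 := by positivity
  have hm1 : (0 : ℝ) < m + 1 := by positivity
  rw [show m + 1 + 1 = m + 2 from rfl, Nat.factorial_succ, Nat.factorial_succ] at hBez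
  push_cast at hBez ⊢
  have e3 : ((m : ℝ) + 1 + 1) * ((m + 1) * m.factorial) ≠ 0 := by positivity
  field_simp at hBez
  nlinarith [hBez]

end MixedCoefficients

section SupportFunction

variable {n : ℕ}

lemma suppFn_finset_eq_sup' {s : Finset (EuclideanSpace ℝ (Fin n))} (hs : s.Nonempty)
    (w : EuclideanSpace ℝ (Fin n)) : suppFn (s : Set _) w = s.sup' hs fun x => ⟪x, w⟫ :=
  (s.sup'_eq_csSup_image hs _).symm

lemma suppFn_convexHull {s : Finset (EuclideanSpace ℝ (Fin n))} (hs : s.Nonempty)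
    (w : EuclideanSpace ℝ (Fin n)) :
    suppFn (convexHull ℝ (s : Set (EuclideanSpace ℝ (Fin n)))) w = suppFn (s : Set _) w := by
  have hle : ∀ x ∈ convexHull ℝ (s : Set (EuclideanSpace ℝ (Fin n))),
      ⟪x, w⟫ ≤ suppFn (s : Set _) w := by
    have hconv : Convex ℝ {x : EuclideanSpace ℝ (Fin n) | ⟪x, w⟫ ≤ suppFn (s : Set _) w} :=
      convex_halfSpace_le ((innerₗ (EuclideanSpace ℝ (Fin n))).flip w).isLinear _
    refine convexHull_min (fun x hx => ?_) hconv
    change ⟪x, w⟫ ≤ _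
    rw [suppFn_finset_eq_sup' hs]
    exact Finset.le_sup' (fun x => ⟪x, w⟫) hx
  have hle' : ∀ y ∈ (fun x => ⟪x, w⟫) '' convexHull ℝ (s : Set (EuclideanSpace ℝ (Fin n))),
      y ≤ suppFn (s : Set _) w := by
    rintro _ ⟨x, hx, rfl⟩; exact hle x hx
  refine le_antisymm (csSup_le ((convexHull_nonempty_iff.2 hs).image _) hle') ?_
  exact csSup_le_csSup ⟨_, hle'⟩ (hs.to_set.image _) (Set.image_mono (subset_convexHull ℝ _))

lemma suppFn_finset_add [DecidableEq (EuclideanSpace ℝ (Fin n))]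
    {s t : Finset (EuclideanSpace ℝ (Fin n))} (hs : s.Nonempty)
    (ht : t.Nonempty) (w : EuclideanSpace ℝ (Fin n)) :
    suppFn ((s + t : Finset _) : Set (EuclideanSpace ℝ (Fin n))) w =
      suppFn (s : Set _) w + suppFn (t : Set _) w := by
  rw [suppFn, Finset.coe_add, suppFn, suppFn, ← csSup_add (hs.to_set.image _)
    (s.finite_toSet.image _).bddAbove (ht.to_set.image _) (t.finite_toSet.image _).bddAbove]
  congr 1
  exact Set.image_image2_distrib fun a b => inner_add_left a b w

lemma suppFn_finset_union [DecidableEq (EuclideanSpace ℝ (Fin n))]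
    {s t : Finset (EuclideanSpace ℝ (Fin n))} (hs : s.Nonempty)
    (ht : t.Nonempty) (w : EuclideanSpace ℝ (Fin n)) :
    suppFn ((s ∪ t : Finset _) : Set (EuclideanSpace ℝ (Fin n))) w =
      max (suppFn (s : Set _) w) (suppFn (t : Set _) w) := by
  rw [suppFn, Finset.coe_union, Set.image_union, csSup_union (s.finite_toSet.image _).bddAbove
    (hs.to_set.image _) (t.finite_toSet.image _).bddAbove (ht.to_set.image _)]
  rfl

lemma continuous_suppFn_finset {s : Finset (EuclideanSpace ℝ (Fin n))} (hs : s.Nonempty) :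
    Continuous fun w => suppFn (s : Set (EuclideanSpace ℝ (Fin n))) w := by
  simp only [suppFn_finset_eq_sup' hs]
  exact Continuous.finset_sup'_apply hs fun x _ => by fun_prop

/-- Differences of support functions of polytopes, as functions on the sphere. -/
def suppFnDifferences (n : ℕ) : Set C(Metric.sphere (0 : EuclideanSpace ℝ (Fin n)) 1, ℝ) :=
  {f | ∃ s t : Finset (EuclideanSpace ℝ (Fin n)), s.Nonempty ∧ t.Nonempty ∧
    ∀ w : Metric.sphere (0 : EuclideanSpace ℝ (Fin n)) 1,
      f w = suppFn (s : Set _) (w : EuclideanSpace ℝ (Fin n)) -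
        suppFn (t : Set _) (w : EuclideanSpace ℝ (Fin n))}

lemma neg_mem_suppFnDifferences {f : C(Metric.sphere (0 : EuclideanSpace ℝ (Fin n)) 1, ℝ)}
    (hf : f ∈ suppFnDifferences n) : -f ∈ suppFnDifferences n := by
  obtain ⟨s, t, hs, ht, h⟩ := hf
  exact ⟨t, s, ht, hs, fun w => by rw [ContinuousMap.neg_apply, h, neg_sub]⟩

lemma add_mem_suppFnDifferences {f g : C(Metric.sphere (0 : EuclideanSpace ℝ (Fin n)) 1, ℝ)}
    (hf : f ∈ suppFnDifferences n) (hg : g ∈ suppFnDifferences n) :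
    f + g ∈ suppFnDifferences n := by
  classical
  obtain ⟨s, t, hs, ht, h⟩ := hf
  obtain ⟨s', t', hs', ht', h'⟩ := hg
  refine ⟨s + s', t + t', hs.add hs', ht.add ht', fun w => ?_⟩
  rw [ContinuousMap.add_apply, h, h', suppFn_finset_add hs hs', suppFn_finset_add ht ht']
  ring

lemma sup_mem_suppFnDifferences {f g : C(Metric.sphere (0 : EuclideanSpace ℝ (Fin n)) 1, ℝ)}
    (hf : f ∈ suppFnDifferences n) (hg : g ∈ suppFnDifferences n) :
    f ⊔ g ∈ suppFnDifferences n := by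
  classical
  obtain ⟨s, t, hs, ht, h⟩ := hf
  obtain ⟨s', t', hs', ht', h'⟩ := hg
  refine ⟨(s + t') ∪ (s' + t), t + t', (hs.add ht').mono Finset.subset_union_left, ht.add ht',
    fun w => ?_⟩
  rw [ContinuousMap.sup_apply, h, h', suppFn_finset_union (hs.add ht') (hs'.add ht),
    suppFn_finset_add hs ht', suppFn_finset_add hs' ht, suppFn_finset_add ht ht',
    ← max_sub_sub_right]
  congr 1 <;> ring

lemma inf_mem_suppFnDifferences {f g : C(Metric.sphere (0 : EuclideanSpace ℝ (Fin n)) 1, ℝ)}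
    (hf : f ∈ suppFnDifferences n) (hg : g ∈ suppFnDifferences n) :
    f ⊓ g ∈ suppFnDifferences n := by
  have h := neg_mem_suppFnDifferences
    (sup_mem_suppFnDifferences (neg_mem_suppFnDifferences hf) (neg_mem_suppFnDifferences hg))
  convert h using 1
  ext w
  simp [max_neg_neg]

/-- The support function of a polytope, as a continuous function on the sphere. -/
noncomputable def suppFnSphere {s : Finset (EuclideanSpace ℝ (Fin n))} (hs : s.Nonempty) :
    C(Metric.sphere (0 : EuclideanSpace ℝ (Fin n)) 1, ℝ) :=
  ⟨fun w => suppFn (s : Set _) (w : EuclideanSpace ℝ (Fin n)),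
    (continuous_suppFn_finset hs).comp continuous_subtype_val⟩

lemma suppFnSphere_mem_suppFnDifferences {s : Finset (EuclideanSpace ℝ (Fin n))}
    (hs : s.Nonempty) : suppFnSphere hs ∈ suppFnDifferences n := by
  refine ⟨s, {0}, hs, Finset.singleton_nonempty _, fun w => ?_⟩
  simp [suppFnSphere, suppFn]

lemma suppFn_singleton (z w : EuclideanSpace ℝ (Fin n)) :
    suppFn (({z} : Finset (EuclideanSpace ℝ (Fin n))) : Set _) w = ⟪z, w⟫ := by
  simp [suppFn]

lemma suppFn_zero_pair [DecidableEq (EuclideanSpace ℝ (Fin n))] (z w : EuclideanSpace ℝ (Fin n)) :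
    suppFn (({0, z} : Finset (EuclideanSpace ℝ (Fin n))) : Set _) w = max 0 ⟪z, w⟫ := by
  rw [Finset.insert_eq, suppFn_finset_union (Finset.singleton_nonempty _)
    (Finset.singleton_nonempty _), suppFn_singleton, suppFn_singleton, inner_zero_left]

lemma separatesPointsStrongly_suppFnDifferences :
    (suppFnDifferences n).SeparatesPointsStrongly := by
  classical
  have hball : ∀ x y : Metric.sphere (0 : EuclideanSpace ℝ (Fin n)) 1, x ≠ y → ∀ a : ℝ,
      ∃ f ∈ suppFnDifferences n, f x = a ∧ f y = 0 := by
    intro x y hxy a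
    have hx : ⟪(x : EuclideanSpace ℝ (Fin n)), (x : EuclideanSpace ℝ (Fin n))⟫ = 1 := by
      rw [real_inner_self_eq_norm_sq, norm_eq_of_mem_sphere, one_pow]
    have hy : ⟪(y : EuclideanSpace ℝ (Fin n)), (y : EuclideanSpace ℝ (Fin n))⟫ = 1 := by
      rw [real_inner_self_eq_norm_sq, norm_eq_of_mem_sphere, one_pow]
    set d : ℝ := 1 - ⟪(y : EuclideanSpace ℝ (Fin n)), (x : EuclideanSpace ℝ (Fin n))⟫ with hd
    have hd0 : 0 < d := by
      have hne : (x : EuclideanSpace ℝ (Fin n)) - y ≠ 0 := sub_ne_zero.2 fun h => hxy (Subtype.ext h)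
      have h1 := real_inner_self_pos.2 hne
      rw [real_inner_sub_sub_self, hx, hy, real_inner_comm] at h1
      linarith
    have main : ∀ b : ℝ, 0 ≤ b → ∃ f ∈ suppFnDifferences n, f x = b ∧ f y = 0 := by
      intro b hb
      have hne : ({0, (b / d) • ((x : EuclideanSpace ℝ (Fin n)) - y)} :
        Finset (EuclideanSpace ℝ (Fin n))).Nonempty := Finset.insert_nonempty _ _
      refine ⟨_, suppFnSphere_mem_suppFnDifferences hne, ?_, ?_⟩
      · change suppFn _ _ = _
        rw [suppFn_zero_pair, inner_smul_left, inner_sub_left, hx, ← hd, conj_trivial,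
          div_mul_cancel₀ _ hd0.ne', max_eq_right hb]
      · change suppFn _ _ = _
        rw [suppFn_zero_pair, inner_smul_left, inner_sub_left, hy, real_inner_comm, conj_trivial]
        have : 0 ≤ b / d := by positivity
        exact max_eq_left (by nlinarith)
    rcases le_total 0 a with ha | ha
    · exact main a ha
    · obtain ⟨f, hf, h1, h2⟩ := main (-a) (by linarith)
      exact ⟨-f, neg_mem_suppFnDifferences hf, by simp [h1], by simp [h2]⟩
  intro v x y
  by_cases hxy : x = y
  · subst hxy
    have hx : ⟪(x : EuclideanSpace ℝ (Fin n)), (x : EuclideanSpace ℝ (Fin n))⟫ = 1 := by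
      rw [real_inner_self_eq_norm_sq, norm_eq_of_mem_sphere, one_pow]
    have h1 : suppFnSphere (Finset.singleton_nonempty (v x • (x : EuclideanSpace ℝ (Fin n)))) x =
        v x := by
      change suppFn _ _ = _
      rw [suppFn_singleton, inner_smul_left, hx, mul_one, conj_trivial]
    exact ⟨_, suppFnSphere_mem_suppFnDifferences _, h1, h1⟩
  · obtain ⟨f, hf, hfx, hfy⟩ := hball x y hxy (v x)
    obtain ⟨g, hg, hgy, hgx⟩ := hball y x (Ne.symm hxy) (v y)
    exact ⟨f + g, add_mem_suppFnDifferences hf hg, by simp [hfx, hgx], by simp [hfy, hgy]⟩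

lemma ext_of_integral_suppFn
    {μ ν : Measure (Metric.sphere (0 : EuclideanSpace ℝ (Fin n)) 1)}
    [IsFiniteMeasure μ] [IsFiniteMeasure ν]
    (h : ∀ s : Finset (EuclideanSpace ℝ (Fin n)), s.Nonempty →
      ∫ w : Metric.sphere (0 : EuclideanSpace ℝ (Fin n)) 1,
        suppFn (s : Set _) (w : EuclideanSpace ℝ (Fin n)) ∂μ =
      ∫ w : Metric.sphere (0 : EuclideanSpace ℝ (Fin n)) 1,
        suppFn (s : Set _) (w : EuclideanSpace ℝ (Fin n)) ∂ν) : μ = ν := by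
  have hcont : ∀ (ρ : Measure (Metric.sphere (0 : EuclideanSpace ℝ (Fin n)) 1))
      [IsFiniteMeasure ρ], Continuous fun f : C(Metric.sphere (0 : EuclideanSpace ℝ (Fin n)) 1, ℝ) =>
        ∫ w, f w ∂ρ := by
    intro ρ _
    have := continuous_integral.comp (ContinuousMap.toLp (E := ℝ) 1 ρ ℝ).continuous
    refine this.congr fun f => ?_
    exact integral_congr_ae (ContinuousMap.coeFn_toLp ρ f)
  have hint : ∀ (ρ : Measure (Metric.sphere (0 : EuclideanSpace ℝ (Fin n)) 1))
      [IsFiniteMeasure ρ] (f : C(Metric.sphere (0 : EuclideanSpace ℝ (Fin n)) 1, ℝ)),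
      Integrable f ρ := fun ρ _ f =>
    (BoundedContinuousFunction.mkOfCompact f).integrable ρ
  have hclosed : IsClosed {f : C(Metric.sphere (0 : EuclideanSpace ℝ (Fin n)) 1, ℝ) |
      ∫ w, f w ∂μ = ∫ w, f w ∂ν} := isClosed_eq (hcont μ) (hcont ν)
  have hsub : suppFnDifferences n ⊆ {f : C(Metric.sphere (0 : EuclideanSpace ℝ (Fin n)) 1, ℝ) |
      ∫ w, f w ∂μ = ∫ w, f w ∂ν} := by
    rintro f ⟨s, t, hs, ht, hf⟩
    change ∫ w, f w ∂μ = ∫ w, f w ∂ν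
    simp only [hf]
    refine (integral_sub (hint μ (suppFnSphere hs)) (hint μ (suppFnSphere ht))).trans
      (Eq.trans ?_ (integral_sub (hint ν (suppFnSphere hs)) (hint ν (suppFnSphere ht))).symm)
    exact congrArg₂ _ (h s hs) (h t ht)
  have htop := ContinuousMap.sublattice_closure_eq_top (suppFnDifferences n)
    ⟨_, suppFnSphere_mem_suppFnDifferences (Finset.singleton_nonempty 0)⟩
    (fun f hf g hg => inf_mem_suppFnDifferences hf hg)
    (fun f hf g hg => sup_mem_suppFnDifferences hf hg) separatesPointsStrongly_suppFnDifferences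
  refine ext_of_forall_integral_eq_of_IsFiniteMeasure fun f => ?_
  have hf : f.toContinuousMap ∈ closure (suppFnDifferences n) := by rw [htop]; trivial
  exact closure_minimal hsub hclosed hf

end SupportFunction

section MixedAreaMeasure

variable {n : ℕ}

lemma isConvexBody_convexHull {s : Finset (EuclideanSpace ℝ (Fin n))} (hs : s.Nonempty) :
    IsConvexBody (convexHull ℝ (s : Set (EuclideanSpace ℝ (Fin n)))) :=
  ⟨convex_convexHull ℝ _, s.finite_toSet.isCompact_convexHull ℝ, convexHull_nonempty_iff.2 hs⟩

/-- If `s + x` spans a body with nonempty interior, some translate has a support function that is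
bounded below by a positive constant on the sphere. -/
lemma exists_translate_suppFn_ge {s : Finset (EuclideanSpace ℝ (Fin n))}
    (hi : (interior (convexHull ℝ (s : Set (EuclideanSpace ℝ (Fin n))))).Nonempty) :
    ∃ (v : EuclideanSpace ℝ (Fin n)) (ρ : ℝ), 0 < ρ ∧
      ∀ w ∈ Metric.sphere (0 : EuclideanSpace ℝ (Fin n)) 1,
        ρ ≤ suppFn (v +ᵥ convexHull ℝ (s : Set (EuclideanSpace ℝ (Fin n)))) w := by
  obtain ⟨x, hx⟩ := hi
  obtain ⟨ε, hε, hball⟩ := Metric.isOpen_iff.1 isOpen_interior x hx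
  have hc : IsCompact (-x +ᵥ convexHull ℝ (s : Set (EuclideanSpace ℝ (Fin n)))) :=
    (s.finite_toSet.isCompact_convexHull ℝ).vadd _
  refine ⟨-x, ε / 2, by positivity, fun w hw => ?_⟩
  have hw1 : ‖w‖ = 1 := by simpa using hw
  have hmem : (ε / 2) • w ∈ -x +ᵥ convexHull ℝ (s : Set (EuclideanSpace ℝ (Fin n))) := by
    refine ⟨x + (ε / 2) • w, interior_subset (hball ?_), by simp⟩
    rw [Metric.mem_ball, dist_eq_norm, add_sub_cancel_left, norm_smul, hw1, mul_one,
      Real.norm_of_nonneg (by positivity)]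
    linarith
  have : ε / 2 = ⟪(ε / 2) • w, w⟫ := by
    rw [inner_smul_left, real_inner_self_eq_norm_sq, hw1]; simp
  rw [this]
  exact le_csSup (hc.image (by fun_prop : Continuous fun y => ⟪y, w⟫)).bddAbove ⟨_, hmem, rfl⟩

lemma isFiniteMeasure_of_integral_ne_zero {α : Type*} [MeasurableSpace α] {μ : Measure α}
    {f : α → ℝ} {ρ : ℝ} (hρ : 0 < ρ) (hf : ∀ w, ρ ≤ f w) (h : ∫ w, f w ∂μ ≠ 0) :
    IsFiniteMeasure μ := by
  have hint : Integrable f μ := by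
    by_contra hn
    exact h (integral_undef hn)
  have : Integrable (fun _ : α => ρ) μ := by
    refine hint.mono' aestronglyMeasurable_const (.of_forall fun w => ?_)
    rw [Real.norm_of_nonneg hρ.le]; exact hf w
  rcases integrable_const_iff.1 this with h0 | h1
  · exact absurd h0 hρ.ne'
  · exact h1

/-- Test values of the surface area measure of `K`, up to a factor, determine the measure. -/
lemma eq_smul_of_integral_suppFn (hn : 1 ≤ n) {K : Set (EuclideanSpace ℝ (Fin n))}
    {s : Finset (EuclideanSpace ℝ (Fin n))} (hKs : K = convexHull ℝ (s : Set _))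
    (hKi : (interior K).Nonempty) {γ : ℝ} (hγ : 0 < γ)
    {μ ν : Measure (Metric.sphere (0 : EuclideanSpace ℝ (Fin n)) 1)}
    (hμ : ∀ l : Finset (EuclideanSpace ℝ (Fin n)), l.Nonempty →
      γ * mixedVol n (fun j : Fin n => if (j : ℕ) = 0 then
        convexHull ℝ (l : Set (EuclideanSpace ℝ (Fin n))) else K) =
      (1 / n) * ∫ w : Metric.sphere (0 : EuclideanSpace ℝ (Fin n)) 1,
        suppFn (convexHull ℝ (l : Set (EuclideanSpace ℝ (Fin n))))
          (w : EuclideanSpace ℝ (Fin n)) ∂μ)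
    (hν : ∀ l : Finset (EuclideanSpace ℝ (Fin n)), l.Nonempty →
      mixedVol n (fun j : Fin n => if (j : ℕ) = 0 then
        convexHull ℝ (l : Set (EuclideanSpace ℝ (Fin n))) else K) =
      (1 / n) * ∫ w : Metric.sphere (0 : EuclideanSpace ℝ (Fin n)) 1,
        suppFn (convexHull ℝ (l : Set (EuclideanSpace ℝ (Fin n))))
          (w : EuclideanSpace ℝ (Fin n)) ∂ν) :
    μ = ENNReal.ofReal γ • ν ∧ ν ≠ 0 := by
  classical
  have hne : K.Nonempty := hKi.mono interior_subset
  have hKcv : Convex ℝ K := hKs ▸ convex_convexHull ℝ _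
  have hsne : s.Nonempty := by
    rw [hKs] at hne
    exact Finset.coe_nonempty.1 (convexHull_nonempty_iff.1 hne)
  have hn0 : (n : ℝ) ≠ 0 := by positivity
  obtain ⟨v, ρ, hρ, hvρ⟩ := exists_translate_suppFn_ge (hKs ▸ hKi)
  have hl : v +ᵥ convexHull ℝ (s : Set (EuclideanSpace ℝ (Fin n))) =
      convexHull ℝ ((v +ᵥ s : Finset (EuclideanSpace ℝ (Fin n))) : Set _) := by
    rw [Finset.coe_vadd_finset, convexHull_vadd]
  have hV : 0 < mixedVol n (fun j : Fin n => if (j : ℕ) = 0 then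
      convexHull ℝ ((v +ᵥ s : Finset (EuclideanSpace ℝ (Fin n))) : Set _) else K) := by
    have h1 : (fun j : Fin n => if (j : ℕ) = 0 then
        convexHull ℝ ((v +ᵥ s : Finset (EuclideanSpace ℝ (Fin n))) : Set _) else K) =
        fun j : Fin n => (if (j : ℕ) = 0 then v else 0) +ᵥ K := by
      ext1 j
      split_ifs
      · rw [← hl, ← hKs]
      · rw [zero_vadd]
    rw [h1, mixedVol_vadd, mixedVol_const hKcv hne]
    refine ENNReal.toReal_pos ?_ ?_
    · exact ((isOpen_interior.measure_pos volume hKi).trans_le (measure_mono interior_subset)).ne'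
    · rw [hKs]; exact (s.finite_toSet.isCompact_convexHull ℝ).measure_lt_top.ne
  have hνpos := hν _ (hsne.vadd_finset (a := v))
  have hμpos := hμ _ (hsne.vadd_finset (a := v))
  have hge : ∀ w : Metric.sphere (0 : EuclideanSpace ℝ (Fin n)) 1, ρ ≤
      suppFn (convexHull ℝ ((v +ᵥ s : Finset (EuclideanSpace ℝ (Fin n))) : Set _))
        (w : EuclideanSpace ℝ (Fin n)) := fun w => by
    rw [← hl]; exact hvρ w w.2
  have hνint : ∫ w : Metric.sphere (0 : EuclideanSpace ℝ (Fin n)) 1,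
      suppFn (convexHull ℝ ((v +ᵥ s : Finset (EuclideanSpace ℝ (Fin n))) : Set _))
        (w : EuclideanSpace ℝ (Fin n)) ∂ν ≠ 0 := by
    intro h0
    rw [h0, mul_zero] at hνpos
    exact hV.ne' hνpos
  have hμint : ∫ w : Metric.sphere (0 : EuclideanSpace ℝ (Fin n)) 1,
      suppFn (convexHull ℝ ((v +ᵥ s : Finset (EuclideanSpace ℝ (Fin n))) : Set _))
        (w : EuclideanSpace ℝ (Fin n)) ∂μ ≠ 0 := by
    intro h0
    rw [h0, mul_zero] at hμpos
    exact (mul_pos hγ hV).ne' hμpos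
  have : IsFiniteMeasure ν := isFiniteMeasure_of_integral_ne_zero hρ hge hνint
  have : IsFiniteMeasure μ := isFiniteMeasure_of_integral_ne_zero hρ hge hμint
  have : IsFiniteMeasure (ENNReal.ofReal γ • ν) := Measure.smul_finite ν ENNReal.ofReal_ne_top
  refine ⟨ext_of_integral_suppFn fun l hl => ?_, fun h0 => hνint (by rw [h0]; simp)⟩
  rw [integral_smul_measure, ENNReal.toReal_ofReal hγ.le, smul_eq_mul]
  have h1 := hμ l hl
  have h2 := hν l hl
  simp only [suppFn_convexHull hl] at h1 h2
  rw [h2] at h1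
  field_simp at h1
  linarith

end MixedAreaMeasure

section MovedPolytope

variable {n N : ℕ} {K : Set (EuclideanSpace ℝ (Fin n))} {u : Fin N → EuclideanSpace ℝ (Fin n)}
  {i : Fin N} {p : EuclideanSpace ℝ (Fin n)}

lemma movedPoly_eq_vadd_smul (hKrep : ∀ x, x ∈ K ↔ ∀ j, ⟪x, u j⟫ ≤ suppFn K (u j))
    (hp : ∀ j, j ≠ i → ⟪p, u j⟫ = suppFn K (u j))
    {t c : ℝ} (hc : 0 < c) (hct : c * (suppFn K (u i) - ⟪p, u i⟫) = suppFn K (u i) - ⟪p, u i⟫ + t) :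
    movedPoly K u i t = ((1 - c) • p) +ᵥ c • K := by
  ext x
  rw [Set.mem_vadd_set_iff_neg_vadd_mem, Set.mem_smul_set_iff_inv_smul_mem₀ hc.ne', hKrep, vadd_eq_add]
  refine forall_congr' fun j => ?_
  rw [inner_smul_left, inner_add_left, inner_neg_left, inner_smul_left, conj_trivial, conj_trivial,
    inv_mul_le_iff₀ hc]
  by_cases hj : j = i
  · subst hj
    rw [if_pos rfl]
    constructor <;> intro h <;> linarith
  · rw [if_neg hj, hp j hj]
    constructor <;> intro h <;> linarith

lemma movedPoly_eq_singleton (hK : Bornology.IsBounded K)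
    (hKrep : ∀ x, x ∈ K ↔ ∀ j, ⟪x, u j⟫ ≤ suppFn K (u j)) (hpK : p ∈ K)
    (hp : ∀ j, j ≠ i → ⟪p, u j⟫ = suppFn K (u j)) :
    movedPoly K u i (⟪p, u i⟫ - suppFn K (u i)) = {p} := by
  ext x
  rw [Set.mem_singleton_iff]
  constructor
  · intro hx
    have hx : ∀ j, ⟪x, u j⟫ ≤ suppFn K (u j) +
      if j = i then ⟪p, u i⟫ - suppFn K (u i) else 0 := hx
    have hle : ∀ j, ⟪x - p, u j⟫ ≤ 0 := by
      intro j
      have := hx j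
      rw [inner_sub_left]
      by_cases hj : j = i
      · subst hj; rw [if_pos rfl] at this; linarith
      · rw [if_neg hj] at this; rw [hp j hj]; linarith
    have hray : ∀ k : ℝ, 0 ≤ k → p + k • (x - p) ∈ K := by
      intro k hk
      rw [hKrep]
      intro j
      have h1 := (hKrep p).1 hpK j
      have h2 := mul_nonneg hk (neg_nonneg.2 (hle j))
      rw [inner_add_left, inner_smul_left, conj_trivial]
      linarith
    obtain ⟨R, hR⟩ := hK.exists_norm_le
    by_contra hne
    have hpos : 0 < ‖x - p‖ := norm_pos_iff.2 (sub_ne_zero.2 hne)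
    have hR0 : 0 ≤ R := (norm_nonneg p).trans (hR p hpK)
    have h1 := hR _ (hray ((R + ‖p‖ + 1) / ‖x - p‖) (by positivity))
    have h2 := norm_sub_le (p + ((R + ‖p‖ + 1) / ‖x - p‖) • (x - p)) p
    rw [add_sub_cancel_left, norm_smul, Real.norm_of_nonneg (by positivity),
      div_mul_cancel₀ _ hpos.ne'] at h2
    linarith
  · rintro rfl j
    by_cases hj : j = i
    · subst hj; rw [if_pos rfl]; linarith
    · rw [if_neg hj, hp j hj, add_zero]

lemma movedPoly_neg (hKrep : ∀ x, x ∈ K ↔ ∀ j, ⟪x, u j⟫ ≤ suppFn K (u j)) {ε : ℝ} (hε : 0 < ε) :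
    movedPoly K u i (-ε) = K ∩ {x | ⟪x, u i⟫ ≤ suppFn K (u i) - ε} := by
  ext x
  rw [Set.mem_inter_iff, hKrep]
  constructor
  · intro hx
    have hx : ∀ j, ⟪x, u j⟫ ≤ suppFn K (u j) + if j = i then -ε else 0 := hx
    refine ⟨fun j => (hx j).trans ?_, ?_⟩
    · split_ifs <;> linarith
    · have := hx i
      rw [if_pos rfl] at this
      exact this
  · rintro ⟨hx, hxi⟩ j
    have hxi : ⟪x, u i⟫ ≤ suppFn K (u i) - ε := hxi
    by_cases hj : j = i
    · subst hj; rw [if_pos rfl]; linarith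
    · rw [if_neg hj, add_zero]; exact hx j

end MovedPolytope

section MixedVolScaling

variable {n : ℕ}

lemma mixedVol_vadd_smul_convexHull (s : Fin n → Finset (EuclideanSpace ℝ (Fin n)))
    (hs : ∀ i, (s i).Nonempty) {c : Fin n → ℝ} (hc : ∀ i, 0 ≤ c i)
    (v : Fin n → EuclideanSpace ℝ (Fin n)) :
    mixedVol n (fun i => v i +ᵥ c i • convexHull ℝ (s i : Set (EuclideanSpace ℝ (Fin n)))) =
      (∏ i, c i) * mixedVol n (fun i => convexHull ℝ (s i : Set (EuclideanSpace ℝ (Fin n)))) := by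
  rw [mixedVol_vadd, mixedVol_smul_convexHull s hs hc]

lemma prod_ite_Ioc {r : ℕ} (hr : r ≤ n - 1) (c : ℝ) :
    ∏ j : Fin n, (if (j : ℕ) = 0 then 1 else if (j : ℕ) ≤ r then c else 1) = c ^ r := by
  rw [Fin.prod_univ_eq_prod_range (fun j => if j = 0 then 1 else if j ≤ r then c else 1) n,
    ← Finset.prod_subset (s₁ := Finset.Ioc 0 r)]
  · rw [Finset.prod_congr rfl (g := fun _ => c)]
    · simp
    · intro j hj
      rw [Finset.mem_Ioc] at hj
      rw [if_neg (by omega), if_pos hj.2]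
  · intro j hj
    rw [Finset.mem_Ioc] at hj
    rw [Finset.mem_range]; omega
  · intro j _ hj
    rw [Finset.mem_Ioc] at hj
    by_cases h0 : j = 0
    · rw [if_pos h0]
    · rw [if_neg h0, if_neg (by omega)]

lemma mixedVol_homothetic {l s : Finset (EuclideanSpace ℝ (Fin n))} (hl : l.Nonempty)
    (hs : s.Nonempty) {r : ℕ} (hr : r ≤ n - 1) {c : ℝ} (hc : 0 ≤ c)
    (v : EuclideanSpace ℝ (Fin n)) :
    mixedVol n (fun j : Fin n => if (j : ℕ) = 0 then
        convexHull ℝ (l : Set (EuclideanSpace ℝ (Fin n))) else if (j : ℕ) ≤ r then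
          v +ᵥ c • convexHull ℝ (s : Set (EuclideanSpace ℝ (Fin n))) else
        convexHull ℝ (s : Set (EuclideanSpace ℝ (Fin n)))) =
      c ^ r * mixedVol n (fun j : Fin n => if (j : ℕ) = 0 then
        convexHull ℝ (l : Set (EuclideanSpace ℝ (Fin n))) else
        convexHull ℝ (s : Set (EuclideanSpace ℝ (Fin n)))) := by
  have h := mixedVol_vadd_smul_convexHull (n := n) (fun j => if (j : ℕ) = 0 then l else s)
    (fun j => by split_ifs; exacts [hl, hs])
    (c := fun j => if (j : ℕ) = 0 then 1 else if (j : ℕ) ≤ r then c else 1)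
    (fun j => by split_ifs; exacts [zero_le_one, hc, zero_le_one])
    (fun j => if (j : ℕ) = 0 then 0 else if (j : ℕ) ≤ r then v else 0)
  rw [prod_ite_Ioc hr] at h
  convert h using 2
  · ext1 j
    split_ifs <;> simp
  · congr 1
    ext1 j
    split_ifs <;> rfl

lemma mixedVol_vadd_smul_self {s : Finset (EuclideanSpace ℝ (Fin n))} (hn : 1 ≤ n)
    (hs : s.Nonempty) {c : ℝ} (hc : 0 ≤ c) (v : EuclideanSpace ℝ (Fin n)) :
    mixedVol n (fun j : Fin n => if (j : ℕ) = 0 then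
        v +ᵥ c • convexHull ℝ (s : Set (EuclideanSpace ℝ (Fin n))) else
        convexHull ℝ (s : Set (EuclideanSpace ℝ (Fin n)))) =
      c * mixedVol n (fun _ => convexHull ℝ (s : Set (EuclideanSpace ℝ (Fin n)))) := by
  have h := mixedVol_vadd_smul_convexHull (n := n) (fun _ => s) (fun _ => hs)
    (c := fun j => if (j : ℕ) = 0 then c else 1)
    (fun j => by split_ifs; exacts [hc, zero_le_one]) (fun j => if (j : ℕ) = 0 then v else 0)
  have hprod : ∏ j : Fin n, (if (j : ℕ) = 0 then c else 1) = c := by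
    rw [Fin.prod_univ_eq_prod_range (fun j => if j = 0 then c else 1) n, Finset.prod_ite_eq',
      if_pos (Finset.mem_range.2 hn)]
  rw [hprod] at h
  rw [← h]
  congr 1
  ext1 j
  split_ifs <;> simp

end MixedVolScaling

lemma msupport_zero {α : Type*} [TopologicalSpace α] [MeasurableSpace α] :
    msupport (0 : Measure α) = ∅ := by
  ext x
  simp only [Set.mem_empty_iff_false, iff_false]
  exact fun h => h Set.univ isOpen_univ trivial (by simp)

lemma measure_eq_zero_of_msupport_eq_empty {α : Type*} [TopologicalSpace α]
    [SecondCountableTopology α] [MeasurableSpace α] {ν : Measure α} (h : msupport ν = ∅) :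
    ν = 0 := by
  rw [← Measure.measure_univ_eq_zero]
  refine measure_null_of_locally_null _ fun x _ => ?_
  have hx : x ∉ msupport ν := by rw [h]; exact Set.notMem_empty x
  have hx : ¬ ∀ U : Set α, IsOpen U → x ∈ U → ν U ≠ 0 := hx
  push Not at hx
  obtain ⟨U, hU, hxU, h0⟩ := hx
  exact ⟨U, mem_nhdsWithin_of_mem_nhds (hU.mem_nhds hxU), h0⟩

/-- If the `n`-polytope `K` satisfies the Bezout inequality
`V(L,K_t,K[n-2]) V_n(K) ≤ V(L,K[n-1]) V(K_t,K[n-1])` for all convex bodies `L` and all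
`t ∈ (-δ,δ)` (with `δ` as in the support lemma), then
`S(K_t[r],K[n-1-r],·) = (V(K_t,K[n-1])/V_n(K))^r S(K,·)` for all `0 ≤ r ≤ n-1`, `t ∈ (-δ,δ)`. -/
theorem mixed_area_measures_proportional (n N : ℕ) (hn : 1 ≤ n)
    (K : Set (EuclideanSpace ℝ (Fin n))) (hK : IsConvexBody K)
    (hKdim : (interior K).Nonempty)
    (hKpoly : ∃ s : Finset (EuclideanSpace ℝ (Fin n)), K = convexHull ℝ (s : Set _))
    (u : Fin N → EuclideanSpace ℝ (Fin n)) (hu : ∀ j, ‖u j‖ = 1)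
    (huinj : Function.Injective u)
    (hKrep : K = ⋂ j : Fin N, {x | ⟪x, u j⟫ ≤ suppFn K (u j)})
    (hfacet : ∀ j : Fin N,
      μH[(n : ℝ) - 1] (K ∩ {x | ⟪x, u j⟫ = suppFn K (u j)}) ≠ 0)
    (i : Fin N) (δ : ℝ) (hδ : 0 < δ)
    (hsupp : ∀ r : ℕ, r ≤ n - 1 → ∀ t : ℝ, |t| < δ →
      ∀ μ ν : Measure (Metric.sphere (0 : EuclideanSpace ℝ (Fin n)) 1),
        IsMixedAreaMeasure n r (movedPoly K u i t) K μ →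
        IsMixedAreaMeasure n 0 K K ν → msupport μ = msupport ν)
    (hBez : ∀ t : ℝ, |t| < δ → ∀ L : Set (EuclideanSpace ℝ (Fin n)), IsConvexBody L →
      mixedVol n (fun j : Fin n =>
          if (j : ℕ) = 0 then L else if (j : ℕ) = 1 then movedPoly K u i t else K) *
          mixedVol n (fun _ => K) ≤
        mixedVol n (fun j : Fin n => if (j : ℕ) = 0 then L else K) *
          mixedVol n (fun j : Fin n => if (j : ℕ) = 0 then movedPoly K u i t else K)) :
    ∀ r : ℕ, r ≤ n - 1 → ∀ t : ℝ, |t| < δ →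
      ∀ μ ν : Measure (Metric.sphere (0 : EuclideanSpace ℝ (Fin n)) 1),
        IsMixedAreaMeasure n r (movedPoly K u i t) K μ →
        IsMixedAreaMeasure n 0 K K ν →
        μ = ENNReal.ofReal
              ((mixedVol n (fun j : Fin n => if (j : ℕ) = 0 then movedPoly K u i t else K) /
                mixedVol n (fun _ => K)) ^ r) • ν := by
  intro r hr t ht μ ν hμ hν
  obtain ⟨s, hKs⟩ := hKpoly
  have hsne : s.Nonempty := by
    have := hK.2.2
    rw [hKs] at this
    exact Finset.coe_nonempty.1 (convexHull_nonempty_iff.1 this)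
  have hrep : ∀ x, x ∈ K ↔ ∀ j, ⟪x, u j⟫ ≤ suppFn K (u j) := by
    intro x
    conv_lhs => rw [hKrep]
    exact Set.mem_iInter
  have hν' : ∀ l : Finset (EuclideanSpace ℝ (Fin n)), l.Nonempty →
      mixedVol n (fun j : Fin n => if (j : ℕ) = 0 then
        convexHull ℝ (l : Set (EuclideanSpace ℝ (Fin n))) else K) =
      (1 / n) * ∫ w : Metric.sphere (0 : EuclideanSpace ℝ (Fin n)) 1,
        suppFn (convexHull ℝ (l : Set (EuclideanSpace ℝ (Fin n))))
          (w : EuclideanSpace ℝ (Fin n)) ∂ν := by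
    intro l hl
    rw [← hν _ (isConvexBody_convexHull hl)]
    simp only [ite_self]
  rcases Nat.eq_zero_or_pos r with rfl | hr0
  · rw [pow_zero]
    refine (eq_smul_of_integral_suppFn hn hKs hKdim one_pos (fun l hl => ?_) hν').1
    rw [← hμ _ (isConvexBody_convexHull hl), one_mul]
    congr 1
    ext1 j
    split_ifs with h1 h2
    · rfl
    · exact absurd (Nat.le_zero.1 h2) h1
    · rfl
  have hνne : ν ≠ 0 := (eq_smul_of_integral_suppFn hn hKs hKdim one_pos
    (fun l hl => by rw [one_mul]; exact hν' l hl) hν').2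
  obtain ⟨m, rfl⟩ : ∃ m, n = m + 1 := ⟨n - 1, by omega⟩
  have hm : 1 ≤ m := by omega
  obtain ⟨p, hpK, hpi, hp⟩ := exists_apex_of_bezout hm hKdim hKs hu huinj hrep hfacet i hδ
    (fun ε hε hεδ L M hL hM hMK k κ a b c habc hpoly => by
      have hB := hBez (-ε) (by rwa [abs_neg, abs_of_pos hε]) _ (isConvexBody_convexHull hL)
      rw [movedPoly_neg hrep hε, ← hMK] at hB
      exact bezout_coefficients hm (convexHull_nonempty_iff.2 hL) (convexHull_nonempty_iff.2 hM)
        hK.1 hK.2.2 habc hpoly hB)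
  set H := suppFn K (u i) - ⟪p, u i⟫ with hH
  have hH0 : 0 < H := sub_pos.2 hpi
  have htH : -H < t := by
    by_contra hle
    have hle : t ≤ -H := not_lt.1 hle
    have hHδ : |⟪p, u i⟫ - suppFn K (u i)| < δ := by
      rw [← neg_sub, ← hH, abs_neg, abs_of_pos hH0]
      have := neg_abs_le t
      linarith
    have hzero : IsMixedAreaMeasure (m + 1) 1
        (movedPoly K u i (⟪p, u i⟫ - suppFn K (u i))) K 0 := by
      intro L _
      rw [movedPoly_eq_singleton hK.2.1.isBounded hrep hpK hp, integral_zero_measure, mul_zero]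
      exact mixedVol_eq_zero_of_singleton ⟨1, by omega⟩ (p := p) (by simp)
    have := hsupp 1 (by omega) _ hHδ 0 ν hzero hν
    rw [msupport_zero] at this
    exact hνne (measure_eq_zero_of_msupport_eq_empty this.symm)
  have hc : 0 < 1 + t / H := by
    rw [← neg_lt_iff_pos_add', lt_div_iff₀ hH0]; linarith
  have hmoved := movedPoly_eq_vadd_smul hrep hp (t := t) hc
    (by rw [← hH]; field_simp)
  have hV0 : 0 < mixedVol (m + 1) (fun _ => K) := by
    rw [mixedVol_const hK.1 hK.2.2]
    exact ENNReal.toReal_pos ((isOpen_interior.measure_pos volume hKdim).trans_le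
      (measure_mono interior_subset)).ne' hK.2.1.measure_lt_top.ne
  have hratio : mixedVol (m + 1) (fun j => if (j : ℕ) = 0 then movedPoly K u i t else K) /
      mixedVol (m + 1) (fun _ => K) = 1 + t / H := by
    rw [div_eq_iff hV0.ne', hmoved, hKs]
    exact mixedVol_vadd_smul_self hn hsne hc.le _
  rw [hratio]
  refine (eq_smul_of_integral_suppFn hn hKs hKdim (pow_pos hc r) (fun l hl => ?_) hν').1
  rw [← hμ _ (isConvexBody_convexHull hl), hmoved, hKs]
  exact (mixedVol_homothetic hl hsne hr hc.le _).symm
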